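/- Suppose the high temperature condition holds with parameters q ∈ [0,1) and K > 0. For each 1 ≤ i ≤ N let p_i := e^{β r_i + h}/(e^{β r_i + h} + e^{-β r_i - h}) and let ν_i be the (random) probability measure on ℝ with density p_i φ_{r_i + β(1-q), 1-q} + (1 - p_i) φ_{r_i - β(1-q), 1-q}. Then there exists a constant C depending only on β, h, K such that for every N ≥ 2 for which the high temperature condition holds, every bounded measurable u : ℝ → ℝ, and every 1 ≤ i ≤ N, E( ⟨u(ℓ_i)⟩ - ∫_ℝ u(x) ν_i(dx) )² ≤ C ‖u‖_∞² / √N. -/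

import Mathlib

open MeasureTheory ProbabilityTheory Real Finset

namespace SK

/-- Index set of pairs `i < j` in `Fin N`. -/
abbrev Pairs (N : ℕ) := {p : Fin N × Fin N // p.1 < p.2}

/-- The disorder: one real coordinate per pair. -/
abbrev Disorder (N : ℕ) := Pairs N → ℝ

/-- Law of the disorder: i.i.d. standard Gaussians. -/
noncomputable def μdis (N : ℕ) : Measure (Disorder N) :=
  Measure.pi fun _ => gaussianReal 0 1

/-- The symmetric extension `g_{ij}` of the disorder. -/
noncomputable def gval {N : ℕ} (G : Disorder N) (i j : Fin N) : ℝ :=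
  if hij : i < j then G ⟨(i, j), hij⟩ else if hji : j < i then G ⟨(j, i), hji⟩ else 0

abbrev Config (N : ℕ) := Fin N → Bool

/-- Spins `±1`. -/
def spin (b : Bool) : ℝ := if b then 1 else -1

/-- (Negative) Hamiltonian of the SK model. -/
noncomputable def ham {N : ℕ} (β h : ℝ) (G : Disorder N) (σ : Config N) : ℝ :=
  (β / Real.sqrt N) * ∑ p : Pairs N, G p * spin (σ p.1.1) * spin (σ p.1.2)
    + h * ∑ i, spin (σ i)

/-- Partition function. -/
noncomputable def Zpart {N : ℕ} (β h : ℝ) (G : Disorder N) : ℝ :=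
  ∑ σ : Config N, Real.exp (ham β h G σ)

/-- Gibbs measure. -/
noncomputable def gibbs {N : ℕ} (β h : ℝ) (G : Disorder N) (σ : Config N) : ℝ :=
  Real.exp (ham β h G σ) / Zpart β h G

/-- Quenched average of a function of one replica. -/
noncomputable def qavg {N : ℕ} (β h : ℝ) (G : Disorder N) (f : Config N → ℝ) : ℝ :=
  ∑ σ : Config N, f σ * gibbs β h G σ

/-- Quenched average of a function of two replicas. -/
noncomputable def qavg2 {N : ℕ} (β h : ℝ) (G : Disorder N)
    (f : Config N → Config N → ℝ) : ℝ :=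
  ∑ σ1 : Config N, ∑ σ2 : Config N, f σ1 σ2 * gibbs β h G σ1 * gibbs β h G σ2

/-- Overlap of two configurations. -/
noncomputable def overlap {N : ℕ} (σ1 σ2 : Config N) : ℝ :=
  (1 / (N : ℝ)) * ∑ i, spin (σ1 i) * spin (σ2 i)

/-- The high temperature condition `E⟨(R₁₂ - q)⁴⟩ ≤ K/N²`. -/
def highTemp (N : ℕ) (β h q K : ℝ) : Prop :=
  ∫ G, qavg2 β h G (fun σ1 σ2 => (overlap σ1 σ2 - q) ^ 4) ∂(μdis N) ≤ K / (N : ℝ) ^ 2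

/-- Magnetization `⟨σ_i⟩`. -/
noncomputable def mavg {N : ℕ} (β h : ℝ) (G : Disorder N) (i : Fin N) : ℝ :=
  qavg β h G fun σ => spin (σ i)

/-- Local field `ℓ_i`. -/
noncomputable def locField {N : ℕ} (G : Disorder N) (i : Fin N) (σ : Config N) : ℝ :=
  (1 / Real.sqrt N) * ∑ j ∈ Finset.univ.erase i, gval G i j * spin (σ j)

/-- The field `r_i`. -/
noncomputable def rfield {N : ℕ} (β h q : ℝ) (G : Disorder N) (i : Fin N) : ℝ :=
  (1 / Real.sqrt N) * ∑ j ∈ Finset.univ.erase i, gval G i j * mavg β h G j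
    - β * (1 - q) * mavg β h G i

/-- Gaussian density `φ_{μ,v}` with mean `μ` and variance `v`. -/
noncomputable def gaussDens (μ v x : ℝ) : ℝ :=
  (1 / (Real.sqrt (2 * π) * Real.sqrt v)) * Real.exp (-(x - μ) ^ 2 / (2 * v))

/-- Mixture-Gaussian density `ψ_{a,b,μ,v}`. -/
noncomputable def mixDens (a b μ v x : ℝ) : ℝ :=
  Real.cosh (a * x + b) * Real.exp (-(x - μ) ^ 2 / (2 * v)) /
    (Real.sqrt (2 * π) * Real.sqrt v * Real.cosh (a * μ + b) * Real.exp (a ^ 2 * v / 2))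

/-- Cauchy-Schwarz for real integrals. -/
lemma sq_integral_mul_le {α : Type*} [MeasurableSpace α] (μ : Measure α) {a b : α → ℝ}
    (ha : Integrable (fun x => a x ^ 2) μ) (hb : Integrable (fun x => b x ^ 2) μ)
    (hab : Integrable (fun x => a x * b x) μ) :
    (∫ x, a x * b x ∂μ) ^ 2 ≤ (∫ x, a x ^ 2 ∂μ) * ∫ x, b x ^ 2 ∂μ := by
  have h : ∀ t : ℝ, 0 ≤ (∫ x, a x ^ 2 ∂μ) * (t * t) + (2 * ∫ x, a x * b x ∂μ) * t
      + ∫ x, b x ^ 2 ∂μ := by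
    intro t
    have h1 : 0 ≤ ∫ x, (a x * t + b x) ^ 2 ∂μ := integral_nonneg fun x => sq_nonneg _
    have h2 : ∫ x, (a x * t + b x) ^ 2 ∂μ
        = ∫ x, ((t * t) * a x ^ 2 + (2 * t) * (a x * b x) + b x ^ 2) ∂μ := by
      congr 1; ext x; ring
    have i1 : Integrable (fun x => (t * t) * a x ^ 2 + (2 * t) * (a x * b x)) μ :=
      (ha.const_mul _).add (hab.const_mul _)
    rw [h2, integral_add i1 hb, integral_add (ha.const_mul _) (hab.const_mul _),
      integral_const_mul, integral_const_mul] at h1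
    linarith
  have := discrim_le_zero h
  unfold discrim at this
  linarith

/-- Difference of two integrals against densities, bounded through the Hellinger affinity. -/
lemma sq_integral_sub_le_affinity {α : Type*} [MeasurableSpace α] (μ : Measure α)
    {p p₀ F : α → ℝ} (hp : ∀ x, 0 ≤ p x) (hp₀ : ∀ x, 0 ≤ p₀ x)
    (hpm : Measurable p) (hpm₀ : Measurable p₀) (hF : Measurable F)
    (hpi : Integrable p μ) (hpi₀ : Integrable p₀ μ)
    (hFp : Integrable (fun x => F x ^ 2 * p x) μ)
    (hFp₀ : Integrable (fun x => F x ^ 2 * p₀ x) μ) :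
    (∫ x, F x * p x ∂μ - ∫ x, F x * p₀ x ∂μ) ^ 2 ≤
      2 * (∫ x, F x ^ 2 * p x ∂μ + ∫ x, F x ^ 2 * p₀ x ∂μ)
        * (∫ x, p x ∂μ + ∫ x, p₀ x ∂μ - 2 * ∫ x, √(p x * p₀ x) ∂μ) := by
  have hs : ∀ x, √(p x) ^ 2 = p x := fun x => Real.sq_sqrt (hp x)
  have hs₀ : ∀ x, √(p₀ x) ^ 2 = p₀ x := fun x => Real.sq_sqrt (hp₀ x)
  have i1 : ∀ q : α → ℝ, Measurable q → (∀ x, 0 ≤ q x) → Integrable q μ →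
      Integrable (fun x => F x ^ 2 * q x) μ → Integrable (fun x => F x * q x) μ := by
    intro q hqm hq hqi hFq
    refine Integrable.mono' (hqi.add hFq) (hF.mul hqm).aestronglyMeasurable (.of_forall fun x => ?_)
    rw [Real.norm_eq_abs, abs_mul, abs_of_nonneg (hq x)]
    have : |F x| ≤ 1 + F x ^ 2 := by nlinarith [sq_abs (F x), sq_nonneg (|F x| - 1)]
    have := mul_le_mul_of_nonneg_right this (hq x)
    simp only [Pi.add_apply]; linarith
  have isq : Integrable (fun x => √(p x * p₀ x)) μ := by
    refine Integrable.mono' (hpi.add hpi₀) (by fun_prop) (.of_forall fun x => ?_)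
    rw [Real.norm_eq_abs, abs_of_nonneg (Real.sqrt_nonneg _), Real.sqrt_mul (hp x)]
    simp only [Pi.add_apply]
    nlinarith [hs x, hs₀ x, sq_nonneg (√(p x) - √(p₀ x)), hp x, hp₀ x]
  have e1 : ∀ x, (F x * (√(p x) + √(p₀ x))) * (√(p x) - √(p₀ x)) = F x * p x - F x * p₀ x := by
    intro x
    have := hs x; have := hs₀ x
    calc _ = F x * (√(p x) ^ 2 - √(p₀ x) ^ 2) := by ring
      _ = _ := by rw [hs, hs₀]; ring
  have e2 : ∀ x, (√(p x) - √(p₀ x)) ^ 2 = p x + p₀ x - 2 * √(p x * p₀ x) := by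
    intro x
    rw [Real.sqrt_mul (hp x)]
    nlinarith [hs x, hs₀ x]
  have e3 : ∀ x, (F x * (√(p x) + √(p₀ x))) ^ 2 ≤ 2 * (F x ^ 2 * p x + F x ^ 2 * p₀ x) := by
    intro x
    have : (√(p x) + √(p₀ x)) ^ 2 ≤ 2 * (p x + p₀ x) := by
      nlinarith [hs x, hs₀ x, sq_nonneg (√(p x) - √(p₀ x))]
    nlinarith [mul_le_mul_of_nonneg_left this (sq_nonneg (F x))]
  have i3 : Integrable (fun x => 2 * (F x ^ 2 * p x + F x ^ 2 * p₀ x)) μ :=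
    (hFp.add hFp₀).const_mul 2
  have i4 : Integrable (fun x => (F x * (√(p x) + √(p₀ x))) ^ 2) μ := by
    refine Integrable.mono' i3 (by fun_prop) (.of_forall fun x => ?_)
    rw [Real.norm_eq_abs, abs_of_nonneg (sq_nonneg _)]
    exact e3 x
  have i5 : Integrable (fun x => (√(p x) - √(p₀ x)) ^ 2) μ := by
    simp_rw [e2]; exact (hpi.add hpi₀).sub (isq.const_mul 2)
  have j1 := i1 p hpm hp hpi hFp
  have j2 := i1 p₀ hpm₀ hp₀ hpi₀ hFp₀
  have i6 : Integrable (fun x => (F x * (√(p x) + √(p₀ x))) * (√(p x) - √(p₀ x))) μ := by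
    simp_rw [e1]; exact j1.sub j2
  have ipp : Integrable (fun x => p x + p₀ x) μ := hpi.add hpi₀
  have key := sq_integral_mul_le μ i4 i5 i6
  simp_rw [e1, e2] at key
  rw [integral_sub j1 j2, integral_sub ipp (isq.const_mul 2), integral_const_mul] at key
  have e7 : ∫ x, (p x + p₀ x) ∂μ = ∫ x, p x ∂μ + ∫ x, p₀ x ∂μ := integral_add hpi hpi₀
  have e8 : ∫ x, (F x * (√(p x) + √(p₀ x))) ^ 2 ∂μ
      ≤ 2 * (∫ x, F x ^ 2 * p x ∂μ + ∫ x, F x ^ 2 * p₀ x ∂μ) := by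
    rw [← integral_add hFp hFp₀, ← integral_const_mul]
    exact integral_mono i4 i3 e3
  have e9 : 0 ≤ ∫ x, (p x + p₀ x) ∂μ - 2 * ∫ x, √(p x * p₀ x) ∂μ := by
    have : 0 ≤ ∫ x, (√(p x) - √(p₀ x)) ^ 2 ∂μ := integral_nonneg fun x => sq_nonneg _
    simp_rw [e2] at this
    rwa [integral_sub ipp (isq.const_mul 2), integral_const_mul] at this
  rw [← e7]
  exact key.trans (mul_le_mul_of_nonneg_right e8 e9)

/-- Hellinger affinity of two Gaussian densities. -/
lemma integral_sqrt_gaussianPDFReal_mul (μ μ₀ : ℝ) {a b : NNReal} (ha : 0 < a) (hb : 0 < b) :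
    ∫ x, √(gaussianPDFReal μ a x * gaussianPDFReal μ₀ b x)
      = √(2 * √(a * b) / (a + b)) * exp (-(μ - μ₀) ^ 2 / (4 * (a + b))) := by
  have ha' : (0 : ℝ) < a := by exact_mod_cast ha
  have hb' : (0 : ℝ) < b := by exact_mod_cast hb
  set m : ℝ := (μ * b + μ₀ * a) / (a + b) with hm
  set k : ℝ := (a + b) / (4 * (a * b)) with hk
  have hpt : ∀ x, √(gaussianPDFReal μ a x * gaussianPDFReal μ₀ b x)
      = (√(√(2 * π * a) * √(2 * π * b)))⁻¹ * exp (-(μ - μ₀) ^ 2 / (4 * (a + b)))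
        * exp (-k * (x - m) ^ 2) := by
    intro x
    rw [gaussianPDFReal, gaussianPDFReal]
    have : (√(2 * π * a))⁻¹ * exp (-(x - μ) ^ 2 / (2 * a))
        * ((√(2 * π * b))⁻¹ * exp (-(x - μ₀) ^ 2 / (2 * b)))
        = (√(2 * π * a) * √(2 * π * b))⁻¹
          * (exp (-(μ - μ₀) ^ 2 / (4 * (a + b))) * exp (-k * (x - m) ^ 2)) ^ 2 := by
      rw [mul_inv, ← exp_add, ← exp_nat_mul]
      have : ((2 : ℕ) : ℝ) * (-(μ - μ₀) ^ 2 / (4 * (a + b)) + -k * (x - m) ^ 2)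
          = -(x - μ) ^ 2 / (2 * a) + -(x - μ₀) ^ 2 / (2 * b) := by
        rw [hk, hm]; push_cast; field_simp; ring
      rw [this, exp_add]; ring
    rw [this, Real.sqrt_mul (by positivity), Real.sqrt_sq (by positivity), Real.sqrt_inv]
    ring
  simp_rw [hpt]
  rw [integral_const_mul]
  have hsh : ∫ x, exp (-k * (x - m) ^ 2) = √(π / k) := by
    rw [integral_sub_right_eq_self (fun x => exp (-k * x ^ 2)) m]
    exact integral_gaussian k
  rw [hsh]
  have : (√(√(2 * π * a) * √(2 * π * b)))⁻¹ * √(π / k) = √(2 * √(a * b) / (a + b)) := by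
    rw [← Real.sqrt_inv, ← Real.sqrt_mul (by positivity)]
    congr 1
    have h1 : √(2 * π * a) * √(2 * π * b) = 2 * π * √(a * b) := by
      rw [← Real.sqrt_mul (by positivity)]
      rw [show 2 * π * (a : ℝ) * (2 * π * b) = (2 * π) ^ 2 * (a * b) by ring,
        Real.sqrt_mul (by positivity), Real.sqrt_sq (by positivity)]
    rw [h1, hk]
    have h2 : √((a : ℝ) * b) ^ 2 = a * b := Real.sq_sqrt (by positivity)
    have h3 : 0 < √((a : ℝ) * b) := by positivity
    field_simp
    rw [h2]; ring
  rw [← this]; ring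

lemma one_sub_affinity_le (μ μ₀ : ℝ) {a b : ℝ} (ha : 0 < a) (hb : 0 < b) :
    1 - √(2 * √(a * b) / (a + b)) * exp (-(μ - μ₀) ^ 2 / (4 * (a + b)))
      ≤ (a - b) ^ 2 / (a + b) ^ 2 + (μ - μ₀) ^ 2 / (4 * (a + b)) := by
  have hab : 0 < a + b := by positivity
  have h0 : √(a * b) = √a * √b := Real.sqrt_mul ha.le _
  have hsa : √a ^ 2 = a := Real.sq_sqrt ha.le
  have hsb : √b ^ 2 = b := Real.sq_sqrt hb.le
  have pa : 0 < √a := by positivity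
  have pb : 0 < √b := by positivity
  set y : ℝ := 2 * √(a * b) / (a + b) with hy
  have hy0 : 0 ≤ y := by positivity
  have hy1 : y ≤ 1 := by
    rw [hy, div_le_one hab, h0]; nlinarith [sq_nonneg (√a - √b)]
  have h1 : y ≤ √y := by
    have h2 : √y ≤ 1 := Real.sqrt_le_one.mpr hy1
    nlinarith [Real.sq_sqrt hy0, Real.sqrt_nonneg y]
  have h3 : 1 - y ≤ (a - b) ^ 2 / (a + b) ^ 2 := by
    have : 1 - y = (√a - √b) ^ 2 / (a + b) := by
      rw [hy, h0]; field_simp; nlinarith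
    rw [this, div_le_div_iff₀ hab (by positivity)]
    have e : (a - b) ^ 2 = (√a - √b) ^ 2 * (√a + √b) ^ 2 := by
      rw [← hsa, ← hsb]; simp only [Real.sqrt_sq pa.le, Real.sqrt_sq pb.le]; ring
    have : a + b ≤ (√a + √b) ^ 2 := by nlinarith
    rw [e]
    have h5 : 0 ≤ (√a - √b) ^ 2 * (a + b) := by positivity
    nlinarith
  have h4 := Real.add_one_le_exp (-(μ - μ₀) ^ 2 / (4 * (a + b)))
  have h5 : exp (-(μ - μ₀) ^ 2 / (4 * (a + b))) ≤ 1 := by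
    rw [Real.exp_le_one_iff]; apply div_nonpos_of_nonpos_of_nonneg <;> nlinarith [sq_nonneg (μ - μ₀)]
  have h6 : -(μ - μ₀) ^ 2 / (4 * (a + b)) = -((μ - μ₀) ^ 2 / (4 * (a + b))) := by ring
  have h7 : √y ≤ 1 := Real.sqrt_le_one.mpr hy1
  have h8 := Real.exp_pos (-(μ - μ₀) ^ 2 / (4 * (a + b)))
  nlinarith [mul_nonneg (sub_nonneg.2 h7) (sub_nonneg.2 h5)]

/-- Total variation bound between one-dimensional Gaussians. -/
lemma sq_integral_gaussianReal_sub_le {u : ℝ → ℝ} (hu : Measurable u) {M : ℝ}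
    (hM : ∀ x, |u x| ≤ M) (μ μ₀ : ℝ) (a : NNReal) {b : NNReal} (hb : 0 < b) :
    (∫ x, u x ∂(gaussianReal μ a) - ∫ x, u x ∂(gaussianReal μ₀ b)) ^ 2
      ≤ 8 * M ^ 2 * (((a : ℝ) - b) ^ 2 / b ^ 2 + (μ - μ₀) ^ 2 / b) := by
  have hb' : (0 : ℝ) < b := by exact_mod_cast hb
  have hM0 : 0 ≤ M := (abs_nonneg _).trans (hM 0)
  have hbd : ∀ ν : Measure ℝ, IsProbabilityMeasure ν → |∫ x, u x ∂ν| ≤ M := by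
    intro ν hν
    have := norm_integral_le_of_norm_le_const (μ := ν) (f := u) (C := M) (.of_forall hM)
    simpa using this
  rcases eq_or_lt_of_le (zero_le (a := a)) with ha | ha
  · subst ha
    have h1 := hbd (gaussianReal μ 0) inferInstance
    have h2 := hbd (gaussianReal μ₀ b) inferInstance
    rw [abs_le] at h1 h2
    have h3 : (1 : ℝ) ≤ (((0 : NNReal) : ℝ) - b) ^ 2 / b ^ 2 + (μ - μ₀) ^ 2 / b := by
      have : (((0 : NNReal) : ℝ) - b) ^ 2 / b ^ 2 = 1 := by
        simp [hb'.ne']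
      have : 0 ≤ (μ - μ₀) ^ 2 / b := by positivity
      linarith
    have h4 := mul_le_mul_of_nonneg_left h3 (by positivity : 0 ≤ 8 * M ^ 2)
    nlinarith
  · have ha' : (0 : ℝ) < a := by exact_mod_cast ha
    have hsq_int : ∀ (m : ℝ) (c : NNReal), Integrable (fun x => u x ^ 2 * gaussianPDFReal m c x) := by
      intro m c
      refine (integrable_gaussianPDFReal m c).bdd_mul (c := M ^ 2) (by fun_prop) (.of_forall fun x => ?_)
      rw [Real.norm_eq_abs, abs_of_nonneg (sq_nonneg _), ← sq_abs]
      exact pow_le_pow_left₀ (abs_nonneg _) (hM x) 2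
    have hle : ∀ (m : ℝ) (c : NNReal), 0 < c → ∫ x, u x ^ 2 * gaussianPDFReal m c x ≤ M ^ 2 := by
      intro m c hc
      calc ∫ x, u x ^ 2 * gaussianPDFReal m c x ≤ ∫ x, M ^ 2 * gaussianPDFReal m c x := by
            refine integral_mono (hsq_int m c) ((integrable_gaussianPDFReal m c).const_mul _) fun x => ?_
            refine mul_le_mul_of_nonneg_right ?_ (gaussianPDFReal_nonneg _ _ _)
            rw [← sq_abs]; exact pow_le_pow_left₀ (abs_nonneg _) (hM x) 2
        _ = M ^ 2 := by rw [integral_const_mul, integral_gaussianPDFReal_eq_one _ hc.ne', mul_one]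
    have key := sq_integral_sub_le_affinity volume (gaussianPDFReal_nonneg μ a)
      (gaussianPDFReal_nonneg μ₀ b) (measurable_gaussianPDFReal _ _) (measurable_gaussianPDFReal _ _)
      hu (integrable_gaussianPDFReal _ _) (integrable_gaussianPDFReal _ _) (hsq_int _ _) (hsq_int _ _)
    rw [integral_gaussianPDFReal_eq_one _ ha.ne', integral_gaussianPDFReal_eq_one _ hb.ne',
      integral_sqrt_gaussianPDFReal_mul μ μ₀ ha hb] at key
    rw [integral_gaussianReal_eq_integral_smul ha.ne', integral_gaussianReal_eq_integral_smul hb.ne']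
    simp only [smul_eq_mul]
    simp_rw [mul_comm _ (u _)]
    have h1 := one_sub_affinity_le μ μ₀ ha' hb'
    have h2 : ((a : ℝ) - b) ^ 2 / (a + b) ^ 2 ≤ ((a : ℝ) - b) ^ 2 / b ^ 2 := by
      gcongr; linarith
    have h3 : (μ - μ₀) ^ 2 / (4 * ((a : ℝ) + b)) ≤ (μ - μ₀) ^ 2 / b := by
      gcongr; linarith
    have h4 := hle μ a ha
    have h5 := hle μ₀ b hb
    refine key.trans ?_
    set α := √(2 * √((a : ℝ) * b) / (a + b)) * exp (-(μ - μ₀) ^ 2 / (4 * (a + b)))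
    set δ := ((a : ℝ) - b) ^ 2 / b ^ 2 + (μ - μ₀) ^ 2 / b
    have hδ : 0 ≤ δ := by positivity
    have h6 : 1 + 1 - 2 * α ≤ 2 * δ := by linarith
    have h00 : 0 ≤ ∫ x, u x ^ 2 * gaussianPDFReal μ a x :=
      integral_nonneg fun x => mul_nonneg (sq_nonneg _) (gaussianPDFReal_nonneg _ _ _)
    have h01 : 0 ≤ ∫ x, u x ^ 2 * gaussianPDFReal μ₀ b x :=
      integral_nonneg fun x => mul_nonneg (sq_nonneg _) (gaussianPDFReal_nonneg _ _ _)
    calc _ ≤ 2 * ((∫ x, u x ^ 2 * gaussianPDFReal μ a x) + ∫ x, u x ^ 2 * gaussianPDFReal μ₀ b x) * (2 * δ) := by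
          refine mul_le_mul_of_nonneg_left h6 (by linarith)
      _ ≤ 2 * (M ^ 2 + M ^ 2) * (2 * δ) := by gcongr
      _ = _ := by ring

/-- A centred Gaussian measure on the plane with independent coordinates. -/
noncomputable def gaussPlane (a b : NNReal) : Measure (ℝ × ℝ) :=
  (gaussianReal 0 a).prod (gaussianReal 0 b)

instance (a b : NNReal) : IsProbabilityMeasure (gaussPlane a b) := by
  unfold gaussPlane; infer_instance

lemma gaussPlane_eq_withDensity {a b : NNReal} (ha : a ≠ 0) (hb : b ≠ 0) :
    gaussPlane a b = (volume.prod volume).withDensity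
      fun z : ℝ × ℝ => ENNReal.ofReal (gaussianPDFReal 0 a z.1 * gaussianPDFReal 0 b z.2) := by
  rw [gaussPlane, gaussianReal_of_var_ne_zero _ ha, gaussianReal_of_var_ne_zero _ hb,
    prod_withDensity (measurable_gaussianPDF _ _) (measurable_gaussianPDF _ _)]
  congr 1
  ext z
  rw [ENNReal.ofReal_mul (gaussianPDFReal_nonneg _ _ _)]
  rfl

lemma sq_integral_le_integral_sq {α : Type*} [MeasurableSpace α] (μ : Measure α)
    [IsProbabilityMeasure μ] {F : α → ℝ} (hF : Measurable F)
    (h2 : Integrable (fun x => F x ^ 2) μ) :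
    Integrable F μ ∧ (∫ x, F x ∂μ) ^ 2 ≤ ∫ x, F x ^ 2 ∂μ := by
  have h1 : Integrable F μ := by
    refine Integrable.mono' ((integrable_const (1 : ℝ)).add h2) hF.aestronglyMeasurable
      (.of_forall fun x => ?_)
    rw [Real.norm_eq_abs]
    simp only [Pi.add_apply]
    nlinarith [sq_abs (F x), sq_nonneg (|F x| - 1)]
  refine ⟨h1, ?_⟩
  have := sq_integral_mul_le μ (a := fun _ => (1 : ℝ)) (b := F) (by simp) h2 (by simpa using h1)
  simpa using this

/-- Lipschitz dependence of a Gaussian expectation on the variances, when their sum is fixed. -/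
lemma abs_integral_gaussPlane_sub_le {F : ℝ × ℝ → ℝ} (hF : Measurable F) {B : ℝ} (hB : 0 ≤ B)
    {a b a₀ b₀ : NNReal} (hb₀ : 0 < b₀) (hab₀ : b₀ ≤ a₀) (hsum : a + b = a₀ + b₀)
    (hi : Integrable (fun z => F z ^ 2) (gaussPlane a b))
    (hi₀ : Integrable (fun z => F z ^ 2) (gaussPlane a₀ b₀))
    (hle : ∫ z, F z ^ 2 ∂(gaussPlane a b) ≤ B ^ 2)
    (hle₀ : ∫ z, F z ^ 2 ∂(gaussPlane a₀ b₀) ≤ B ^ 2) :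
    |∫ z, F z ∂(gaussPlane a b) - ∫ z, F z ∂(gaussPlane a₀ b₀)| ≤ 4 * B * |(a : ℝ) - a₀| / b₀ := by
  have hb₀' : (0 : ℝ) < b₀ := by exact_mod_cast hb₀
  have hab₀' : (b₀ : ℝ) ≤ a₀ := by exact_mod_cast hab₀
  have hsum' : (a : ℝ) + b = a₀ + b₀ := by exact_mod_cast hsum
  have ha₀' : (0 : ℝ) < a₀ := by linarith
  have ha₀ : 0 < a₀ := by exact_mod_cast ha₀'
  have e1 : |∫ z, F z ∂(gaussPlane a b)| ≤ B :=
    abs_le_of_sq_le_sq ((sq_integral_le_integral_sq _ hF hi).2.trans hle) hB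
  have e2 : |∫ z, F z ∂(gaussPlane a₀ b₀)| ≤ B :=
    abs_le_of_sq_le_sq ((sq_integral_le_integral_sq _ hF hi₀).2.trans hle₀) hB
  have triv : (b₀ : ℝ) ≤ |(a : ℝ) - a₀| →
      |∫ z, F z ∂(gaussPlane a b) - ∫ z, F z ∂(gaussPlane a₀ b₀)| ≤ 4 * B * |(a : ℝ) - a₀| / b₀ := by
    intro h
    rw [le_div_iff₀ hb₀']
    have h3 := (abs_sub (∫ z, F z ∂(gaussPlane a b)) (∫ z, F z ∂(gaussPlane a₀ b₀)))
    have h4 : |∫ z, F z ∂(gaussPlane a b) - ∫ z, F z ∂(gaussPlane a₀ b₀)| ≤ 2 * B := by linarith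
    calc _ ≤ 2 * B * b₀ := by gcongr
      _ ≤ 2 * B * |(a : ℝ) - a₀| := by gcongr
      _ ≤ _ := by have : 0 ≤ B * |(a : ℝ) - a₀| := by positivity
                  linarith
  rcases eq_or_ne a 0 with rfl | ha
  · apply triv
    rw [NNReal.coe_zero, zero_sub, abs_neg, abs_of_pos ha₀']; exact hab₀'
  rcases eq_or_ne b 0 with rfl | hb
  · apply triv
    rw [NNReal.coe_zero] at hsum'
    rw [show (a : ℝ) - a₀ = b₀ by linarith, abs_of_pos hb₀']
  have ha' : (0 : ℝ) < a := by exact_mod_cast pos_iff_ne_zero.2 ha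
  have hb' : (0 : ℝ) < b := by exact_mod_cast pos_iff_ne_zero.2 hb
  have dens : ∀ (c d : NNReal), c ≠ 0 → d ≠ 0 → ∀ H : ℝ × ℝ → ℝ,
      ∫ z, H z ∂(gaussPlane c d)
        = ∫ z, H z * (gaussianPDFReal 0 c z.1 * gaussianPDFReal 0 d z.2) ∂(volume.prod volume) := by
    intro c d hc hd H
    rw [gaussPlane_eq_withDensity hc hd, integral_withDensity_eq_integral_toReal_smul
      (by fun_prop) (.of_forall fun z => ENNReal.ofReal_lt_top)]
    congr 1; ext z
    rw [ENNReal.toReal_ofReal (mul_nonneg (gaussianPDFReal_nonneg _ _ _)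
      (gaussianPDFReal_nonneg _ _ _)), smul_eq_mul, mul_comm]
  have densi : ∀ (c d : NNReal), c ≠ 0 → d ≠ 0 → ∀ H : ℝ × ℝ → ℝ,
      Integrable H (gaussPlane c d) →
        Integrable (fun z => H z * (gaussianPDFReal 0 c z.1 * gaussianPDFReal 0 d z.2))
          (volume.prod volume) := by
    intro c d hc hd H hH
    rw [gaussPlane_eq_withDensity hc hd, integrable_withDensity_iff
      (by fun_prop) (.of_forall fun z => ENNReal.ofReal_lt_top)] at hH
    refine hH.congr (.of_forall fun z => ?_)
    simp only []
    rw [ENNReal.toReal_ofReal (mul_nonneg (gaussianPDFReal_nonneg _ _ _)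
      (gaussianPDFReal_nonneg _ _ _))]
  have pint : ∀ (c d : NNReal), Integrable
      (fun z : ℝ × ℝ => gaussianPDFReal 0 c z.1 * gaussianPDFReal 0 d z.2) (volume.prod volume) :=
    fun c d => (integrable_gaussianPDFReal 0 c).mul_prod (integrable_gaussianPDFReal 0 d)
  have pone : ∀ (c d : NNReal), c ≠ 0 → d ≠ 0 →
      ∫ z : ℝ × ℝ, gaussianPDFReal 0 c z.1 * gaussianPDFReal 0 d z.2 ∂(volume.prod volume) = 1 := by
    intro c d hc hd
    rw [integral_prod_mul, integral_gaussianPDFReal_eq_one _ hc,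
      integral_gaussianPDFReal_eq_one _ hd, one_mul]
  have key := sq_integral_sub_le_affinity (volume.prod volume)
    (p := fun z : ℝ × ℝ => gaussianPDFReal 0 a z.1 * gaussianPDFReal 0 b z.2)
    (p₀ := fun z : ℝ × ℝ => gaussianPDFReal 0 a₀ z.1 * gaussianPDFReal 0 b₀ z.2)
    (fun z => mul_nonneg (gaussianPDFReal_nonneg _ _ _) (gaussianPDFReal_nonneg _ _ _))
    (fun z => mul_nonneg (gaussianPDFReal_nonneg _ _ _) (gaussianPDFReal_nonneg _ _ _))
    (by fun_prop) (by fun_prop) hF (pint _ _) (pint _ _) (densi _ _ ha hb _ hi)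
    (densi _ _ ha₀.ne' hb₀.ne' _ hi₀)
  rw [pone a b ha hb, pone a₀ b₀ ha₀.ne' hb₀.ne', ← dens a b ha hb, ← dens a b ha hb,
    ← dens a₀ b₀ ha₀.ne' hb₀.ne', ← dens a₀ b₀ ha₀.ne' hb₀.ne'] at key
  have aff : ∫ z : ℝ × ℝ, √(gaussianPDFReal 0 a z.1 * gaussianPDFReal 0 b z.2 *
        (gaussianPDFReal 0 a₀ z.1 * gaussianPDFReal 0 b₀ z.2)) ∂(volume.prod volume)
      = √(2 * √(a * a₀) / (a + a₀)) * √(2 * √(b * b₀) / (b + b₀)) := by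
    have h1 := integral_sqrt_gaussianPDFReal_mul 0 0 (pos_iff_ne_zero.2 ha) ha₀
    have h2 := integral_sqrt_gaussianPDFReal_mul 0 0 (pos_iff_ne_zero.2 hb) hb₀
    simp only [sub_self, ne_eq, OfNat.ofNat_ne_zero, not_false_eq_true, zero_pow, neg_zero,
      zero_div, exp_zero, mul_one] at h1 h2
    rw [← h1, ← h2, ← integral_prod_mul]
    congr 1; ext z
    rw [← Real.sqrt_mul (mul_nonneg (gaussianPDFReal_nonneg _ _ _) (gaussianPDFReal_nonneg _ _ _))]
    congr 1; ring
  rw [aff] at key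
  have h1 := one_sub_affinity_le 0 0 ha' ha₀'
  have h2 := one_sub_affinity_le 0 0 hb' hb₀'
  simp only [sub_self, ne_eq, OfNat.ofNat_ne_zero, not_false_eq_true, zero_pow, neg_zero,
    zero_div, exp_zero, mul_one, add_zero] at h1 h2
  have ubd : ∀ c d : ℝ, 0 < c → 0 < d → √(2 * √(c * d) / (c + d)) ≤ 1 := by
    intro c d hc hd
    rw [Real.sqrt_le_one, div_le_one (by positivity), Real.sqrt_mul hc.le]
    nlinarith [sq_nonneg (√c - √d), Real.sq_sqrt hc.le, Real.sq_sqrt hd.le]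
  have u1 := ubd a a₀ ha' ha₀'
  have u2 := ubd b b₀ hb' hb₀'
  set α := √(2 * √((a : ℝ) * a₀) / (a + a₀))
  set α' := √(2 * √((b : ℝ) * b₀) / (b + b₀))
  set δ := |(a : ℝ) - a₀| / b₀ with hδ
  have h3 : ((a : ℝ) - a₀) ^ 2 / (a + a₀) ^ 2 ≤ δ ^ 2 := by
    rw [hδ, div_pow, sq_abs]; gcongr; linarith
  have h4 : ((b : ℝ) - b₀) ^ 2 / (b + b₀) ^ 2 ≤ δ ^ 2 := by
    rw [hδ, div_pow, sq_abs, show (b : ℝ) - b₀ = -((a : ℝ) - a₀) by linarith, neg_sq]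
    gcongr; linarith
  have h5 : 1 + 1 - 2 * (α * α') ≤ 4 * δ ^ 2 := by
    nlinarith [mul_nonneg (sub_nonneg.2 u1) (sub_nonneg.2 u2)]
  have hδ0 : 0 ≤ δ := by positivity
  have h6 : (∫ z, F z ∂(gaussPlane a b) - ∫ z, F z ∂(gaussPlane a₀ b₀)) ^ 2 ≤ (4 * B * δ) ^ 2 := by
    have n1 : 0 ≤ ∫ z, F z ^ 2 ∂(gaussPlane a b) := integral_nonneg fun z => sq_nonneg _
    have n2 : 0 ≤ ∫ z, F z ^ 2 ∂(gaussPlane a₀ b₀) := integral_nonneg fun z => sq_nonneg _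
    calc _ ≤ _ := key
      _ ≤ 2 * (∫ z, F z ^ 2 ∂(gaussPlane a b) + ∫ z, F z ^ 2 ∂(gaussPlane a₀ b₀)) * (4 * δ ^ 2) :=
          mul_le_mul_of_nonneg_left h5 (by positivity)
      _ ≤ 2 * (B ^ 2 + B ^ 2) * (4 * δ ^ 2) := by gcongr
      _ = _ := by ring
  have := abs_le_of_sq_le_sq h6 (by positivity)
  rw [hδ] at this
  rw [mul_div_assoc]; exact this

/-- Expectation of `f(X) f(Y)` for jointly Gaussian centred `X, Y` of variance `(a+b)/2`
and covariance `(a-b)/2`. -/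
noncomputable def prodRot (f : ℝ → ℝ) (z : ℝ × ℝ) : ℝ := f ((z.1 + z.2) / √2) * f ((z.1 - z.2) / √2)

lemma exp_moment_gaussPlane (a b : NNReal) (t s : ℝ) :
    Integrable (fun z : ℝ × ℝ => exp (t * z.1 + s * z.2)) (gaussPlane a b) ∧
    ∫ z, exp (t * z.1 + s * z.2) ∂(gaussPlane a b) = exp ((a * t ^ 2 + b * s ^ 2) / 2) := by
  have mg : ∀ (c : NNReal) (t : ℝ), ∫ x, exp (t * x) ∂(gaussianReal 0 c) = exp (c * t ^ 2 / 2) := by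
    intro c t
    have := congrFun (mgf_fun_id_gaussianReal (μ := 0) (v := c)) t
    rw [mgf] at this
    simpa using this
  constructor
  · simp_rw [exp_add]
    exact (integrable_exp_mul_gaussianReal t).mul_prod (integrable_exp_mul_gaussianReal s)
  · simp_rw [exp_add]
    rw [gaussPlane, integral_prod_mul (fun x => exp (t * x)) (fun x => exp (s * x)), mg, mg,
      ← exp_add]
    congr 1; ring

lemma cosh_pow_four_le (y : ℝ) : cosh y ^ 4 ≤ (exp (4 * y) + exp (-4 * y)) / 2 := by
  have h1 : exp (4 * y) = exp y ^ 4 := by rw [← exp_nat_mul]; norm_num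
  have h2 : exp (-4 * y) = exp (-y) ^ 4 := by rw [← exp_nat_mul]; congr 1; push_cast; ring
  rw [h1, h2, cosh_eq]
  have p1 := exp_pos y
  have p2 := exp_pos (-y)
  set p := exp y
  set q := exp (-y)
  have h3 : ((p + q) / 2) ^ 2 ≤ (p ^ 2 + q ^ 2) / 2 := by nlinarith [sq_nonneg (p - q)]
  have h4 : ((p ^ 2 + q ^ 2) / 2) ^ 2 ≤ (p ^ 4 + q ^ 4) / 2 := by nlinarith [sq_nonneg (p ^ 2 - q ^ 2)]
  calc ((p + q) / 2) ^ 4 = (((p + q) / 2) ^ 2) ^ 2 := by ring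
    _ ≤ ((p ^ 2 + q ^ 2) / 2) ^ 2 := by gcongr
    _ ≤ _ := h4

/-- The constant bounding fourth moments of `cosh (β X + h)`. -/
noncomputable def momC (β h : ℝ) : ℝ := cosh (4 * h) * exp (8 * β ^ 2)

lemma one_le_momC (β h : ℝ) : 1 ≤ momC β h := by
  have h1 := one_le_cosh (4 * h)
  have h2 : 1 ≤ exp (8 * β ^ 2) := one_le_exp (by positivity)
  unfold momC; nlinarith

lemma prodRot_sq_bound {β h M : ℝ} {f : ℝ → ℝ} (hf : Measurable f)
    (hfM : ∀ x, |f x| ≤ M * cosh (β * x + h)) {a b : NNReal} (hab : (a : ℝ) + b ≤ 2) :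
    Integrable (fun z => prodRot f z ^ 2) (gaussPlane a b) ∧
    ∫ z, prodRot f z ^ 2 ∂(gaussPlane a b) ≤ M ^ 4 * momC β h := by
  have hM : 0 ≤ M := by
    have := (abs_nonneg _).trans (hfM 0)
    exact nonneg_of_mul_nonneg_left this (cosh_pos _)
  have hm : Measurable (prodRot f) := by unfold prodRot; fun_prop
  have h2 : (√2 : ℝ) ^ 2 = 2 := Real.sq_sqrt (by norm_num)
  have h2' : (√2 : ℝ) ≠ 0 := by positivity
  let e : ℝ → ℝ → ℝ × ℝ → ℝ := fun k l z => exp (4 * k * h) *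
    exp (4 * k * β / √2 * z.1 + 4 * l * β / √2 * z.2)
  have ei : ∀ k l, Integrable (e k l) (gaussPlane a b) :=
    fun k l => (exp_moment_gaussPlane a b _ _).1.const_mul _
  have ee : ∀ k l, k ^ 2 = 1 → l ^ 2 = 1 →
      ∫ z, e k l z ∂(gaussPlane a b) ≤ exp (4 * k * h) * exp (8 * β ^ 2) := by
    intro k l hk hl
    simp only [e]
    rw [integral_const_mul, (exp_moment_gaussPlane a b _ _).2]
    gcongr
    have : ((a : ℝ) * (4 * k * β / √2) ^ 2 + b * (4 * l * β / √2) ^ 2) / 2 = 4 * β ^ 2 * (a + b) := by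
      rw [div_pow, div_pow, h2, mul_pow, mul_pow, mul_pow, mul_pow, hk, hl]; ring
    rw [this]; nlinarith [sq_nonneg β]
  let G : ℝ × ℝ → ℝ := fun z => M ^ 4 * ((e 1 1 z + e (-1) (-1) z + (e 1 (-1) z + e (-1) 1 z)) / 4)
  have Gi : Integrable G (gaussPlane a b) :=
    ((((ei _ _).add (ei _ _)).add ((ei _ _).add (ei _ _))).div_const 4).const_mul _
  have f4 : ∀ x, f x ^ 4 ≤ M ^ 4 * ((exp (4 * (β * x + h)) + exp (-4 * (β * x + h))) / 2) := by
    intro x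
    have h0 : f x ^ 4 = |f x| ^ 4 := by rw [← abs_pow, abs_of_nonneg (by positivity)]
    rw [h0]
    calc |f x| ^ 4 ≤ (M * cosh (β * x + h)) ^ 4 := by gcongr; exact hfM x
      _ = M ^ 4 * cosh (β * x + h) ^ 4 := by ring
      _ ≤ _ := by gcongr; exact cosh_pow_four_le _
  have hle : ∀ z, prodRot f z ^ 2 ≤ G z := by
    intro z
    have h5 : prodRot f z ^ 2 ≤ (f ((z.1 + z.2) / √2) ^ 4 + f ((z.1 - z.2) / √2) ^ 4) / 2 := by
      unfold prodRot
      nlinarith [sq_nonneg (f ((z.1 + z.2) / √2) ^ 2 - f ((z.1 - z.2) / √2) ^ 2)]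
    have h6 := f4 ((z.1 + z.2) / √2)
    have h7 := f4 ((z.1 - z.2) / √2)
    have e1 : exp (4 * (β * ((z.1 + z.2) / √2) + h)) = e 1 1 z := by
      simp only [e]; rw [← exp_add]; congr 1; ring
    have e2 : exp (-4 * (β * ((z.1 + z.2) / √2) + h)) = e (-1) (-1) z := by
      simp only [e]; rw [← exp_add]; congr 1; ring
    have e3 : exp (4 * (β * ((z.1 - z.2) / √2) + h)) = e 1 (-1) z := by
      simp only [e]; rw [← exp_add]; congr 1; ring
    have e4 : exp (-4 * (β * ((z.1 - z.2) / √2) + h)) = e (-1) 1 z := by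
      simp only [e]; rw [← exp_add]; congr 1; ring
    rw [e1, e2] at h6
    rw [e3, e4] at h7
    simp only [G]
    linarith
  have hi : Integrable (fun z => prodRot f z ^ 2) (gaussPlane a b) := by
    refine Integrable.mono' Gi (hm.pow_const 2).aestronglyMeasurable (.of_forall fun z => ?_)
    rw [Real.norm_eq_abs, abs_of_nonneg (sq_nonneg _)]; exact hle z
  refine ⟨hi, (integral_mono hi Gi hle).trans ?_⟩
  have e5 : ∫ z, G z ∂(gaussPlane a b) = M ^ 4 * ((∫ z, e 1 1 z ∂(gaussPlane a b)
      + ∫ z, e (-1) (-1) z ∂(gaussPlane a b) + (∫ z, e 1 (-1) z ∂(gaussPlane a b)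
      + ∫ z, e (-1) 1 z ∂(gaussPlane a b))) / 4) := by
    simp only [G]
    rw [integral_const_mul, integral_div]
    have i1 : Integrable (fun z => e 1 1 z + e (-1) (-1) z) (gaussPlane a b) := (ei _ _).add (ei _ _)
    have i2 : Integrable (fun z => e 1 (-1) z + e (-1) 1 z) (gaussPlane a b) := (ei _ _).add (ei _ _)
    rw [integral_add i1 i2, integral_add (ei _ _) (ei _ _), integral_add (ei _ _) (ei _ _)]
  rw [e5]
  have b1 := ee 1 1 (by norm_num) (by norm_num)
  have b2 := ee 1 (-1) (by norm_num) (by norm_num)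
  have b3 := ee (-1) (-1) (by norm_num) (by norm_num)
  have b4 := ee (-1) 1 (by norm_num) (by norm_num)
  have h8 : momC β h = (exp (4 * 1 * h) * exp (8 * β ^ 2) + exp (4 * -1 * h) * exp (8 * β ^ 2)) / 2 := by
    unfold momC; rw [cosh_eq]; ring_nf
  rw [h8]
  refine mul_le_mul_of_nonneg_left ?_ (by positivity)
  generalize exp (4 * 1 * h) * exp (8 * β ^ 2) = A at *
  generalize exp (4 * -1 * h) * exp (8 * β ^ 2) = B at *
  generalize (∫ z, e 1 1 z ∂(gaussPlane a b)) = I1 at *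
  generalize (∫ z, e 1 (-1) z ∂(gaussPlane a b)) = I2 at *
  generalize (∫ z, e (-1) (-1) z ∂(gaussPlane a b)) = I3 at *
  generalize (∫ z, e (-1) 1 z ∂(gaussPlane a b)) = I4 at *
  linarith

/-- The correlation function is Lipschitz away from degenerate correlations. -/
lemma abs_corr_sub_le {β h M : ℝ} {f : ℝ → ℝ} (hf : Measurable f)
    (hfM : ∀ x, |f x| ≤ M * cosh (β * x + h)) {a b a₀ b₀ : NNReal} (hb₀ : 0 < b₀) (hab₀ : b₀ ≤ a₀)
    (hsum : a + b = a₀ + b₀) (hab : (a : ℝ) + b ≤ 2) :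
    |∫ z, prodRot f z ∂(gaussPlane a b) - ∫ z, prodRot f z ∂(gaussPlane a₀ b₀)|
      ≤ 4 * momC β h * M ^ 2 * |(a : ℝ) - a₀| / b₀ := by
  have hab' : (a₀ : ℝ) + b₀ ≤ 2 := by
    have : (a : ℝ) + b = a₀ + b₀ := by exact_mod_cast hsum
    linarith
  have h1 := prodRot_sq_bound hf hfM hab
  have h2 := prodRot_sq_bound hf hfM hab'
  have hm1 := one_le_momC β h
  have hB : M ^ 4 * momC β h ≤ (momC β h * M ^ 2) ^ 2 := by
    have : 0 ≤ M ^ 4 * momC β h := by positivity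
    nlinarith
  have := abs_integral_gaussPlane_sub_le (F := prodRot f) (by unfold prodRot; fun_prop)
    (B := momC β h * M ^ 2) (by positivity) hb₀ hab₀ hsum h1.1 h2.1 (h1.2.trans hB) (h2.2.trans hB)
  simpa only [mul_assoc] using this

section Gauss
variable {ι : Type*} [Fintype ι]

/-- Law of a standard Gaussian vector indexed by `ι`. -/
noncomputable def stdPi (ι : Type*) [Fintype ι] : Measure (ι → ℝ) :=
  Measure.pi fun _ => gaussianReal 0 1

instance : IsProbabilityMeasure (stdPi ι) := by unfold stdPi; infer_instance

/-- A standard Gaussian vector together with two further independent Gaussian variables. -/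
noncomputable def stdExt (ι : Type*) [Fintype ι] : Measure ((ι → ℝ) × (ℝ × ℝ)) :=
  (stdPi ι).prod ((gaussianReal 0 1).prod (gaussianReal 0 1))

instance : IsProbabilityMeasure (stdExt ι) := by unfold stdExt; infer_instance

/-- The linear form on the extended Gaussian space with coefficients `c, d.1, d.2`. -/
def linForm (c : ι → ℝ) (d : ℝ × ℝ) (ω : (ι → ℝ) × (ℝ × ℝ)) : ℝ :=
  ∑ p, c p * ω.1 p + (d.1 * ω.2.1 + d.2 * ω.2.2)

@[fun_prop]
lemma measurable_linForm (c : ι → ℝ) (d : ℝ × ℝ) : Measurable (linForm c d) := by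
  unfold linForm; fun_prop

lemma integral_cexp_gaussianReal (v : NNReal) (t : ℝ) :
    ∫ x, Complex.exp (((t * x : ℝ) : ℂ) * Complex.I) ∂(gaussianReal 0 v)
      = Complex.exp (-(v * t ^ 2 / 2)) := by
  have := charFun_gaussianReal (μ := 0) (v := v) t
  rw [charFun_apply_real] at this
  simpa using this

lemma integral_cexp_linForm (c : ι → ℝ) (d : ℝ × ℝ) :
    ∫ ω, Complex.exp ((linForm c d ω : ℂ) * Complex.I) ∂(stdExt ι)
      = Complex.exp (-((∑ p, c p ^ 2 + (d.1 ^ 2 + d.2 ^ 2) : ℝ) / 2)) := by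
  have e : ∀ ω : (ι → ℝ) × (ℝ × ℝ), Complex.exp ((linForm c d ω : ℂ) * Complex.I)
      = (∏ p, Complex.exp (((c p * ω.1 p : ℝ) : ℂ) * Complex.I)) *
        (Complex.exp (((d.1 * ω.2.1 : ℝ) : ℂ) * Complex.I) *
          Complex.exp (((d.2 * ω.2.2 : ℝ) : ℂ) * Complex.I)) := by
    intro ω
    rw [← Complex.exp_sum, ← Complex.exp_add, ← Complex.exp_add]
    congr 1
    unfold linForm
    push_cast
    rw [add_mul, add_mul, Finset.sum_mul]
  simp_rw [e]
  rw [stdExt, integral_prod_mul (fun g : ι → ℝ => ∏ p, Complex.exp (((c p * g p : ℝ) : ℂ) * Complex.I))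
      (fun z : ℝ × ℝ => Complex.exp (((d.1 * z.1 : ℝ) : ℂ) * Complex.I) *
          Complex.exp (((d.2 * z.2 : ℝ) : ℂ) * Complex.I)),
    integral_prod_mul (fun z : ℝ => Complex.exp (((d.1 * z : ℝ) : ℂ) * Complex.I))
      (fun z : ℝ => Complex.exp (((d.2 * z : ℝ) : ℂ) * Complex.I)), stdPi,
    integral_fintype_prod_eq_prod (fun p (x : ℝ) => Complex.exp (((c p * x : ℝ) : ℂ) * Complex.I))]
  simp_rw [integral_cexp_gaussianReal]
  rw [← Complex.exp_sum, ← Complex.exp_add, ← Complex.exp_add]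
  congr 1
  push_cast
  rw [Finset.sum_neg_distrib, ← Finset.sum_div, neg_div']
  simp only [one_mul]
  ring

lemma map_linForm_pair (a b : ι → ℝ) (d e : ℝ × ℝ) {v w : NNReal}
    (ha : ∑ p, a p ^ 2 + (d.1 ^ 2 + d.2 ^ 2) = v) (hb : ∑ p, b p ^ 2 + (e.1 ^ 2 + e.2 ^ 2) = w)
    (hab : ∑ p, a p * b p + (d.1 * e.1 + d.2 * e.2) = 0) :
    (stdExt ι).map (fun ω => (linForm a d ω, linForm b e ω)) = gaussPlane v w := by
  have hm : Measurable (fun ω => (linForm a d ω, linForm b e ω)) := by fun_prop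
  have : IsProbabilityMeasure ((stdExt ι).map (fun ω => (linForm a d ω, linForm b e ω))) :=
    Measure.isProbabilityMeasure_map hm.aemeasurable
  apply Measure.ext_of_charFunDual
  ext L
  rw [charFunDual_apply, charFunDual_apply, integral_map hm.aemeasurable (by fun_prop)]
  have hL : ∀ x y : ℝ, L (x, y) = L (1, 0) * x + L (0, 1) * y := by
    intro x y
    have : ((x, y) : ℝ × ℝ) = x • ((1 : ℝ), (0 : ℝ)) + y • ((0 : ℝ), (1 : ℝ)) := by simp
    rw [this, map_add, map_smul, map_smul, smul_eq_mul, smul_eq_mul]; ring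
  set s := L (1, 0)
  set t := L (0, 1)
  have e1 : ∀ ω, L (linForm a d ω, linForm b e ω)
      = linForm (fun p => s * a p + t * b p) (s * d.1 + t * e.1, s * d.2 + t * e.2) ω := by
    intro ω
    rw [hL]
    simp only [linForm]
    simp_rw [add_mul, Finset.sum_add_distrib, mul_add, Finset.mul_sum, mul_assoc]
    ring
  simp_rw [e1]
  rw [integral_cexp_linForm, gaussPlane]
  have e2 : ∀ z : ℝ × ℝ, Complex.exp ((L z : ℂ) * Complex.I)
      = Complex.exp (((s * z.1 : ℝ) : ℂ) * Complex.I) *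
          Complex.exp (((t * z.2 : ℝ) : ℂ) * Complex.I) := by
    intro z
    rw [← Complex.exp_add, show L z = s * z.1 + t * z.2 from hL z.1 z.2]
    congr 1; push_cast; ring
  simp_rw [e2]
  rw [integral_prod_mul (fun z : ℝ => Complex.exp (((s * z : ℝ) : ℂ) * Complex.I))
      (fun z : ℝ => Complex.exp (((t * z : ℝ) : ℂ) * Complex.I)), integral_cexp_gaussianReal,
      integral_cexp_gaussianReal, ← Complex.exp_add]
  congr 1
  have e3 : ∑ p, (s * a p + t * b p) ^ 2 + ((s * d.1 + t * e.1) ^ 2 + (s * d.2 + t * e.2) ^ 2)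
      = s ^ 2 * v + t ^ 2 * w := by
    have : ∑ p, (s * a p + t * b p) ^ 2
        = s ^ 2 * ∑ p, a p ^ 2 + 2 * s * t * ∑ p, a p * b p + t ^ 2 * ∑ p, b p ^ 2 := by
      rw [Finset.mul_sum, Finset.mul_sum, Finset.mul_sum, ← Finset.sum_add_distrib,
        ← Finset.sum_add_distrib]
      exact Finset.sum_congr rfl fun p _ => by ring
    rw [this, ← ha, ← hb]
    linear_combination 2 * s * t * hab
  simp only [e3]
  push_cast
  ring

/-- Correlations of a function of two Gaussian variables with equal variances. -/
lemma integral_linForm_mul (f : ℝ → ℝ) (hf : Measurable f) (a b : ι → ℝ) (d e : ℝ × ℝ)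
    {v ρ : ℝ} {v₁ v₂ : NNReal} (h₁ : (v₁ : ℝ) = v + ρ) (h₂ : (v₂ : ℝ) = v - ρ)
    (ha : ∑ p, a p ^ 2 + (d.1 ^ 2 + d.2 ^ 2) = v) (hb : ∑ p, b p ^ 2 + (e.1 ^ 2 + e.2 ^ 2) = v)
    (hab : ∑ p, a p * b p + (d.1 * e.1 + d.2 * e.2) = ρ) :
    ∫ ω, f (linForm a d ω) * f (linForm b e ω) ∂(stdExt ι)
      = ∫ z, prodRot f z ∂(gaussPlane v₁ v₂) := by
  have h2 : (√2 : ℝ) ^ 2 = 2 := Real.sq_sqrt (by norm_num)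
  have h2' : (√2 : ℝ) ≠ 0 := by positivity
  have es : ∀ σ : ℝ, ∑ p, ((a p + σ * b p) / √2) ^ 2
      = (∑ p, a p ^ 2 + 2 * σ * ∑ p, a p * b p + σ ^ 2 * ∑ p, b p ^ 2) / 2 := by
    intro σ
    rw [Finset.mul_sum, Finset.mul_sum, ← Finset.sum_add_distrib,
        ← Finset.sum_add_distrib, Finset.sum_div]
    exact Finset.sum_congr rfl fun p _ => by rw [div_pow, h2]; ring
  have hmap := map_linForm_pair (fun p => (a p + 1 * b p) / √2) (fun p => (a p + (-1) * b p) / √2)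
    ((d.1 + e.1) / √2, (d.2 + e.2) / √2) ((d.1 - e.1) / √2, (d.2 - e.2) / √2) (v := v₁) (w := v₂)
    (by rw [es, h₁]; simp only [div_pow, h2]; linear_combination (ha + hb) / 2 + hab)
    (by rw [es, h₂]; simp only [div_pow, h2]; linear_combination (ha + hb) / 2 - hab)
    (by
      have : ∑ p, (a p + 1 * b p) / √2 * ((a p + (-1) * b p) / √2)
          = (∑ p, a p ^ 2 - ∑ p, b p ^ 2) / 2 := by
        rw [← Finset.sum_sub_distrib, Finset.sum_div]
        refine Finset.sum_congr rfl fun p _ => ?_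
        rw [div_mul_div_comm, ← sq √2, h2]; ring
      rw [this]
      simp only [div_mul_div_comm, ← sq √2, h2]
      linear_combination (ha - hb) / 2)
  rw [← hmap, integral_map (by fun_prop) (by unfold prodRot; fun_prop)]
  have el : ∀ ω, linForm (fun p => (a p + 1 * b p) / √2) ((d.1 + e.1) / √2, (d.2 + e.2) / √2) ω
      = (linForm a d ω + linForm b e ω) / √2 := by
    intro ω
    simp only [linForm]
    have : ∑ p, (a p + 1 * b p) / √2 * ω.1 p
        = (∑ p, a p * ω.1 p + ∑ p, b p * ω.1 p) / √2 := by
      rw [← Finset.sum_add_distrib, Finset.sum_div]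
      exact Finset.sum_congr rfl fun p _ => by ring
    rw [this]; ring
  have el' : ∀ ω, linForm (fun p => (a p + (-1) * b p) / √2)
      ((d.1 - e.1) / √2, (d.2 - e.2) / √2) ω
      = (linForm a d ω - linForm b e ω) / √2 := by
    intro ω
    simp only [linForm]
    have : ∑ p, (a p + (-1) * b p) / √2 * ω.1 p
        = (∑ p, a p * ω.1 p - ∑ p, b p * ω.1 p) / √2 := by
      rw [← Finset.sum_sub_distrib, Finset.sum_div]
      exact Finset.sum_congr rfl fun p _ => by ring
    rw [this]; ring
  congr 1
  ext ω
  simp only [prodRot, el, el', ← add_div, ← sub_div, div_div, ← sq √2, h2]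
  congr 2 <;> ring

end Gauss

lemma gaussianReal_withDensity_exp (c : ℝ) :
    (gaussianReal 0 1).withDensity (fun x => ENNReal.ofReal (exp (c * x - c ^ 2 / 2)))
      = gaussianReal c 1 := by
  rw [gaussianReal_of_var_ne_zero _ one_ne_zero, gaussianReal_of_var_ne_zero _ one_ne_zero,
    ← withDensity_mul _ (measurable_gaussianPDF _ _) (by fun_prop)]
  congr 1
  ext x
  simp only [Pi.mul_apply, gaussianPDF]
  rw [← ENNReal.ofReal_mul (gaussianPDFReal_nonneg _ _ _)]
  congr 1
  simp only [gaussianPDFReal]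
  rw [mul_assoc, ← exp_add]
  congr 2
  simp only [NNReal.coe_one]
  ring

section Gauss
variable {ι : Type*} [Fintype ι]

/-- The Cameron–Martin formula in finite dimension. -/
lemma map_add_stdPi (c : ι → ℝ) :
    (stdPi ι).map (fun g p => g p + c p) = (stdPi ι).withDensity
      (fun g => ENNReal.ofReal (exp (∑ p, c p * g p - (∑ p, c p ^ 2) / 2))) := by
  have h1 : (stdPi ι).map (fun g p => g p + c p) = Measure.pi fun p => gaussianReal (c p) 1 := by
    have : ∀ p, gaussianReal (c p) 1 = (gaussianReal 0 1).map (fun x => x + c p) := by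
      intro p
      rw [gaussianReal_map_add_const]; simp
    simp_rw [this]
    exact Measure.pi_map_pi (μ := fun _ : ι => gaussianReal 0 1) (f := fun p x => x + c p) (fun p => by fun_prop)
  rw [h1]
  refine Measure.pi_eq fun s hs => ?_
  rw [withDensity_apply _ (MeasurableSet.univ_pi hs), stdPi, Measure.restrict_pi_pi]
  have e : ∀ g : ι → ℝ, exp (∑ p, c p * g p - (∑ p, c p ^ 2) / 2)
      = ∏ p, exp (c p * g p - c p ^ 2 / 2) := by
    intro g
    rw [← exp_sum, Finset.sum_sub_distrib, Finset.sum_div]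
  simp_rw [e]
  have hi : ∀ p, Integrable (fun x => exp (c p * x - c p ^ 2 / 2))
      ((gaussianReal 0 1).restrict (s p)) := by
    intro p
    simp_rw [sub_eq_add_neg, exp_add]
    exact ((integrable_exp_mul_gaussianReal (c p)).mul_const _).integrableOn
  rw [← ofReal_integral_eq_lintegral_ofReal
    (Integrable.fintype_prod (f := fun p x => exp (c p * x - c p ^ 2 / 2)) hi)
    (.of_forall fun g => Finset.prod_nonneg fun p _ => (exp_pos _).le),
    integral_fintype_prod_eq_prod (fun p x => exp (c p * x - c p ^ 2 / 2)),
    ENNReal.ofReal_prod_of_nonneg fun p _ => integral_nonneg fun x => (exp_pos _).le]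
  refine Finset.prod_congr rfl fun p _ => ?_
  rw [ofReal_integral_eq_lintegral_ofReal (hi p) (.of_forall fun g => (exp_pos _).le),
    ← withDensity_apply _ (hs p), gaussianReal_withDensity_exp]

lemma integral_mul_exp_stdPi (c : ι → ℝ) {F : (ι → ℝ) → ℝ} (hF : Measurable F) :
    ∫ g, F g * exp (∑ p, c p * g p) ∂(stdPi ι)
      = exp ((∑ p, c p ^ 2) / 2) * ∫ g, F (fun p => g p + c p) ∂(stdPi ι) := by
  have h := map_add_stdPi c
  have h2 : ∫ g, F (fun p => g p + c p) ∂(stdPi ι)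
      = ∫ g, F g * exp (∑ p, c p * g p - (∑ p, c p ^ 2) / 2) ∂(stdPi ι) := by
    rw [← integral_map (φ := fun g : ι → ℝ => fun p => g p + c p)
      (by exact (by fun_prop : Measurable _).aemeasurable)
      hF.aestronglyMeasurable, h, integral_withDensity_eq_integral_toReal_smul
      (by fun_prop) (.of_forall fun z => ENNReal.ofReal_lt_top)]
    congr 1; ext g
    rw [ENNReal.toReal_ofReal (exp_pos _).le, smul_eq_mul, mul_comm]
  rw [h2, ← integral_const_mul]
  congr 1; ext g
  rw [exp_sub]
  field_simp

lemma integrable_exp_stdPi (c : ι → ℝ) :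
    Integrable (fun g => exp (∑ p, c p * g p)) (stdPi ι) := by
  simp_rw [exp_sum]
  exact Integrable.fintype_prod (f := fun p x => exp (c p * x))
    fun p => integrable_exp_mul_gaussianReal (c p)

lemma integral_exp_stdPi (c : ι → ℝ) :
    ∫ g, exp (∑ p, c p * g p) ∂(stdPi ι) = exp ((∑ p, c p ^ 2) / 2) := by
  have := integral_mul_exp_stdPi c (F := fun _ => 1) measurable_const
  simpa using this

lemma integrable_mul_exp_stdPi (c : ι → ℝ) {F : (ι → ℝ) → ℝ} (hF : Measurable F)
    (hi : Integrable (fun g => F (fun p => g p + c p)) (stdPi ι)) :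
    Integrable (fun g => F g * exp (∑ p, c p * g p)) (stdPi ι) := by
  have h := map_add_stdPi c
  have h2 : Integrable F ((stdPi ι).map (fun g p => g p + c p)) :=
    (integrable_map_measure hF.aestronglyMeasurable
      (by fun_prop : Measurable fun (g : ι → ℝ) p => g p + c p).aemeasurable).2 hi
  rw [h, integrable_withDensity_iff (by fun_prop) (.of_forall fun z => ENNReal.ofReal_lt_top)] at h2
  refine (h2.mul_const (exp ((∑ p, c p ^ 2) / 2))).congr (.of_forall fun g => ?_)
  simp only []
  rw [ENNReal.toReal_ofReal (exp_pos _).le, exp_sub]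
  field_simp

lemma memLp_eval_stdPi (p : ι) : MemLp (fun g : ι → ℝ => g p) 2 (stdPi ι) := by
  have := (memLp_id_gaussianReal (μ := 0) (v := 1) 2)
  exact MemLp.comp_measurePreserving this (measurePreserving_eval (fun _ => gaussianReal 0 1) p)

lemma integral_eval_stdPi (p : ι) : ∫ g, g p ∂(stdPi ι) = 0 := by
  have h := (measurePreserving_eval (fun _ : ι => gaussianReal 0 1) p).map_eq
  have h2 := integral_map (μ := stdPi ι) (φ := Function.eval p) (f := fun x : ℝ => x)
    (measurable_pi_apply p).aemeasurable (by fun_prop)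
  rw [stdPi, h, integral_id_gaussianReal] at h2
  exact h2.symm

lemma integral_eval_mul_eval_stdPi [DecidableEq ι] (p p' : ι) :
    ∫ g, g p * g p' ∂(stdPi ι) = if p = p' then 1 else 0 := by
  split_ifs with hp
  · subst hp
    have h := (measurePreserving_eval (fun _ : ι => gaussianReal 0 1) p).map_eq
    have h2 := integral_map (μ := stdPi ι) (φ := Function.eval p) (f := fun x : ℝ => x * x)
      (measurable_pi_apply p).aemeasurable (by fun_prop)
    have h3 := variance_fun_id_gaussianReal (μ := 0) (v := 1)
    rw [variance_eq_integral (by fun_prop), integral_id_gaussianReal] at h3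
    rw [stdPi, h] at h2
    refine h2.symm.trans ?_
    simpa [sq] using h3
  · have h := (iIndepFun_pi (μ := fun _ : ι => gaussianReal 0 1) (X := fun _ x => x)
      (fun _ => aemeasurable_id')).indepFun hp
    have h2 := h.integral_fun_mul_eq_mul_integral (measurable_pi_apply p).aestronglyMeasurable
      (measurable_pi_apply p').aestronglyMeasurable
    have h3 := integral_eval_stdPi p
    rw [stdPi] at h3 ⊢
    rw [h2, h3, zero_mul]

lemma memLp_affine_stdPi (a : ι → ℝ) (a₀ : ℝ) :
    MemLp (fun g : ι → ℝ => ∑ p, a p * g p + a₀) 2 (stdPi ι) :=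
  (memLp_finsetSum _ fun p _ => (memLp_eval_stdPi p).const_mul (a p)).add (memLp_const a₀)

lemma integral_affine_mul_stdPi (a b : ι → ℝ) (a₀ b₀ : ℝ) :
    ∫ g, (∑ p, a p * g p + a₀) * (∑ p, b p * g p + b₀) ∂(stdPi ι)
      = ∑ p, a p * b p + a₀ * b₀ := by
  classical
  have hl : ∀ c : ι → ℝ, Integrable (fun g : ι → ℝ => ∑ p, c p * g p) (stdPi ι) := by
    intro c
    simpa using (memLp_affine_stdPi c 0).integrable one_le_two
  have h0 : ∀ c : ι → ℝ, ∫ g, ∑ p, c p * g p ∂(stdPi ι) = 0 := by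
    intro c
    rw [integral_finsetSum _ fun p _ => ((memLp_eval_stdPi p).integrable one_le_two).const_mul _]
    simp [integral_const_mul, integral_eval_stdPi]
  have hq : Integrable (fun g : ι → ℝ => (∑ p, a p * g p) * (∑ p, b p * g p)) (stdPi ι) := by
    have := (memLp_affine_stdPi a 0).integrable_mul (memLp_affine_stdPi b 0)
    simp only [add_zero] at this
    exact this
  have h2 : ∫ g, (∑ p, a p * g p) * (∑ p, b p * g p) ∂(stdPi ι) = ∑ p, a p * b p := by
    simp_rw [Finset.sum_mul_sum]
    have hpp : ∀ p p', Integrable (fun g : ι → ℝ => a p * g p * (b p' * g p')) (stdPi ι) :=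
      fun p p' => ((memLp_eval_stdPi p).const_mul (a p)).integrable_mul
        ((memLp_eval_stdPi p').const_mul (b p'))
    rw [integral_finsetSum _ fun p _ => integrable_finsetSum _ fun p' _ => hpp p p']
    refine Finset.sum_congr rfl fun p _ => ?_
    rw [integral_finsetSum _ fun p' _ => hpp p p']
    simp_rw [mul_mul_mul_comm (a p), integral_const_mul, integral_eval_mul_eval_stdPi]
    simp
  have e : ∀ g : ι → ℝ, (∑ p, a p * g p + a₀) * (∑ p, b p * g p + b₀)
      = (∑ p, a p * g p) * (∑ p, b p * g p)
        + (b₀ * ∑ p, a p * g p + (a₀ * ∑ p, b p * g p + a₀ * b₀)) := fun g => by ring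
  simp_rw [e]
  have i3 : Integrable (fun g : ι → ℝ => a₀ * ∑ p, b p * g p + a₀ * b₀) (stdPi ι) :=
    ((hl b).const_mul a₀).add (integrable_const _)
  have i2 : Integrable (fun g : ι → ℝ => b₀ * ∑ p, a p * g p + (a₀ * ∑ p, b p * g p + a₀ * b₀))
      (stdPi ι) := ((hl a).const_mul b₀).add i3
  rw [integral_add hq i2, integral_add ((hl a).const_mul b₀) i3,
    integral_add ((hl b).const_mul a₀) (integrable_const _), integral_const_mul,
    integral_const_mul, h0, h0, h2]
  simp

lemma integral_affine_mul_exp_stdPi (a b c : ι → ℝ) (a₀ b₀ : ℝ) :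
    Integrable (fun g => (∑ p, a p * g p + a₀) * (∑ p, b p * g p + b₀) * exp (∑ p, c p * g p))
      (stdPi ι) ∧
    ∫ g, (∑ p, a p * g p + a₀) * (∑ p, b p * g p + b₀) * exp (∑ p, c p * g p) ∂(stdPi ι)
      = exp ((∑ p, c p ^ 2) / 2) *
        (∑ p, a p * b p + (∑ p, a p * c p + a₀) * (∑ p, b p * c p + b₀)) := by
  have e : ∀ (a : ι → ℝ) (a₀ : ℝ) (g : ι → ℝ), ∑ p, a p * (g p + c p) + a₀
      = ∑ p, a p * g p + (∑ p, a p * c p + a₀) := by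
    intro a a₀ g
    simp_rw [mul_add, Finset.sum_add_distrib]; ring
  constructor
  · refine integrable_mul_exp_stdPi c (F := fun g => (∑ p, a p * g p + a₀) * (∑ p, b p * g p + b₀))
      (by fun_prop) ?_
    simp_rw [e]
    exact (memLp_affine_stdPi a _).integrable_mul (memLp_affine_stdPi b _)
  · rw [integral_mul_exp_stdPi c (F := fun g => (∑ p, a p * g p + a₀) * (∑ p, b p * g p + b₀))
      (by fun_prop)]
    simp_rw [e]
    rw [integral_affine_mul_stdPi]

end Gauss

/-- A random finite family of linear forms on Gaussian space, all of the same variance `v ≤ 1`. -/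
structure FieldFamily (ι S : Type*) [Fintype ι] [Fintype S] where
  w : S → ℝ
  x : S → ι → ℝ
  v : ℝ
  w_nonneg : ∀ σ, 0 ≤ w σ
  sum_w : ∑ σ, w σ = 1
  norm_x : ∀ σ, ∑ p, x σ p ^ 2 = v
  v_le : v ≤ 1

namespace FieldFamily
variable {ι S : Type*} [Fintype ι] [Fintype S] (D : FieldFamily ι S)

/-- The covariance of two of the forms. -/
def R (σ τ : S) : ℝ := ∑ p, D.x σ p * D.x τ p

/-- The mean of the coefficient vectors. -/
def m (p : ι) : ℝ := ∑ σ, D.w σ * D.x σ p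

/-- The value of the form indexed by `σ`. -/
def fld (σ : S) (g : ι → ℝ) : ℝ := ∑ p, D.x σ p * g p

/-- The mean of the forms. -/
def mfld (g : ι → ℝ) : ℝ := ∑ p, D.m p * g p

/-- The variance not explained by the mean form. -/
def res : ℝ := D.v - ∑ p, D.m p ^ 2

/-- Weighted average of a function of the forms. -/
def avg (f : ℝ → ℝ) (g : ι → ℝ) : ℝ := ∑ σ, D.w σ * f (D.fld σ g)

/-- The Gaussian surrogate of `avg`. -/
noncomputable def gavg (f : ℝ → ℝ) (g : ι → ℝ) : ℝ :=
  ∫ z, f (D.mfld g + √D.res * z) ∂(gaussianReal 0 1)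

/-- Mean absolute deviation of the covariances from `q`. -/
def dev (q : ℝ) : ℝ := ∑ σ, ∑ τ, D.w σ * D.w τ * |D.R σ τ - q|

lemma dev_nonneg (q : ℝ) : 0 ≤ D.dev q :=
  Finset.sum_nonneg fun _ _ => Finset.sum_nonneg fun _ _ =>
    mul_nonneg (mul_nonneg (D.w_nonneg _) (D.w_nonneg _)) (abs_nonneg _)

lemma sum_x_mul_m (σ : S) : ∑ p, D.x σ p * D.m p = ∑ τ, D.w τ * D.R σ τ := by
  simp_rw [m, R, Finset.mul_sum]
  rw [Finset.sum_comm]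
  exact Finset.sum_congr rfl fun _ _ => Finset.sum_congr rfl fun _ _ => by ring

lemma sum_m_sq : ∑ p, D.m p ^ 2 = ∑ σ, D.w σ * ∑ τ, D.w τ * D.R σ τ := by
  simp_rw [← D.sum_x_mul_m, sq, Finset.mul_sum]
  rw [Finset.sum_comm]
  refine Finset.sum_congr rfl fun p _ => ?_
  conv_lhs => rw [m, Finset.sum_mul]
  exact Finset.sum_congr rfl fun _ _ => by simp only [m]; ring

lemma abs_corr_le {ι : Type*} [Fintype ι] (a b : ι → ℝ) {v : ℝ} (ha : ∑ p, a p ^ 2 ≤ v)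
    (hb : ∑ p, b p ^ 2 ≤ v) : |∑ p, a p * b p| ≤ v := by
  have h1 : 0 ≤ ∑ p, (a p + b p) ^ 2 := Finset.sum_nonneg fun _ _ => sq_nonneg _
  have h2 : 0 ≤ ∑ p, (a p - b p) ^ 2 := Finset.sum_nonneg fun _ _ => sq_nonneg _
  have e1 : ∑ p, (a p + b p) ^ 2 = ∑ p, a p ^ 2 + 2 * ∑ p, a p * b p + ∑ p, b p ^ 2 := by
    rw [Finset.mul_sum, ← Finset.sum_add_distrib, ← Finset.sum_add_distrib]
    exact Finset.sum_congr rfl fun _ _ => by ring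
  have e2 : ∑ p, (a p - b p) ^ 2 = ∑ p, a p ^ 2 - 2 * ∑ p, a p * b p + ∑ p, b p ^ 2 := by
    rw [Finset.mul_sum, ← Finset.sum_sub_distrib, ← Finset.sum_add_distrib]
    exact Finset.sum_congr rfl fun _ _ => by ring
  rw [abs_le]
  constructor <;> linarith

lemma abs_R_le (σ τ : S) : |D.R σ τ| ≤ D.v :=
  abs_corr_le _ _ (D.norm_x σ).le (D.norm_x τ).le

lemma abs_sum_w_mul_le {a : S → ℝ} {b : S → ℝ} (h : ∀ σ, |a σ| ≤ b σ) :
    |∑ σ, D.w σ * a σ| ≤ ∑ σ, D.w σ * b σ := by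
  refine (Finset.abs_sum_le_sum_abs _ _).trans (Finset.sum_le_sum fun σ _ => ?_)
  rw [abs_mul, abs_of_nonneg (D.w_nonneg σ)]
  exact mul_le_mul_of_nonneg_left (h σ) (D.w_nonneg σ)

lemma sum_w_mul_const (c : ℝ) : ∑ σ, D.w σ * c = c := by
  rw [← Finset.sum_mul, D.sum_w, one_mul]

lemma abs_Rm_le (σ : S) : |∑ p, D.x σ p * D.m p| ≤ D.v := by
  rw [D.sum_x_mul_m]
  exact (D.abs_sum_w_mul_le fun τ => D.abs_R_le σ τ).trans_eq (D.sum_w_mul_const _)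

lemma sum_m_sq_le : ∑ p, D.m p ^ 2 ≤ D.v := by
  rw [D.sum_m_sq]
  refine (le_abs_self _).trans ((D.abs_sum_w_mul_le (b := fun _ => D.v) fun σ => ?_).trans_eq
    (D.sum_w_mul_const _))
  rw [← D.sum_x_mul_m]; exact D.abs_Rm_le σ

lemma res_nonneg : 0 ≤ D.res := sub_nonneg.2 D.sum_m_sq_le

lemma res_le_one : D.res ≤ 1 := by
  have : 0 ≤ ∑ p, D.m p ^ 2 := Finset.sum_nonneg fun _ _ => sq_nonneg _
  have := D.v_le
  unfold res; linarith

lemma abs_Rm_sub_le (q : ℝ) (σ : S) :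
    |∑ p, D.x σ p * D.m p - q| ≤ ∑ τ, D.w τ * |D.R σ τ - q| := by
  have : ∑ p, D.x σ p * D.m p - q = ∑ τ, D.w τ * (D.R σ τ - q) := by
    simp_rw [mul_sub, Finset.sum_sub_distrib, D.sum_w_mul_const, D.sum_x_mul_m]
  rw [this]
  exact D.abs_sum_w_mul_le fun τ => le_rfl

lemma dev_eq (q : ℝ) : D.dev q = ∑ σ, D.w σ * ∑ τ, D.w τ * |D.R σ τ - q| := by
  simp_rw [dev, Finset.mul_sum, mul_assoc]

lemma sum_abs_Rm_sub_le (q : ℝ) : ∑ σ, D.w σ * |∑ p, D.x σ p * D.m p - q| ≤ D.dev q := by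
  rw [dev_eq]
  exact Finset.sum_le_sum fun σ _ => mul_le_mul_of_nonneg_left (D.abs_Rm_sub_le q σ) (D.w_nonneg σ)

lemma abs_sum_m_sq_sub_le (q : ℝ) : |∑ p, D.m p ^ 2 - q| ≤ D.dev q := by
  have : ∑ p, D.m p ^ 2 - q = ∑ σ, D.w σ * (∑ p, D.x σ p * D.m p - q) := by
    simp_rw [mul_sub, Finset.sum_sub_distrib, D.sum_w_mul_const, D.sum_m_sq, D.sum_x_mul_m]
  rw [this]
  exact (D.abs_sum_w_mul_le fun τ => le_rfl).trans (D.sum_abs_Rm_sub_le q)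

end FieldFamily

section
variable {ι : Type*} [Fintype ι]

lemma integrable_exp_linForm (c : ι → ℝ) (d : ℝ × ℝ) :
    Integrable (fun ω => exp (linForm c d ω)) (stdExt ι) := by
  simp_rw [linForm, exp_add]
  exact (integrable_exp_stdPi c).mul_prod
    ((integrable_exp_mul_gaussianReal d.1).mul_prod (integrable_exp_mul_gaussianReal d.2))

lemma memLp_exp_linForm (k : ℝ) (c : ι → ℝ) (d : ℝ × ℝ) :
    MemLp (fun ω => exp (k * linForm c d ω)) 2 (stdExt ι) := by
  rw [memLp_two_iff_integrable_sq (by fun_prop)]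
  refine (integrable_exp_linForm (fun p => 2 * k * c p) (2 * k * d.1, 2 * k * d.2)).congr
    (.of_forall fun ω => ?_)
  simp only []
  rw [← exp_nat_mul]
  congr 1
  simp only [linForm, mul_add, Finset.mul_sum]
  push_cast
  simp only [mul_assoc]

lemma cosh_affine (β h y : ℝ) :
    cosh (β * y + h) = exp h / 2 * exp (β * y) + exp (-h) / 2 * exp (-β * y) := by
  rw [cosh_eq, neg_add, exp_add, exp_add, neg_mul]; ring

lemma memLp_comp_linForm {β h M : ℝ} {f : ℝ → ℝ} (hf : Measurable f)
    (hfM : ∀ x, |f x| ≤ M * cosh (β * x + h)) (c : ι → ℝ) (d : ℝ × ℝ) :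
    MemLp (fun ω => f (linForm c d ω)) 2 (stdExt ι) := by
  have h1 : MemLp (fun ω => M * (exp h / 2 * exp (β * linForm c d ω)
      + exp (-h) / 2 * exp (-β * linForm c d ω))) 2 (stdExt ι) :=
    (((memLp_exp_linForm β c d).const_mul _).add ((memLp_exp_linForm (-β) c d).const_mul _)).const_mul M
  refine h1.mono' (hf.comp (measurable_linForm c d)).aestronglyMeasurable (.of_forall fun ω => ?_)
  rw [Real.norm_eq_abs, ← cosh_affine]
  exact hfM _

lemma integrable_comp_affine {β h M : ℝ} {f : ℝ → ℝ} (hf : Measurable f)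
    (hfM : ∀ x, |f x| ≤ M * cosh (β * x + h)) (r s : ℝ) :
    Integrable (fun z => f (r + s * z)) (gaussianReal 0 1) := by
  have e : ∀ k z, exp (k * (r + s * z)) = exp (k * r) * exp (k * s * z) := by
    intro k z; rw [← exp_add]; congr 1; ring
  have h1 : ∀ k, Integrable (fun z => exp (k * (r + s * z))) (gaussianReal 0 1) := by
    intro k
    simp_rw [e]
    exact (integrable_exp_mul_gaussianReal _).const_mul _
  refine ((((h1 β).const_mul (exp h / 2)).add ((h1 (-β)).const_mul (exp (-h) / 2))).const_mul M).mono'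
    (hf.comp (by fun_prop)).aestronglyMeasurable (.of_forall fun z => ?_)
  rw [Real.norm_eq_abs]
  simp only [Pi.add_apply]
  rw [← cosh_affine]
  exact hfM _

lemma abs_integral_linForm_mul_sub_le {β h M κ q v ρ : ℝ} {f : ℝ → ℝ} (hf : Measurable f)
    (hfM : ∀ x, |f x| ≤ M * cosh (β * x + h)) (hκ : 0 < κ) (hq : 0 ≤ q) (hqv : κ ≤ v - q)
    (hv : v ≤ 1) (hρ : |ρ| ≤ v) (a b : ι → ℝ) (d e : ℝ × ℝ)
    (ha : ∑ p, a p ^ 2 + (d.1 ^ 2 + d.2 ^ 2) = v) (hb : ∑ p, b p ^ 2 + (e.1 ^ 2 + e.2 ^ 2) = v)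
    (hab : ∑ p, a p * b p + (d.1 * e.1 + d.2 * e.2) = ρ) :
    |∫ ω, f (linForm a d ω) * f (linForm b e ω) ∂(stdExt ι)
      - ∫ z, prodRot f z ∂(gaussPlane (v + q).toNNReal (v - q).toNNReal)|
      ≤ 4 * momC β h * M ^ 2 / κ * |ρ - q| := by
  obtain ⟨hρ1, hρ2⟩ := abs_le.1 hρ
  have c1 : ((v + ρ).toNNReal : ℝ) = v + ρ := Real.coe_toNNReal _ (by linarith)
  have c2 : ((v - ρ).toNNReal : ℝ) = v - ρ := Real.coe_toNNReal _ (by linarith)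
  have c3 : ((v + q).toNNReal : ℝ) = v + q := Real.coe_toNNReal _ (by linarith)
  have c4 : ((v - q).toNNReal : ℝ) = v - q := Real.coe_toNNReal _ (by linarith)
  rw [integral_linForm_mul f hf a b d e c1 c2 ha hb hab]
  have := abs_corr_sub_le hf hfM (a := (v + ρ).toNNReal) (b := (v - ρ).toNNReal)
    (a₀ := (v + q).toNNReal) (b₀ := (v - q).toNNReal)
    (by rw [← NNReal.coe_pos, c4]; linarith) (by rw [← NNReal.coe_le_coe, c3, c4]; linarith)
    (by rw [← NNReal.coe_inj]; push_cast; rw [c1, c2, c3, c4]; ring)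
    (by rw [c1, c2]; linarith)
  rw [c1, c3, c4] at this
  refine this.trans ?_
  rw [show v + ρ - (v + q) = ρ - q by ring, mul_div_right_comm]
  have := one_le_momC β h
  gcongr

end

namespace FieldFamily
variable {ι S : Type*} [Fintype ι] [Fintype S] (D : FieldFamily ι S)

/-- The Gaussian surrogate approximates the weighted average in mean square. -/
theorem integral_sq_avg_sub_gavg_le {β h M κ q : ℝ} {f : ℝ → ℝ} (hf : Measurable f)
    (hfM : ∀ x, |f x| ≤ M * cosh (β * x + h)) (hκ : 0 < κ) (hq : 0 ≤ q) (hqv : κ ≤ D.v - q) :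
    Integrable (fun g => (D.avg f g - D.gavg f g) ^ 2) (stdPi ι) ∧
    ∫ g, (D.avg f g - D.gavg f g) ^ 2 ∂(stdPi ι) ≤ 16 * momC β h * M ^ 2 / κ * D.dev q := by
  have hs : √D.res ^ 2 = D.res := Real.sq_sqrt D.res_nonneg
  let X : S → (ι → ℝ) × (ℝ × ℝ) → ℝ := fun σ ω => f (linForm (D.x σ) (0, 0) ω)
  let Y₁ : (ι → ℝ) × (ℝ × ℝ) → ℝ := fun ω => f (linForm D.m (√D.res, 0) ω)
  let Y₂ : (ι → ℝ) × (ℝ × ℝ) → ℝ := fun ω => f (linForm D.m (0, √D.res) ω)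
  have mX : ∀ σ, MemLp (X σ) 2 (stdExt ι) := fun σ => memLp_comp_linForm hf hfM _ _
  have mY₁ : MemLp Y₁ 2 (stdExt ι) := memLp_comp_linForm hf hfM _ _
  have mY₂ : MemLp Y₂ 2 (stdExt ι) := memLp_comp_linForm hf hfM _ _
  let Φ : (ι → ℝ) × (ℝ × ℝ) → ℝ := fun ω =>
    (∑ σ, D.w σ * X σ ω - Y₁ ω) * (∑ σ, D.w σ * X σ ω - Y₂ ω)
  have mA : MemLp (fun ω => ∑ σ, D.w σ * X σ ω) 2 (stdExt ι) :=
    memLp_finsetSum _ fun σ _ => (mX σ).const_mul (D.w σ)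
  have iΦ : Integrable Φ (stdExt ι) := (mA.sub mY₁).integrable_mul (mA.sub mY₂)
  have inner : ∀ g, ∫ z, Φ (g, z) ∂((gaussianReal 0 1).prod (gaussianReal 0 1))
      = (D.avg f g - D.gavg f g) ^ 2 := by
    intro g
    have e : ∀ z : ℝ × ℝ, Φ (g, z) = (D.avg f g - f (D.mfld g + √D.res * z.1)) *
        (D.avg f g - f (D.mfld g + √D.res * z.2)) := by
      intro z
      simp [Φ, X, Y₁, Y₂, linForm, avg, fld, mfld]
    simp_rw [e]
    rw [integral_prod_mul (fun z => D.avg f g - f (D.mfld g + √D.res * z))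
      (fun z => D.avg f g - f (D.mfld g + √D.res * z)),
      integral_sub (integrable_const _) (integrable_comp_affine hf hfM _ _)]
    simp [gavg, sq]
  have iprod := iΦ
  rw [stdExt] at iprod
  refine ⟨?_, ?_⟩
  · have := iprod.integral_prod_left
    simpa only [inner] using this
  have e1 : ∫ g, (D.avg f g - D.gavg f g) ^ 2 ∂(stdPi ι) = ∫ ω, Φ ω ∂(stdExt ι) := by
    rw [stdExt, integral_prod _ iprod]
    simp_rw [inner]
  set Ψ := ∫ z, prodRot f z ∂(gaussPlane (D.v + q).toNNReal (D.v - q).toNNReal)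
  set L := 4 * momC β h * M ^ 2 / κ
  have hL : 0 ≤ L := by
    have := one_le_momC β h
    positivity
  have nm : ∑ p, D.m p ^ 2 + ((√D.res) ^ 2 + 0 ^ 2) = D.v := by rw [hs, res]; ring
  have nm' : ∑ p, D.m p ^ 2 + (0 ^ 2 + (√D.res) ^ 2) = D.v := by rw [hs, res]; ring
  have bXX : ∀ σ τ, |∫ ω, X σ ω * X τ ω ∂(stdExt ι) - Ψ| ≤ L * |D.R σ τ - q| := fun σ τ =>
    abs_integral_linForm_mul_sub_le hf hfM hκ hq hqv D.v_le (D.abs_R_le σ τ) (D.x σ) (D.x τ)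
      (0, 0) (0, 0) (by simp [D.norm_x]) (by simp [D.norm_x]) (by simp [R])
  have bXY₁ : ∀ σ, |∫ ω, X σ ω * Y₁ ω ∂(stdExt ι) - Ψ| ≤ L * |∑ p, D.x σ p * D.m p - q| :=
    fun σ => abs_integral_linForm_mul_sub_le hf hfM hκ hq hqv D.v_le (D.abs_Rm_le σ) (D.x σ) D.m
      (0, 0) (√D.res, 0) (by simp [D.norm_x]) nm (by simp)
  have bXY₂ : ∀ σ, |∫ ω, X σ ω * Y₂ ω ∂(stdExt ι) - Ψ| ≤ L * |∑ p, D.x σ p * D.m p - q| :=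
    fun σ => abs_integral_linForm_mul_sub_le hf hfM hκ hq hqv D.v_le (D.abs_Rm_le σ) (D.x σ) D.m
      (0, 0) (0, √D.res) (by simp [D.norm_x]) nm' (by simp)
  have bYY : |∫ ω, Y₁ ω * Y₂ ω ∂(stdExt ι) - Ψ| ≤ L * |∑ p, D.m p ^ 2 - q| :=
    abs_integral_linForm_mul_sub_le hf hfM hκ hq hqv D.v_le
      (by rw [abs_of_nonneg (Finset.sum_nonneg fun _ _ => sq_nonneg _)]; exact D.sum_m_sq_le)
      D.m D.m (√D.res, 0) (0, √D.res) nm nm' (by simp [sq])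
  have iXX : ∀ σ τ, Integrable (fun ω => X σ ω * X τ ω) (stdExt ι) :=
    fun σ τ => (mX σ).integrable_mul (mX τ)
  have iXY₁ : ∀ σ, Integrable (fun ω => X σ ω * Y₁ ω) (stdExt ι) :=
    fun σ => (mX σ).integrable_mul mY₁
  have iXY₂ : ∀ σ, Integrable (fun ω => X σ ω * Y₂ ω) (stdExt ι) :=
    fun σ => (mX σ).integrable_mul mY₂
  have iYY : Integrable (fun ω => Y₁ ω * Y₂ ω) (stdExt ι) := mY₁.integrable_mul mY₂
  have eΦ : ∀ ω, Φ ω = ∑ σ, D.w σ * ∑ τ, D.w τ * (X σ ω * X τ ω)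
      - ∑ σ, D.w σ * (X σ ω * Y₁ ω) - ∑ σ, D.w σ * (X σ ω * Y₂ ω) + Y₁ ω * Y₂ ω := by
    intro ω
    have h1 : ∑ σ, D.w σ * ∑ τ, D.w τ * (X σ ω * X τ ω)
        = (∑ σ, D.w σ * X σ ω) * (∑ σ, D.w σ * X σ ω) := by
      rw [Finset.sum_mul_sum]
      refine Finset.sum_congr rfl fun σ _ => ?_
      rw [Finset.mul_sum]
      exact Finset.sum_congr rfl fun τ _ => by ring
    have h2 : ∀ Y : ℝ, ∑ σ, D.w σ * (X σ ω * Y) = (∑ σ, D.w σ * X σ ω) * Y := by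
      intro Y
      rw [Finset.sum_mul]
      exact Finset.sum_congr rfl fun τ _ => by ring
    rw [h1, h2, h2]
    simp only [Φ]; ring
  have i1 : ∀ σ, Integrable (fun ω => ∑ τ, D.w τ * (X σ ω * X τ ω)) (stdExt ι) :=
    fun σ => integrable_finsetSum _ fun τ _ => (iXX σ τ).const_mul _
  have i2 : Integrable (fun ω => ∑ σ, D.w σ * ∑ τ, D.w τ * (X σ ω * X τ ω)) (stdExt ι) :=
    integrable_finsetSum _ fun σ _ => (i1 σ).const_mul _
  have i3 : Integrable (fun ω => ∑ σ, D.w σ * (X σ ω * Y₁ ω)) (stdExt ι) :=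
    integrable_finsetSum _ fun σ _ => (iXY₁ σ).const_mul _
  have i4 : Integrable (fun ω => ∑ σ, D.w σ * (X σ ω * Y₂ ω)) (stdExt ι) :=
    integrable_finsetSum _ fun σ _ => (iXY₂ σ).const_mul _
  have i23 : Integrable (fun ω => ∑ σ, D.w σ * ∑ τ, D.w τ * (X σ ω * X τ ω)
      - ∑ σ, D.w σ * (X σ ω * Y₁ ω)) (stdExt ι) := i2.sub i3
  have i234 : Integrable (fun ω => ∑ σ, D.w σ * ∑ τ, D.w τ * (X σ ω * X τ ω)
      - ∑ σ, D.w σ * (X σ ω * Y₁ ω) - ∑ σ, D.w σ * (X σ ω * Y₂ ω)) (stdExt ι) := i23.sub i4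
  have e2 : ∫ ω, Φ ω ∂(stdExt ι)
      = ∑ σ, D.w σ * ∑ τ, D.w τ * (∫ ω, X σ ω * X τ ω ∂(stdExt ι) - Ψ)
        - ∑ σ, D.w σ * (∫ ω, X σ ω * Y₁ ω ∂(stdExt ι) - Ψ)
        - ∑ σ, D.w σ * (∫ ω, X σ ω * Y₂ ω ∂(stdExt ι) - Ψ)
        + (∫ ω, Y₁ ω * Y₂ ω ∂(stdExt ι) - Ψ) := by
    simp_rw [eΦ]
    rw [integral_add i234 iYY, integral_sub i23 i4, integral_sub i2 i3,
      integral_finsetSum _ fun σ _ => (i1 σ).const_mul _,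
      integral_finsetSum _ fun σ _ => (iXY₁ σ).const_mul _,
      integral_finsetSum _ fun σ _ => (iXY₂ σ).const_mul _]
    simp_rw [integral_const_mul, mul_sub, Finset.sum_sub_distrib, D.sum_w_mul_const]
    have : ∀ σ, ∫ ω, ∑ τ, D.w τ * (X σ ω * X τ ω) ∂(stdExt ι)
        = ∑ τ, D.w τ * ∫ ω, X σ ω * X τ ω ∂(stdExt ι) := by
      intro σ
      rw [integral_finsetSum _ fun τ _ => (iXX σ τ).const_mul _]
      simp_rw [integral_const_mul]
    simp_rw [this, mul_sub, Finset.sum_sub_distrib, D.sum_w_mul_const]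
    ring
  have f1 : ∑ σ, D.w σ * ∑ τ, D.w τ * (∫ ω, X σ ω * X τ ω ∂(stdExt ι) - Ψ) ≤ L * D.dev q := by
    refine (le_abs_self _).trans ((D.abs_sum_w_mul_le fun σ =>
      D.abs_sum_w_mul_le fun τ => bXX σ τ).trans_eq ?_)
    rw [dev_eq, Finset.mul_sum]
    refine Finset.sum_congr rfl fun σ _ => ?_
    rw [Finset.mul_sum, Finset.mul_sum, Finset.mul_sum]
    exact Finset.sum_congr rfl fun τ _ => by ring
  have fm : ∑ σ, D.w σ * (L * |∑ p, D.x σ p * D.m p - q|) ≤ L * D.dev q := by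
    refine le_trans (le_of_eq ?_) (mul_le_mul_of_nonneg_left (D.sum_abs_Rm_sub_le q) hL)
    rw [Finset.mul_sum]
    exact Finset.sum_congr rfl fun τ _ => by ring
  have f2 := (neg_le_abs _).trans ((D.abs_sum_w_mul_le bXY₁).trans fm)
  have f3 := (neg_le_abs _).trans ((D.abs_sum_w_mul_le bXY₂).trans fm)
  have f4 := (le_abs_self _).trans (bYY.trans
    (mul_le_mul_of_nonneg_left (D.abs_sum_m_sq_sub_le q) hL))
  rw [e1, e2]
  have : 16 * momC β h * M ^ 2 / κ * D.dev q = 4 * (L * D.dev q) := by simp only [L]; ring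
  rw [this]
  linarith

end FieldFamily

namespace FieldFamily
variable {ι S : Type*} [Fintype ι] [Fintype S] (D : FieldFamily ι S)

/-- The exponentially weighted discrepancy between the forms and their mean. -/
noncomputable def tilt (k : ℝ) (g : ι → ℝ) : ℝ :=
  ∑ σ, D.w σ * ((D.fld σ g - D.mfld g - k * D.res) * exp (k * D.fld σ g))

/-- The covariance of two centred forms. -/
def Q (σ τ : S) : ℝ :=
  D.R σ τ - ∑ p, D.x σ p * D.m p - ∑ p, D.x τ p * D.m p + ∑ p, D.m p ^ 2

lemma abs_Q_le (q : ℝ) (σ τ : S) : |D.Q σ τ| ≤ |D.R σ τ - q| + |∑ p, D.x σ p * D.m p - q|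
    + |∑ p, D.x τ p * D.m p - q| + |∑ p, D.m p ^ 2 - q| := by
  have : D.Q σ τ = (D.R σ τ - q) - (∑ p, D.x σ p * D.m p - q) - (∑ p, D.x τ p * D.m p - q)
    + (∑ p, D.m p ^ 2 - q) := by unfold Q; ring
  rw [this]
  refine (abs_add_le _ _).trans (add_le_add_left ((abs_sub _ _).trans
    (add_le_add_left (abs_sub _ _) _)) _)

lemma abs_Q_le_four (σ τ : S) : |D.Q σ τ| ≤ 4 := by
  have h1 := D.abs_R_le σ τ
  have h2 := D.abs_Rm_le σ
  have h3 := D.abs_Rm_le τ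
  have h4 := D.sum_m_sq_le
  have h5 : |∑ p, D.m p ^ 2| = ∑ p, D.m p ^ 2 :=
    abs_of_nonneg (Finset.sum_nonneg fun _ _ => sq_nonneg _)
  have h6 := D.abs_Q_le 0 σ τ
  simp only [sub_zero] at h6
  have := D.v_le
  linarith

lemma sum_abs_Q_le (q : ℝ) : ∑ σ, D.w σ * ∑ τ, D.w τ * |D.Q σ τ| ≤ 4 * D.dev q := by
  have h1 : ∑ σ, D.w σ * ∑ τ, D.w τ * |D.Q σ τ| ≤ ∑ σ, D.w σ * ∑ τ, D.w τ *
      (|D.R σ τ - q| + |∑ p, D.x σ p * D.m p - q|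
        + |∑ p, D.x τ p * D.m p - q| + |∑ p, D.m p ^ 2 - q|) :=
    Finset.sum_le_sum fun σ _ => mul_le_mul_of_nonneg_left (Finset.sum_le_sum fun τ _ =>
      mul_le_mul_of_nonneg_left (D.abs_Q_le q σ τ) (D.w_nonneg τ)) (D.w_nonneg σ)
  refine h1.trans ?_
  simp_rw [mul_add, Finset.sum_add_distrib, D.sum_w_mul_const, mul_add, Finset.sum_add_distrib,
    D.sum_w_mul_const, ← D.dev_eq]
  have := D.sum_abs_Rm_sub_le q
  have := D.abs_sum_m_sq_sub_le q
  linarith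

lemma integral_sq_tilt_le (k q : ℝ) :
    Integrable (fun g => D.tilt k g ^ 2) (stdPi ι) ∧
    ∫ g, D.tilt k g ^ 2 ∂(stdPi ι) ≤ exp (2 * k ^ 2) * (1 + 4 * k ^ 2) * 4 * D.dev q := by
  let φ : S → S → (ι → ℝ) → ℝ := fun σ τ g =>
    (∑ p, (D.x σ p - D.m p) * g p + -(k * D.res)) * (∑ p, (D.x τ p - D.m p) * g p + -(k * D.res))
      * exp (∑ p, (k * (D.x σ p + D.x τ p)) * g p)
  have e1 : ∀ g, D.tilt k g ^ 2 = ∑ σ, D.w σ * ∑ τ, D.w τ * φ σ τ g := by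
    intro g
    rw [sq, tilt, Finset.sum_mul_sum]
    refine Finset.sum_congr rfl fun σ _ => ?_
    rw [Finset.mul_sum]
    refine Finset.sum_congr rfl fun τ _ => ?_
    have l : ∀ σ, ∑ p, (D.x σ p - D.m p) * g p = D.fld σ g - D.mfld g := fun σ => by
      simp only [sub_mul, Finset.sum_sub_distrib, fld, mfld]
    have l2 : ∑ p, (k * (D.x σ p + D.x τ p)) * g p = k * D.fld σ g + k * D.fld τ g := by
      simp only [fld, Finset.mul_sum, ← Finset.sum_add_distrib]
      exact Finset.sum_congr rfl fun _ _ => by ring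
    simp only [φ]
    rw [l, l, l2, exp_add]
    ring
  have hφ := fun σ τ => integral_affine_mul_exp_stdPi (fun p => D.x σ p - D.m p)
    (fun p => D.x τ p - D.m p) (fun p => k * (D.x σ p + D.x τ p)) (-(k * D.res)) (-(k * D.res))
  have iφ : ∀ σ τ, Integrable (φ σ τ) (stdPi ι) := fun σ τ => (hφ σ τ).1
  have eφ : ∀ σ τ, ∫ g, φ σ τ g ∂(stdPi ι)
      = exp (k ^ 2 * (D.v + D.R σ τ)) * (D.Q σ τ + k ^ 2 * D.Q σ τ ^ 2) := by
    intro σ τ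
    simp only [φ]
    rw [(hφ σ τ).2]
    have s1 : ∑ p, (k * (D.x σ p + D.x τ p)) ^ 2 = k ^ 2 * (2 * (D.v + D.R σ τ)) := by
      have : ∑ p, (k * (D.x σ p + D.x τ p)) ^ 2
          = k ^ 2 * (∑ p, D.x σ p ^ 2 + 2 * D.R σ τ + ∑ p, D.x τ p ^ 2) := by
        simp only [R, Finset.mul_sum, ← Finset.sum_add_distrib]
        exact Finset.sum_congr rfl fun _ _ => by ring
      rw [this, D.norm_x, D.norm_x]; ring
    have s2 : ∑ p, (D.x σ p - D.m p) * (D.x τ p - D.m p) = D.Q σ τ := by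
      simp only [Q, R, ← Finset.sum_sub_distrib, ← Finset.sum_add_distrib]
      exact Finset.sum_congr rfl fun _ _ => by ring
    have s3 : ∑ p, (D.x σ p - D.m p) * (k * (D.x σ p + D.x τ p)) + -(k * D.res) = k * D.Q σ τ := by
      have : ∑ p, (D.x σ p - D.m p) * (k * (D.x σ p + D.x τ p))
          = k * (∑ p, D.x σ p ^ 2 + D.R σ τ - ∑ p, D.x σ p * D.m p - ∑ p, D.x τ p * D.m p) := by
        simp only [R, Finset.mul_sum, ← Finset.sum_add_distrib, ← Finset.sum_sub_distrib]
        exact Finset.sum_congr rfl fun _ _ => by ring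
      rw [this, D.norm_x, res, Q]; ring
    have s4 : ∑ p, (D.x τ p - D.m p) * (k * (D.x σ p + D.x τ p)) + -(k * D.res) = k * D.Q σ τ := by
      have : ∑ p, (D.x τ p - D.m p) * (k * (D.x σ p + D.x τ p))
          = k * (∑ p, D.x τ p ^ 2 + D.R σ τ - ∑ p, D.x σ p * D.m p - ∑ p, D.x τ p * D.m p) := by
        simp only [R, Finset.mul_sum, ← Finset.sum_add_distrib, ← Finset.sum_sub_distrib]
        exact Finset.sum_congr rfl fun _ _ => by ring
      rw [this, D.norm_x, res, Q]; ring
    rw [s1, s2, s3, s4]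
    congr 1
    · congr 1; ring
    · ring
  have i1 : ∀ σ, Integrable (fun g => ∑ τ, D.w τ * φ σ τ g) (stdPi ι) :=
    fun σ => integrable_finsetSum _ fun τ _ => (iφ σ τ).const_mul _
  simp_rw [e1]
  refine ⟨integrable_finsetSum _ fun σ _ => (i1 σ).const_mul _, ?_⟩
  have e2 : ∫ g, ∑ σ, D.w σ * ∑ τ, D.w τ * φ σ τ g ∂(stdPi ι)
      = ∑ σ, D.w σ * ∑ τ, D.w τ * ∫ g, φ σ τ g ∂(stdPi ι) := by
    rw [integral_finsetSum _ fun σ _ => (i1 σ).const_mul _]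
    refine Finset.sum_congr rfl fun σ _ => ?_
    rw [integral_const_mul, integral_finsetSum _ fun τ _ => (iφ σ τ).const_mul _]
    simp_rw [integral_const_mul]
  rw [e2]
  set L := exp (2 * k ^ 2) * (1 + 4 * k ^ 2)
  have hb : ∀ σ τ, |∫ g, φ σ τ g ∂(stdPi ι)| ≤ L * |D.Q σ τ| := by
    intro σ τ
    rw [eφ, abs_mul, abs_of_pos (exp_pos _)]
    have h1 := D.abs_Q_le_four σ τ
    have h2 : |D.Q σ τ + k ^ 2 * D.Q σ τ ^ 2| ≤ (1 + 4 * k ^ 2) * |D.Q σ τ| := by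
      refine (abs_add_le _ _).trans ?_
      rw [abs_mul, abs_of_nonneg (sq_nonneg k), abs_of_nonneg (sq_nonneg (D.Q σ τ)), ← sq_abs (D.Q σ τ)]
      have : 0 ≤ k ^ 2 * (|D.Q σ τ| * (4 - |D.Q σ τ|)) :=
        mul_nonneg (sq_nonneg k) (mul_nonneg (abs_nonneg _) (by linarith))
      linarith
    have h3 : exp (k ^ 2 * (D.v + D.R σ τ)) ≤ exp (2 * k ^ 2) := by
      have := (abs_le.1 (D.abs_R_le σ τ)).2
      have := D.v_le
      apply exp_le_exp.2
      nlinarith [sq_nonneg k]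
    calc _ ≤ exp (2 * k ^ 2) * ((1 + 4 * k ^ 2) * |D.Q σ τ|) := by gcongr
      _ = _ := by simp only [L]; ring
  have hL : 0 ≤ L := by positivity
  refine (le_abs_self _).trans ((D.abs_sum_w_mul_le fun σ =>
      D.abs_sum_w_mul_le fun τ => hb σ τ).trans ?_)
  have := mul_le_mul_of_nonneg_left (D.sum_abs_Q_le q) hL
  refine le_trans (le_of_eq ?_) (this.trans_eq (by ring))
  rw [Finset.mul_sum]
  refine Finset.sum_congr rfl fun σ _ => ?_
  rw [Finset.mul_sum, Finset.mul_sum, Finset.mul_sum]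
  exact Finset.sum_congr rfl fun τ _ => by ring

end FieldFamily

/-- The logistic function `e^y / (e^y + e^{-y})`. -/
noncomputable def logis (y : ℝ) : ℝ := exp y / (exp y + exp (-y))

lemma logis_nonneg (y : ℝ) : 0 ≤ logis y := by unfold logis; positivity

lemma logis_le_one (y : ℝ) : logis y ≤ 1 := by
  unfold logis
  rw [div_le_one (by positivity)]
  linarith [exp_pos (-y)]

lemma abs_logis_sub_le (y y' : ℝ) : |logis y - logis y'| ≤ 2 * |y - y'| := by
  wlog h : y' ≤ y generalizing y y'
  · rw [abs_sub_comm, abs_sub_comm y]; exact this _ _ (le_of_not_ge h)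
  have e : ∀ y, logis y = (1 + exp (-(2 * y)))⁻¹ := by
    intro y
    have : exp (-y) = exp y * exp (-(2 * y)) := by rw [← exp_add]; congr 1; ring
    rw [logis, this]
    have := exp_pos y
    field_simp
  have h1 : exp (-(2 * y)) ≤ exp (-(2 * y')) := exp_le_exp.2 (by linarith)
  have h2 : exp (-(2 * y)) = exp (-(2 * y')) * exp (-(2 * (y - y'))) := by
    rw [← exp_add]; congr 1; ring
  have h3 : 1 - 2 * (y - y') ≤ exp (-(2 * (y - y'))) := by
    linarith [add_one_le_exp (-(2 * (y - y')))]
  rw [e, e, abs_of_nonneg (sub_nonneg.2 (inv_anti₀ (by positivity) (by linarith))),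
    abs_of_nonneg (sub_nonneg.2 h)]
  have p1 := exp_pos (-(2 * y))
  have p2 := exp_pos (-(2 * y'))
  rw [inv_sub_inv (by positivity) (by positivity), div_le_iff₀ (by positivity)]
  have h4 : exp (-(2 * y')) - exp (-(2 * y)) ≤ exp (-(2 * y')) * (2 * (y - y')) := by
    rw [h2]; nlinarith
  have h5 : 0 ≤ 2 * (y - y') := by linarith
  nlinarith [mul_nonneg h5 p1.le, mul_nonneg h5 p2.le, mul_nonneg h5 (mul_pos p1 p2).le]

/-- Expectation of `u` under the two-component Gaussian mixture with field `r` and variance `s`. -/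
noncomputable def mixE (β h : ℝ) (u : ℝ → ℝ) (r s : ℝ) : ℝ :=
  logis (β * r + h) * ∫ x, u x ∂(gaussianReal (r + β * s) s.toNNReal)
    + (1 - logis (β * r + h)) * ∫ x, u x ∂(gaussianReal (r - β * s) s.toNNReal)

lemma abs_integral_le_of_bound {α : Type*} [MeasurableSpace α] (μ : Measure α)
    [IsProbabilityMeasure μ] {u : α → ℝ} {M : ℝ} (hM : ∀ x, |u x| ≤ M) : |∫ x, u x ∂μ| ≤ M := by
  have := norm_integral_le_of_norm_le_const (μ := μ) (f := u) (C := M) (.of_forall hM)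
  simpa using this

lemma abs_mixE_le {u : ℝ → ℝ} {M : ℝ} (hM : ∀ x, |u x| ≤ M) (β h r s : ℝ) :
    |mixE β h u r s| ≤ M := by
  have h1 := logis_nonneg (β * r + h)
  have h2 := logis_le_one (β * r + h)
  have i1 := abs_le.1 (abs_integral_le_of_bound (gaussianReal (r + β * s) s.toNNReal) hM)
  have i2 := abs_le.1 (abs_integral_le_of_bound (gaussianReal (r - β * s) s.toNNReal) hM)
  unfold mixE
  rw [abs_le]
  constructor <;> nlinarith

lemma sq_mixE_sub_le {u : ℝ → ℝ} (hu : Measurable u) {M : ℝ} (hM : ∀ x, |u x| ≤ M) (β h r r' : ℝ)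
    {s s' κ : ℝ} (hκ : 0 < κ) (hs : κ ≤ s) (hs' : 0 ≤ s') :
    (mixE β h u r' s' - mixE β h u r s) ^ 2 ≤ M ^ 2 *
      ((16 / κ ^ 2 + 32 * β ^ 2 / κ) * (s' - s) ^ 2 + (32 / κ + 32 * β ^ 2) * (r' - r) ^ 2) := by
  have hs0 : 0 < s := hκ.trans_le hs
  have hM0 : 0 ≤ M := (abs_nonneg _).trans (hM 0)
  have c1 : (s.toNNReal : ℝ) = s := Real.coe_toNNReal _ hs0.le
  have c2 : (s'.toNNReal : ℝ) = s' := Real.coe_toNNReal _ hs'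
  have key : ∀ t : ℝ, t ^ 2 = β ^ 2 → (∫ x, u x ∂(gaussianReal (r' + t * s') s'.toNNReal)
      - ∫ x, u x ∂(gaussianReal (r + t * s) s.toNNReal)) ^ 2
      ≤ M ^ 2 * ((8 / κ ^ 2 + 16 * β ^ 2 / κ) * (s' - s) ^ 2 + 16 / κ * (r' - r) ^ 2) := by
    intro t ht
    have h1 := sq_integral_gaussianReal_sub_le hu hM (r' + t * s') (r + t * s) s'.toNNReal
      (b := s.toNNReal) (by rw [← NNReal.coe_pos, c1]; exact hs0)
    rw [c1, c2] at h1
    refine h1.trans ?_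
    have h2 : (s' - s) ^ 2 / s ^ 2 ≤ (s' - s) ^ 2 / κ ^ 2 := by gcongr
    have h3 : (r' + t * s' - (r + t * s)) ^ 2 / s ≤ (2 * (r' - r) ^ 2 + 2 * β ^ 2 * (s' - s) ^ 2) / κ := by
      refine div_le_div₀ (by positivity) ?_ hκ hs
      rw [← ht]
      nlinarith [sq_nonneg ((r' - r) - t * (s' - s))]
    calc _ ≤ 8 * M ^ 2 * ((s' - s) ^ 2 / κ ^ 2
          + (2 * (r' - r) ^ 2 + 2 * β ^ 2 * (s' - s) ^ 2) / κ) := by gcongr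
      _ = _ := by ring
  have k1 := key β rfl
  have k2 := key (-β) (by ring)
  simp only [neg_mul, ← sub_eq_add_neg] at k2
  have i1 := abs_le.1 (abs_integral_le_of_bound (gaussianReal (r + β * s) s.toNNReal) hM)
  have i2 := abs_le.1 (abs_integral_le_of_bound (gaussianReal (r - β * s) s.toNNReal) hM)
  have hp0 := logis_nonneg (β * r' + h)
  have hp1 := logis_le_one (β * r' + h)
  have hp : (logis (β * r' + h) - logis (β * r + h)) ^ 2 ≤ 4 * β ^ 2 * (r' - r) ^ 2 := by
    have := abs_logis_sub_le (β * r' + h) (β * r + h)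
    calc _ = |logis (β * r' + h) - logis (β * r + h)| ^ 2 := (sq_abs _).symm
      _ ≤ (2 * |β * r' + h - (β * r + h)|) ^ 2 := by gcongr
      _ = _ := by rw [mul_pow, sq_abs]; ring
  unfold mixE
  set p' := logis (β * r' + h)
  set p := logis (β * r + h)
  set I₁' := ∫ x, u x ∂(gaussianReal (r' + β * s') s'.toNNReal)
  set I₁ := ∫ x, u x ∂(gaussianReal (r + β * s) s.toNNReal)
  set I₂' := ∫ x, u x ∂(gaussianReal (r' - β * s') s'.toNNReal)
  set I₂ := ∫ x, u x ∂(gaussianReal (r - β * s) s.toNNReal)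
  set B := M ^ 2 * ((8 / κ ^ 2 + 16 * β ^ 2 / κ) * (s' - s) ^ 2 + 16 / κ * (r' - r) ^ 2)
  have e : p' * I₁' + (1 - p') * I₂' - (p * I₁ + (1 - p) * I₂)
      = (p' * (I₁' - I₁) + (1 - p') * (I₂' - I₂)) + (p' - p) * (I₁ - I₂) := by ring
  have h1 : (p' * (I₁' - I₁) + (1 - p') * (I₂' - I₂)) ^ 2 ≤ B := by
    have : (p' * (I₁' - I₁) + (1 - p') * (I₂' - I₂)) ^ 2
        ≤ p' * (I₁' - I₁) ^ 2 + (1 - p') * (I₂' - I₂) ^ 2 := by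
      nlinarith [mul_nonneg (mul_nonneg hp0 (sub_nonneg.2 hp1))
        (sq_nonneg ((I₁' - I₁) - (I₂' - I₂)))]
    have := mul_le_mul_of_nonneg_left k1 hp0
    have := mul_le_mul_of_nonneg_left k2 (sub_nonneg.2 hp1)
    linarith
  have h2 : (I₁ - I₂) ^ 2 ≤ 4 * M ^ 2 := by
    have : |I₁ - I₂| ≤ 2 * M := by rw [abs_le]; constructor <;> linarith
    calc _ = |I₁ - I₂| ^ 2 := (sq_abs _).symm
      _ ≤ (2 * M) ^ 2 := by gcongr
      _ = _ := by ring
  have h3 : ((p' - p) * (I₁ - I₂)) ^ 2 ≤ 4 * β ^ 2 * (r' - r) ^ 2 * (4 * M ^ 2) := by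
    rw [mul_pow]; gcongr
  rw [e]
  calc _ ≤ 2 * (p' * (I₁' - I₁) + (1 - p') * (I₂' - I₂)) ^ 2 + 2 * ((p' - p) * (I₁ - I₂)) ^ 2 := by
        linarith [sq_nonneg ((p' * (I₁' - I₁) + (1 - p') * (I₂' - I₂)) - (p' - p) * (I₁ - I₂))]
    _ ≤ 2 * B + 2 * (4 * β ^ 2 * (r' - r) ^ 2 * (4 * M ^ 2)) := by linarith
    _ = _ := by simp only [B]; ring

lemma integral_affine_mul_exp_gaussianReal (u : ℝ → ℝ) (hu : Measurable u) (β r : ℝ) {s : ℝ}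
    (hs : 0 ≤ s) :
    ∫ z, u (r + √s * z) * exp (β * (√s * z)) ∂(gaussianReal 0 1)
      = exp (β ^ 2 * s / 2) * ∫ x, u x ∂(gaussianReal (r + β * s) s.toNNReal) := by
  have hss : √s ^ 2 = s := Real.sq_sqrt hs
  have h1 : gaussianReal (r + β * s) s.toNNReal
      = (gaussianReal (β * √s) 1).map (fun z => r + √s * z) := by
    have := gaussianReal_map_const_mul (μ := β * √s) (v := 1) √s
    have h2 : (fun z : ℝ => r + √s * z) = (fun z => r + z) ∘ (fun z => √s * z) := rfl
    rw [h2, ← Measure.map_map (by fun_prop) (by fun_prop), this, gaussianReal_map_const_add]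
    congr 1
    · rw [show √s * (β * √s) + r = r + β * √s ^ 2 by ring, hss]
    · rw [← NNReal.coe_inj]
      simp [hss, hs]
  rw [h1, integral_map (by fun_prop) hu.aestronglyMeasurable, ← gaussianReal_withDensity_exp (β * √s),
    integral_withDensity_eq_integral_toReal_smul (by fun_prop)
      (.of_forall fun z => ENNReal.ofReal_lt_top), ← integral_const_mul]
  congr 1; ext z
  rw [ENNReal.toReal_ofReal (exp_pos _).le, smul_eq_mul, mul_left_comm, mul_comm (exp _),
    mul_comm (exp _), mul_assoc, ← exp_add]
  congr 2
  rw [mul_pow, hss]; ring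

namespace FieldFamily
variable {ι S : Type*} [Fintype ι] [Fintype S] (D : FieldFamily ι S)

lemma gavg_mul_cosh {u : ℝ → ℝ} (hu : Measurable u) {M : ℝ} (hM : ∀ x, |u x| ≤ M) (β h : ℝ)
    (g : ι → ℝ) :
    D.gavg (fun x => u x * cosh (β * x + h)) g
      = exp (β ^ 2 * D.res / 2) * cosh (β * D.mfld g + h) * mixE β h u (D.mfld g) D.res := by
  have e : ∀ z, u (D.mfld g + √D.res * z) * cosh (β * (D.mfld g + √D.res * z) + h)
      = exp (β * D.mfld g + h) / 2 * (u (D.mfld g + √D.res * z) * exp (β * (√D.res * z)))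
        + exp (-(β * D.mfld g + h)) / 2 *
          (u (D.mfld g + √D.res * z) * exp (-β * (√D.res * z))) := by
    intro z
    rw [cosh_eq]
    have h1 : exp (β * (D.mfld g + √D.res * z) + h)
        = exp (β * D.mfld g + h) * exp (β * (√D.res * z)) := by rw [← exp_add]; congr 1; ring
    have h2 : exp (-(β * (D.mfld g + √D.res * z) + h))
        = exp (-(β * D.mfld g + h)) * exp (-β * (√D.res * z)) := by rw [← exp_add]; congr 1; ring
    rw [h1, h2]; ring
  have hi : ∀ k : ℝ, Integrable (fun z => u (D.mfld g + √D.res * z) * exp (k * (√D.res * z)))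
      (gaussianReal 0 1) := by
    intro k
    refine Integrable.bdd_mul (c := M) ?_ (hu.comp (by fun_prop)).aestronglyMeasurable
      (.of_forall fun z => hM _)
    simp_rw [← mul_assoc]
    exact integrable_exp_mul_gaussianReal _
  unfold gavg
  simp_rw [e]
  rw [integral_add ((hi _).const_mul _) ((hi _).const_mul _), integral_const_mul,
    integral_const_mul, integral_affine_mul_exp_gaussianReal u hu _ _ D.res_nonneg,
    integral_affine_mul_exp_gaussianReal u hu _ _ D.res_nonneg, mixE, logis, cosh_eq]
  simp only [neg_mul, ← sub_eq_add_neg, neg_sq]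
  have h1 := exp_pos (β * D.mfld g + h)
  have h2 := exp_pos (-(β * D.mfld g + h))
  field_simp
  ring

lemma gavg_cosh (β h : ℝ) (g : ι → ℝ) :
    D.gavg (fun x => cosh (β * x + h)) g
      = exp (β ^ 2 * D.res / 2) * cosh (β * D.mfld g + h) := by
  have := D.gavg_mul_cosh (u := fun _ => 1) measurable_const (M := 1) (by simp) β h g
  simpa [mixE] using this

lemma one_le_avg_cosh (β h : ℝ) (g : ι → ℝ) : 1 ≤ D.avg (fun x => cosh (β * x + h)) g := by
  rw [avg, ← D.sum_w]
  exact Finset.sum_le_sum fun σ _ => le_mul_of_one_le_right (D.w_nonneg σ) (one_le_cosh _)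

/-- The effective field of the tilted family. -/
noncomputable def field (β h s : ℝ) (g : ι → ℝ) : ℝ :=
  (D.avg (fun x => x * cosh (β * x + h)) g - β * s * D.avg (fun x => sinh (β * x + h)) g)
    / D.avg (fun x => cosh (β * x + h)) g

lemma abs_avg_sinh_le (β h : ℝ) (g : ι → ℝ) :
    |D.avg (fun x => sinh (β * x + h)) g| ≤ D.avg (fun x => cosh (β * x + h)) g := by
  refine D.abs_sum_w_mul_le fun σ => ?_
  have h1 := sinh_lt_cosh (β * D.fld σ g + h)
  have h2 := sinh_lt_cosh (-(β * D.fld σ g + h))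
  rw [sinh_neg, cosh_neg] at h2
  rw [abs_le]; constructor <;> linarith

lemma sq_field_sub_le (β h s : ℝ) (g : ι → ℝ) :
    (D.field β h s g - D.mfld g) ^ 2 ≤ exp h ^ 2 * D.tilt β g ^ 2 + exp (-h) ^ 2 * D.tilt (-β) g ^ 2
      + 2 * β ^ 2 * (D.res - s) ^ 2 := by
  have hC := D.one_le_avg_cosh β h g
  have hS := D.abs_avg_sinh_le β h g
  have hC0 : 0 < D.avg (fun x => cosh (β * x + h)) g := by linarith
  have e : D.field β h s g - D.mfld g
      = (exp h * D.tilt β g / 2 + exp (-h) * D.tilt (-β) g / 2)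
          / D.avg (fun x => cosh (β * x + h)) g
        + β * (D.res - s) * (D.avg (fun x => sinh (β * x + h)) g
          / D.avg (fun x => cosh (β * x + h)) g) := by
    have h1 : exp h * D.tilt β g / 2 + exp (-h) * D.tilt (-β) g / 2
        = D.avg (fun x => x * cosh (β * x + h)) g
          - D.mfld g * D.avg (fun x => cosh (β * x + h)) g
          - β * D.res * D.avg (fun x => sinh (β * x + h)) g := by
      simp only [tilt, avg, Finset.mul_sum, Finset.sum_div, ← Finset.sum_sub_distrib,
        ← Finset.sum_add_distrib]
      refine Finset.sum_congr rfl fun σ _ => ?_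
      rw [cosh_eq, sinh_eq, neg_add, exp_add, exp_add, neg_mul]
      ring_nf
    rw [h1, field]
    generalize D.avg (fun x => cosh (β * x + h)) g = c at *
    generalize D.avg (fun x => x * cosh (β * x + h)) g = a at *
    field_simp
    ring_nf
  set C := D.avg (fun x => cosh (β * x + h)) g
  set θ := D.avg (fun x => sinh (β * x + h)) g / C
  have hθ : θ ^ 2 ≤ 1 := by
    rw [← sq_abs, abs_div, abs_of_pos hC0]
    exact pow_le_one₀ (by positivity) ((div_le_one hC0).2 hS)
  have h1 : ((exp h * D.tilt β g / 2 + exp (-h) * D.tilt (-β) g / 2) / C) ^ 2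
      ≤ (exp h ^ 2 * D.tilt β g ^ 2 + exp (-h) ^ 2 * D.tilt (-β) g ^ 2) / 2 := by
    rw [div_pow]
    refine (div_le_self (sq_nonneg _) (one_le_pow₀ hC)).trans ?_
    nlinarith [sq_nonneg (exp h * D.tilt β g - exp (-h) * D.tilt (-β) g)]
  have h2 : (β * (D.res - s) * θ) ^ 2 ≤ β ^ 2 * (D.res - s) ^ 2 := by
    rw [mul_pow, mul_pow]
    exact mul_le_of_le_one_right (by positivity) hθ
  rw [e]
  refine (add_sq_le).trans ?_
  linarith

end FieldFamily

/-- The constant in the mean square estimate for `FieldFamily.gap`. -/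
noncomputable def gapC (β h κ : ℝ) : ℝ :=
  128 * momC β h / κ + 2 * (16 / κ ^ 2 + 32 * β ^ 2 / κ)
    + 4 * β ^ 2 * (32 / κ + 32 * β ^ 2)
    + 2 * (32 / κ + 32 * β ^ 2) * (exp h ^ 2 + exp (-h) ^ 2) * (exp (2 * β ^ 2) * (1 + 4 * β ^ 2) * 4)

lemma gapC_pos (β h : ℝ) {κ : ℝ} (hκ : 0 < κ) : 0 < gapC β h κ := by
  have := one_le_momC β h
  unfold gapC
  positivity

namespace FieldFamily
variable {ι S : Type*} [Fintype ι] [Fintype S] (D : FieldFamily ι S)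

/-- The error in approximating the tilted law of the forms by a Gaussian mixture. -/
noncomputable def gap (β h s : ℝ) (u : ℝ → ℝ) (g : ι → ℝ) : ℝ :=
  D.avg (fun x => u x * cosh (β * x + h)) g / D.avg (fun x => cosh (β * x + h)) g
    - mixE β h u (D.field β h s g) s

lemma abs_avg_div_le {u : ℝ → ℝ} {M : ℝ} (hM : ∀ x, |u x| ≤ M) (β h : ℝ) (g : ι → ℝ) :
    |D.avg (fun x => u x * cosh (β * x + h)) g / D.avg (fun x => cosh (β * x + h)) g| ≤ M := by
  have hC := D.one_le_avg_cosh β h g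
  rw [abs_div, abs_of_pos (by linarith : 0 < D.avg (fun x => cosh (β * x + h)) g),
    div_le_iff₀ (by linarith)]
  have := D.abs_sum_w_mul_le (a := fun σ => u (D.fld σ g) * cosh (β * D.fld σ g + h))
    (b := fun σ => M * cosh (β * D.fld σ g + h)) fun σ => by
      rw [abs_mul, abs_of_pos (cosh_pos _)]
      exact mul_le_mul_of_nonneg_right (hM _) (cosh_pos _).le
  refine this.trans_eq ?_
  rw [avg, Finset.mul_sum]
  exact Finset.sum_congr rfl fun _ _ => by ring

lemma sq_gap_le {u : ℝ → ℝ} (hu : Measurable u) {M : ℝ} (hM : ∀ x, |u x| ≤ M) (β h : ℝ)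
    {s κ : ℝ} (hκ : 0 < κ) (hs : κ ≤ s) (g : ι → ℝ) :
    D.gap β h s u g ^ 2 ≤
      4 * (D.avg (fun x => u x * cosh (β * x + h)) g
        - D.gavg (fun x => u x * cosh (β * x + h)) g) ^ 2
      + 4 * M ^ 2 * (D.avg (fun x => cosh (β * x + h)) g
        - D.gavg (fun x => cosh (β * x + h)) g) ^ 2
      + 2 * M ^ 2 * (32 / κ + 32 * β ^ 2) *
        (exp h ^ 2 * D.tilt β g ^ 2 + exp (-h) ^ 2 * D.tilt (-β) g ^ 2)
      + M ^ 2 * (2 * (16 / κ ^ 2 + 32 * β ^ 2 / κ) + 4 * β ^ 2 * (32 / κ + 32 * β ^ 2))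
        * (D.res - s) ^ 2 := by
  have hC := D.one_le_avg_cosh β h g
  have hm := abs_mixE_le hM β h (D.mfld g) D.res
  have h1 := sq_mixE_sub_le hu hM β h (D.field β h s g) (D.mfld g) hκ hs D.res_nonneg
  have h2 := D.sq_field_sub_le β h s g
  have e1 := D.gavg_mul_cosh hu hM β h g
  have e2 := D.gavg_cosh β h g
  rw [← e2] at e1
  rw [gap]
  generalize D.avg (fun x => u x * cosh (β * x + h)) g = a at *
  generalize D.gavg (fun x => u x * cosh (β * x + h)) g = b at *
  generalize D.avg (fun x => cosh (β * x + h)) g = c at *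
  generalize D.gavg (fun x => cosh (β * x + h)) g = d at *
  generalize mixE β h u (D.mfld g) D.res = m at *
  generalize mixE β h u (D.field β h s g) s = m' at *
  generalize hB : 32 / κ + 32 * β ^ 2 = B at *
  generalize 16 / κ ^ 2 + 32 * β ^ 2 / κ = A at *
  have hB0 : 0 ≤ B := by rw [← hB]; positivity
  rw [show (D.mfld g - D.field β h s g) ^ 2 = (D.field β h s g - D.mfld g) ^ 2 by ring] at h1
  have e : a / c - m' = ((a - b) - m * (c - d)) / c + (m - m') := by
    have : c ≠ 0 := by linarith
    rw [e1]; field_simp; ring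
  have h3 : (((a - b) - m * (c - d)) / c) ^ 2 ≤ 2 * (a - b) ^ 2 + 2 * (M ^ 2 * (c - d) ^ 2) := by
    rw [div_pow]
    refine (div_le_self (sq_nonneg _) (one_le_pow₀ hC)).trans ?_
    have : (m * (c - d)) ^ 2 ≤ M ^ 2 * (c - d) ^ 2 := by
      rw [mul_pow]
      exact mul_le_mul_of_nonneg_right (sq_le_sq' (abs_le.1 hm).1 (abs_le.1 hm).2) (sq_nonneg _)
    nlinarith [sq_nonneg ((a - b) + m * (c - d))]
  have h4 := mul_le_mul_of_nonneg_left h2 (mul_nonneg (sq_nonneg M) hB0)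
  rw [e]
  refine (add_sq_le).trans ?_
  nlinarith

lemma sq_res_sub_le {s : ℝ} (hs : 0 ≤ s) (hs1 : s ≤ 1) :
    (D.res - s) ^ 2 ≤ (1 - D.v) + D.dev (1 - s) := by
  have h0 := D.res_nonneg
  have h1 := D.res_le_one
  have h2 := D.abs_sum_m_sq_sub_le (1 - s)
  have hv := D.v_le
  have h3 : |D.res - s| ≤ 1 := by rw [abs_le]; constructor <;> linarith
  have h4 : |D.res - s| ≤ (1 - D.v) + D.dev (1 - s) := by
    have := abs_le.1 h2
    unfold res
    rw [abs_le]; constructor <;> linarith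
  rw [← sq_abs]
  nlinarith [abs_nonneg (D.res - s)]

theorem integral_sq_gap_le {u : ℝ → ℝ} (hu : Measurable u) {M : ℝ} (hM : ∀ x, |u x| ≤ M)
    (β h : ℝ) {s κ : ℝ} (hκ : 0 < κ) (hs1 : s ≤ 1) (hs : κ ≤ D.v - (1 - s)) :
    ∫ g, D.gap β h s u g ^ 2 ∂(stdPi ι) ≤
      gapC β h κ * M ^ 2 * (D.dev (1 - s) + (1 - D.v)) := by
  have hv := D.v_le
  have hκs : κ ≤ s := by linarith
  have hr := D.sq_res_sub_le (hκ.le.trans hκs) hs1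
  have hmc := one_le_momC β h
  have hd := D.dev_nonneg (1 - s)
  obtain ⟨i1, b1⟩ := D.integral_sq_avg_sub_gavg_le (β := β) (h := h) (M := M)
    (f := fun x => u x * cosh (β * x + h)) (by fun_prop)
    (fun x => by
      rw [abs_mul, abs_of_pos (cosh_pos _)]
      exact mul_le_mul_of_nonneg_right (hM _) (cosh_pos _).le) hκ (sub_nonneg.2 hs1) hs
  obtain ⟨i2, b2⟩ := D.integral_sq_avg_sub_gavg_le (β := β) (h := h) (M := 1)
    (f := fun x => cosh (β * x + h)) (by fun_prop)
    (fun x => by rw [abs_of_pos (cosh_pos _), one_mul]) hκ (sub_nonneg.2 hs1) hs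
  obtain ⟨i3, b3⟩ := D.integral_sq_tilt_le β (1 - s)
  obtain ⟨i4, b4⟩ := D.integral_sq_tilt_le (-β) (1 - s)
  refine (integral_mono_of_nonneg (.of_forall fun g => sq_nonneg _) ?_
    (.of_forall fun g => D.sq_gap_le hu hM β h hκ hκs g)).trans ?_
  · exact (((i1.const_mul _).add (i2.const_mul _)).add
      (((i3.const_mul _).add (i4.const_mul _)).const_mul _)).add (integrable_const _)
  rw [integral_add ?_ (integrable_const _), integral_add ?_ ?_,
    integral_add (i1.const_mul _) (i2.const_mul _), integral_const_mul, integral_const_mul,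
    integral_const_mul, integral_add (i3.const_mul _) (i4.const_mul _), integral_const_mul,
    integral_const_mul]
  rotate_left
  · exact (i1.const_mul _).add (i2.const_mul _)
  · exact ((i3.const_mul _).add (i4.const_mul _)).const_mul _
  · exact ((i1.const_mul _).add (i2.const_mul _)).add
      (((i3.const_mul _).add (i4.const_mul _)).const_mul _)
  simp only [integral_const, probReal_univ, one_smul]
  simp only [neg_sq] at b4
  unfold gapC
  generalize hT : exp (2 * β ^ 2) * (1 + 4 * β ^ 2) * 4 = T at *
  generalize ∫ g, (D.avg (fun x => u x * cosh (β * x + h)) g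
        - D.gavg (fun x => u x * cosh (β * x + h)) g) ^ 2 ∂(stdPi ι) = I1 at *
  generalize ∫ g, (D.avg (fun x => cosh (β * x + h)) g
        - D.gavg (fun x => cosh (β * x + h)) g) ^ 2 ∂(stdPi ι) = I2 at *
  generalize ∫ g, D.tilt β g ^ 2 ∂(stdPi ι) = I3 at *
  generalize ∫ g, D.tilt (-β) g ^ 2 ∂(stdPi ι) = I4 at *
  have hB0 : 0 ≤ 32 / κ + 32 * β ^ 2 := by positivity
  have hA0 : 0 ≤ 16 / κ ^ 2 + 32 * β ^ 2 / κ := by positivity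
  have hL0 : 0 ≤ momC β h / κ := by positivity
  have hT0 : 0 ≤ T := by rw [← hT]; positivity
  rw [mul_div_assoc (128 : ℝ) (momC β h) κ]
  have b1' : I1 ≤ 16 * (momC β h / κ) * M ^ 2 * D.dev (1 - s) := b1.trans_eq (by ring)
  have b2' : I2 ≤ 16 * (momC β h / κ) * D.dev (1 - s) := b2.trans_eq (by ring)
  generalize 32 / κ + 32 * β ^ 2 = B at *
  generalize 16 / κ ^ 2 + 32 * β ^ 2 / κ = A at *
  generalize momC β h / κ = L at *
  generalize D.dev (1 - s) = d at *
  have hv' : 0 ≤ 1 - D.v := by linarith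
  generalize 1 - D.v = w at *
  have hE : 0 ≤ exp h ^ 2 + exp (-h) ^ 2 := by positivity
  have b34 : exp h ^ 2 * I3 + exp (-h) ^ 2 * I4 ≤ (exp h ^ 2 + exp (-h) ^ 2) * (T * d) := by
    nlinarith [mul_le_mul_of_nonneg_left b3 (sq_nonneg (exp h)),
      mul_le_mul_of_nonneg_left b4 (sq_nonneg (exp (-h)))]
  have hMM := sq_nonneg M
  have t1 := mul_le_mul_of_nonneg_left b2' hMM
  have t2 := mul_le_mul_of_nonneg_left b34 (mul_nonneg hMM hB0)
  have t3 := mul_le_mul_of_nonneg_left hr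
    (mul_nonneg hMM (by positivity : 0 ≤ 2 * A + 4 * β ^ 2 * B))
  have t4 : 0 ≤ M ^ 2 * L * w := by positivity
  have t5 : 0 ≤ M ^ 2 * B * ((exp h ^ 2 + exp (-h) ^ 2) * T) * w := by positivity
  calc _ ≤ 4 * (16 * L * M ^ 2 * d) + 4 * (M ^ 2 * (16 * L * d))
        + 2 * (M ^ 2 * B * ((exp h ^ 2 + exp (-h) ^ 2) * (T * d)))
        + M ^ 2 * (2 * A + 4 * β ^ 2 * B) * (w + d) := by linarith
    _ ≤ _ := by linarith

end FieldFamily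

/-- A bound on the second moment of `cosh (β x + h)` for centred Gaussian `x` of variance at most
one. -/
noncomputable def cavC (β h : ℝ) : ℝ := cosh (2 * h) * exp (2 * β ^ 2)

lemma one_le_cavC (β h : ℝ) : 1 ≤ cavC β h := by
  have h1 := one_le_cosh (2 * h)
  have h2 : 1 ≤ exp (2 * β ^ 2) := one_le_exp (by positivity)
  unfold cavC; nlinarith

namespace FieldFamily
variable {ι S : Type*} [Fintype ι] [Fintype S] (D : FieldFamily ι S)

lemma measurable_fld (σ : S) : Measurable (D.fld σ) := by
  unfold fld
  exact Finset.measurable_fun_sum _ fun p _ => by fun_prop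

lemma measurable_avg {f : ℝ → ℝ} (hf : Measurable f) : Measurable (D.avg f) := by
  unfold avg
  exact Finset.measurable_fun_sum _ fun σ _ => (hf.comp (D.measurable_fld σ)).const_mul _

lemma sq_cosh_fld_eq (β h : ℝ) (σ : S) (g : ι → ℝ) :
    cosh (β * D.fld σ g + h) ^ 2 = 1 / 2 + exp (2 * h) / 4 * exp (∑ p, 2 * β * D.x σ p * g p)
      + exp (-(2 * h)) / 4 * exp (∑ p, -(2 * β) * D.x σ p * g p) := by
  have e1 : exp (∑ p, 2 * β * D.x σ p * g p) = exp (β * D.fld σ g) ^ 2 := by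
    rw [← exp_nat_mul]; simp only [fld, Finset.mul_sum]
    congr 1; exact Finset.sum_congr rfl fun _ _ => by push_cast; ring
  have e2 : exp (∑ p, -(2 * β) * D.x σ p * g p) = exp (-(β * D.fld σ g)) ^ 2 := by
    rw [← exp_nat_mul]; simp only [fld, Finset.mul_sum, ← Finset.sum_neg_distrib]
    congr 1; exact Finset.sum_congr rfl fun _ _ => by push_cast; ring
  have e3 : exp (2 * h) = exp h ^ 2 := by rw [← exp_nat_mul]; norm_num
  have e4 : exp (-(2 * h)) = exp (-h) ^ 2 := by rw [← exp_nat_mul]; norm_num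
  have e5 : exp (β * D.fld σ g) * exp (-(β * D.fld σ g)) = 1 := by rw [← exp_add]; simp
  have e6 : exp h * exp (-h) = 1 := by rw [← exp_add]; simp
  rw [e1, e2, e3, e4, cosh_eq, neg_add, exp_add, exp_add]
  linear_combination (1 / 2) * e5 * exp h * exp (-h) + (1 / 2) * e6

lemma integrable_sq_cosh_fld (β h : ℝ) (σ : S) :
    Integrable (fun g => cosh (β * D.fld σ g + h) ^ 2) (stdPi ι) := by
  simp_rw [sq_cosh_fld_eq]
  exact ((integrable_const _).add ((integrable_exp_stdPi _).const_mul _)).add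
    ((integrable_exp_stdPi _).const_mul _)

lemma integral_sq_cosh_fld_le (β h : ℝ) (σ : S) :
    ∫ g, cosh (β * D.fld σ g + h) ^ 2 ∂(stdPi ι) ≤ cavC β h := by
  have hv : ∀ k : ℝ, k ^ 2 = 4 * β ^ 2 → (∑ p, (k * D.x σ p) ^ 2) / 2 ≤ 2 * β ^ 2 := by
    intro k hk
    simp_rw [mul_pow, hk, ← Finset.mul_sum, D.norm_x]
    nlinarith [D.v_le, sq_nonneg β]
  simp_rw [sq_cosh_fld_eq]
  have hi : Integrable (fun g : ι → ℝ => 1 / 2 + exp (2 * h) / 4 * exp (∑ p, 2 * β * D.x σ p * g p))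
      (stdPi ι) := (integrable_const _).add ((integrable_exp_stdPi _).const_mul _)
  rw [integral_add hi ((integrable_exp_stdPi _).const_mul _), integral_add (integrable_const _) ((integrable_exp_stdPi _).const_mul _),
    integral_const_mul, integral_const_mul, integral_exp_stdPi, integral_exp_stdPi]
  have h1 := exp_le_exp.2 (hv (2 * β) (by ring))
  have h2 := exp_le_exp.2 (hv (-(2 * β)) (by ring))
  have h3 := mul_le_mul_of_nonneg_left h1 (exp_pos (2 * h)).le
  have h4 := mul_le_mul_of_nonneg_left h2 (exp_pos (-(2 * h))).le
  have h5 := one_le_cavC β h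
  unfold cavC at *
  rw [cosh_eq] at *
  simp only [integral_const, probReal_univ, one_smul]
  linarith

/-- Tangent-line form of Jensen's inequality for the inverse square of the tilting factor. -/
lemma inv_cavC_le_integral (β h : ℝ) :
    (cavC β h)⁻¹ ≤ ∫ g, (D.avg (fun x => cosh (β * x + h)) g ^ 2)⁻¹ ∂(stdPi ι) := by
  set A := cavC β h
  have hA : 0 < A := by linarith [one_le_cavC β h]
  have hi : Integrable (fun g => ∑ σ, D.w σ * cosh (β * D.fld σ g + h) ^ 2) (stdPi ι) :=
    integrable_finsetSum _ fun σ _ => (D.integrable_sq_cosh_fld β h σ).const_mul _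
  have hb : ∫ g, ∑ σ, D.w σ * cosh (β * D.fld σ g + h) ^ 2 ∂(stdPi ι) ≤ A := by
    rw [integral_finsetSum _ fun σ _ => (D.integrable_sq_cosh_fld β h σ).const_mul _]
    simp_rw [integral_const_mul]
    rw [← D.sum_w_mul_const A]
    exact Finset.sum_le_sum fun σ _ =>
      mul_le_mul_of_nonneg_left (D.integral_sq_cosh_fld_le β h σ) (D.w_nonneg σ)
  have hpt : ∀ g, 2 / A - (∑ σ, D.w σ * cosh (β * D.fld σ g + h) ^ 2) / A ^ 2
      ≤ (D.avg (fun x => cosh (β * x + h)) g ^ 2)⁻¹ := by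
    intro g
    have hC := D.one_le_avg_cosh β h g
    have hcs : D.avg (fun x => cosh (β * x + h)) g ^ 2
        ≤ ∑ σ, D.w σ * cosh (β * D.fld σ g + h) ^ 2 := by
      have := Finset.sum_sq_le_sum_mul_sum_of_sq_le_mul Finset.univ
        (r := fun σ => D.w σ * cosh (β * D.fld σ g + h)) (f := D.w)
        (g := fun σ => D.w σ * cosh (β * D.fld σ g + h) ^ 2) (fun σ _ => D.w_nonneg σ)
        (fun σ _ => mul_nonneg (D.w_nonneg σ) (sq_nonneg _)) (fun σ _ => (by ring : _ = _).le)
      simpa only [avg, D.sum_w, one_mul] using this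
    set y := D.avg (fun x => cosh (β * x + h)) g ^ 2
    have hy : 0 < y := by positivity
    have : 2 / A - y / A ^ 2 ≤ y⁻¹ := by
      rw [← sub_nonneg]
      have : y⁻¹ - (2 / A - y / A ^ 2) = (A - y) ^ 2 / (y * A ^ 2) := by field_simp; ring
      rw [this]; positivity
    have : y / A ^ 2 ≤ (∑ σ, D.w σ * cosh (β * D.fld σ g + h) ^ 2) / A ^ 2 := by gcongr
    linarith
  have hm : Integrable (fun g => (D.avg (fun x => cosh (β * x + h)) g ^ 2)⁻¹) (stdPi ι) := by
    refine Integrable.of_bound (C := 1)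
      ((D.measurable_avg (by fun_prop)).pow_const 2).inv.aestronglyMeasurable (.of_forall fun g => ?_)
    have hC := D.one_le_avg_cosh β h g
    rw [Real.norm_eq_abs, abs_of_nonneg (by positivity)]
    exact inv_le_one_of_one_le₀ (one_le_pow₀ hC)
  have hl : Integrable (fun g => 2 / A - (∑ σ, D.w σ * cosh (β * D.fld σ g + h) ^ 2) / A ^ 2)
      (stdPi ι) := (integrable_const _).sub (hi.div_const _)
  refine le_trans ?_ (integral_mono hl hm hpt)
  rw [integral_sub (integrable_const _) (hi.div_const _), integral_div (A ^ 2)]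
  simp only [integral_const, probReal_univ, one_smul]
  have : (∫ g, ∑ σ, D.w σ * cosh (β * D.fld σ g + h) ^ 2 ∂(stdPi ι)) / A ^ 2 ≤ A / A ^ 2 := by gcongr
  have e : A / A ^ 2 = A⁻¹ := by field_simp
  have e' : 2 / A = 2 * A⁻¹ := by rw [div_eq_mul_inv]
  linarith

lemma inv_sq_avg_cosh_le (β h : ℝ) (g : ι → ℝ) :
    (D.avg (fun x => cosh (β * x + h)) g ^ 2)⁻¹ ≤
      1 - (D.avg (fun x => sinh (β * x + h)) g / D.avg (fun x => cosh (β * x + h)) g) ^ 2 := by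
  have hC := D.one_le_avg_cosh β h g
  have e1 : D.avg (fun x => cosh (β * x + h)) g + D.avg (fun x => sinh (β * x + h)) g
      = ∑ σ, D.w σ * exp (β * D.fld σ g + h) := by
    simp only [avg, ← Finset.sum_add_distrib, ← mul_add, cosh_add_sinh]
  have e2 : D.avg (fun x => cosh (β * x + h)) g - D.avg (fun x => sinh (β * x + h)) g
      = ∑ σ, D.w σ * exp (-(β * D.fld σ g + h)) := by
    simp only [avg, ← Finset.sum_sub_distrib, ← mul_sub, cosh_sub_sinh]
  have hcs : 1 ≤ (∑ σ, D.w σ * exp (β * D.fld σ g + h))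
      * ∑ σ, D.w σ * exp (-(β * D.fld σ g + h)) := by
    have := Finset.sum_sq_le_sum_mul_sum_of_sq_le_mul Finset.univ (r := D.w)
      (f := fun σ => D.w σ * exp (β * D.fld σ g + h))
      (g := fun σ => D.w σ * exp (-(β * D.fld σ g + h)))
      (fun σ _ => mul_nonneg (D.w_nonneg σ) (exp_pos _).le)
      (fun σ _ => mul_nonneg (D.w_nonneg σ) (exp_pos _).le)
      (fun σ _ => by
        have : exp (β * D.fld σ g + h) * exp (-(β * D.fld σ g + h)) = 1 := by
          rw [← exp_add]; simp
        exact (by linear_combination -(D.w σ ^ 2) * this : _ = _).le)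
    simpa [D.sum_w] using this
  rw [← e1, ← e2] at hcs
  generalize D.avg (fun x => cosh (β * x + h)) g = c at *
  generalize D.avg (fun x => sinh (β * x + h)) g = s at *
  have hc : 0 < c := by linarith
  rw [← sub_nonneg]
  have : 1 - (s / c) ^ 2 - (c ^ 2)⁻¹ = ((c + s) * (c - s) - 1) / c ^ 2 := by
    field_simp; ring
  rw [this]
  exact div_nonneg (by linarith) (by positivity)

end FieldFamily

section merge
variable {ι : Type*} (P : ι → Prop) [DecidablePred P]

/-- Resample the coordinates satisfying `P`. -/
def merge (z : (ι → ℝ) × (ι → ℝ)) : ι → ℝ := fun p => if P p then z.2 p else z.1 p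

lemma measurable_merge : Measurable (merge P) := by
  refine measurable_pi_lambda _ fun p => ?_
  unfold merge
  split_ifs <;> fun_prop

variable [Fintype ι]

lemma map_merge_stdPi : ((stdPi ι).prod (stdPi ι)).map (merge P) = stdPi ι := by
  symm
  refine Measure.pi_eq fun s hs => ?_
  rw [Measure.map_apply (measurable_merge P) (MeasurableSet.univ_pi hs)]
  have : merge P ⁻¹' Set.univ.pi s = (Set.univ.pi fun p => if P p then Set.univ else s p) ×ˢ
      (Set.univ.pi fun p => if P p then s p else Set.univ) := by
    ext z
    simp only [Set.mem_preimage, Set.mem_pi, Set.mem_univ, true_implies, Set.mem_prod, merge]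
    rw [← forall_and]
    refine forall_congr' fun p => ?_
    split_ifs <;> simp
  rw [this, Measure.prod_prod, stdPi, Measure.pi_pi, Measure.pi_pi, ← Finset.prod_mul_distrib]
  refine Finset.prod_congr rfl fun p _ => ?_
  split_ifs <;> simp

lemma integral_stdPi_eq_merge {F : (ι → ℝ) → ℝ} (hF : Measurable F) {B : ℝ}
    (hB : ∀ g, |F g| ≤ B) :
    Integrable (fun g => ∫ g', F (merge P (g, g')) ∂(stdPi ι)) (stdPi ι) ∧
    ∫ g, F g ∂(stdPi ι) = ∫ g, ∫ g', F (merge P (g, g')) ∂(stdPi ι) ∂(stdPi ι) := by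
  have hi : Integrable (fun z => F (merge P z)) ((stdPi ι).prod (stdPi ι)) :=
    Integrable.of_bound (C := B) (hF.comp (measurable_merge P)).aestronglyMeasurable
      (.of_forall fun z => hB _)
  refine ⟨hi.integral_prod_left, ?_⟩
  conv_lhs => rw [← map_merge_stdPi P]
  rw [integral_map (measurable_merge P).aemeasurable hF.aestronglyMeasurable, integral_prod _ hi]

end merge

section
variable {N : ℕ}

/-- The pair `p` involves the site `i`. -/
abbrev onRow (i : Fin N) (p : Pairs N) : Prop := p.1.1 = i ∨ p.1.2 = i

lemma sum_onRow (i : Fin N) (F : Pairs N → ℝ) :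
    ∑ p, (if onRow i p then F p else 0) = ∑ j ∈ Finset.univ.erase i, gval F i j := by
  rw [← Finset.sum_filter]
  refine Finset.sum_bij (fun p _ => if p.1.1 = i then p.1.2 else p.1.1) ?_ ?_ ?_ ?_
  · rintro ⟨⟨a, b⟩, hab⟩ hp
    simp only [Finset.mem_filter, Finset.mem_univ, true_and, onRow] at hp hab
    simp only [Finset.mem_erase, Finset.mem_univ, and_true]
    split_ifs with h
    · subst h; exact hab.ne'
    · exact h
  · rintro ⟨⟨a, b⟩, hab⟩ hp ⟨⟨a', b'⟩, hab'⟩ hp' heq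
    simp only [Finset.mem_filter, Finset.mem_univ, true_and, onRow] at hp hp' hab hab' heq
    simp only [Subtype.mk.injEq, Prod.mk.injEq]
    split_ifs at heq <;> grind
  · intro j hj
    have hj : j ≠ i := by simpa using hj
    rcases lt_or_gt_of_ne hj with h | h
    · exact ⟨⟨(j, i), h⟩, by simp [onRow], by simp [hj]⟩
    · exact ⟨⟨(i, j), h⟩, by simp [onRow], by simp⟩
  · rintro ⟨⟨a, b⟩, hab⟩ hp
    simp only [Finset.mem_filter, Finset.mem_univ, true_and, onRow] at hp hab
    by_cases h : a = i
    · subst h; simp [gval, hab]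
    · have h' : b = i := by tauto
      subst h'
      simp [gval, h, hab, hab.not_gt]

/-- Coefficients of the local field at `i` as a linear form in the disorder. -/
noncomputable def rowX (i : Fin N) (σ : Config N) (p : Pairs N) : ℝ :=
  if p.1.1 = i then spin (σ p.1.2) / √N else if p.1.2 = i then spin (σ p.1.1) / √N else 0

lemma rowX_of_not_onRow {i : Fin N} {p : Pairs N} (hp : ¬ onRow i p) (σ : Config N) :
    rowX i σ p = 0 := by
  simp only [onRow, not_or] at hp
  simp [rowX, hp.1, hp.2]

lemma spin_mul_self (b : Bool) : spin b * spin b = 1 := by cases b <;> simp [spin]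

lemma abs_spin (b : Bool) : |spin b| = 1 := by cases b <;> simp [spin]

lemma sum_rowX_mul (i : Fin N) (σ : Config N) (F : Pairs N → ℝ) :
    ∑ p, rowX i σ p * F p = ∑ j ∈ Finset.univ.erase i, spin (σ j) / √N * gval F i j := by
  have h1 : ∀ p, rowX i σ p * F p = if onRow i p then rowX i σ p * F p else 0 := by
    intro p
    split_ifs with h
    · rfl
    · rw [rowX_of_not_onRow h, zero_mul]
  rw [Finset.sum_congr rfl fun p _ => h1 p, sum_onRow i fun p => rowX i σ p * F p]
  refine Finset.sum_congr rfl fun j hj => ?_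
  have hj : j ≠ i := by simpa using hj
  unfold gval
  rcases lt_or_gt_of_ne hj with h | h
  · simp [h, h.not_gt, rowX, h.ne]
  · simp [h, rowX]

lemma sum_rowX_mul_disorder (i : Fin N) (σ : Config N) (G : Disorder N) :
    ∑ p, rowX i σ p * G p = locField G i σ := by
  rw [sum_rowX_mul, locField, Finset.mul_sum]
  exact Finset.sum_congr rfl fun _ _ => by ring

lemma sum_rowX_mul_rowX (i : Fin N) (σ τ : Config N) :
    ∑ p, rowX i σ p * rowX i τ p
      = 1 / N * ∑ j ∈ Finset.univ.erase i, spin (σ j) * spin (τ j) := by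
  rw [sum_rowX_mul, Finset.mul_sum]
  refine Finset.sum_congr rfl fun j hj => ?_
  have hj : j ≠ i := by simpa using hj
  have hN : √(N : ℝ) * √N = N := Real.mul_self_sqrt (Nat.cast_nonneg N)
  have : gval (rowX i τ) i j = spin (τ j) / √N := by
    unfold gval
    rcases lt_or_gt_of_ne hj with h | h
    · simp [h, h.not_gt, rowX, h.ne]
    · simp [h, rowX]
  rw [this, div_mul_div_comm, hN]; ring

lemma sum_rowX_mul_rowX_eq_overlap (i : Fin N) (σ τ : Config N) :
    ∑ p, rowX i σ p * rowX i τ p = overlap σ τ - spin (σ i) * spin (τ i) / N := by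
  rw [sum_rowX_mul_rowX, overlap, ← Finset.add_sum_erase _ _ (Finset.mem_univ i)]
  ring

lemma sum_rowX_sq (hN : N ≠ 0) (i : Fin N) (σ : Config N) :
    ∑ p, rowX i σ p ^ 2 = 1 - 1 / N := by
  have : (N : ℝ) ≠ 0 := by exact_mod_cast hN
  simp_rw [sq]
  rw [sum_rowX_mul_rowX_eq_overlap, overlap]
  simp [spin_mul_self, this]

/-- Flip the spin at site `i`. -/
def flip (i : Fin N) (σ : Config N) : Config N := Function.update σ i (!σ i)

lemma flip_flip (i : Fin N) (σ : Config N) : flip i (flip i σ) = σ := by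
  simp [flip]

lemma flip_apply_of_ne {i j : Fin N} (h : j ≠ i) (σ : Config N) : flip i σ j = σ j := by
  simp [flip, h]

lemma spin_flip (i : Fin N) (σ : Config N) : spin (flip i σ i) = -spin (σ i) := by
  simp only [flip, Function.update_self]
  cases σ i <;> simp [spin]

lemma rowX_flip (i : Fin N) (σ : Config N) : rowX i (flip i σ) = rowX i σ := by
  ext ⟨⟨a, b⟩, hab⟩
  simp only at hab
  simp only [rowX]
  by_cases ha : a = i
  · subst ha; simp [flip_apply_of_ne hab.ne']
  · by_cases hb : b = i
    · subst hb; simp [ha, flip_apply_of_ne ha]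
    · simp [ha, hb]

lemma locField_flip (G : Disorder N) (i : Fin N) (σ : Config N) :
    locField G i (flip i σ) = locField G i σ := by
  rw [← sum_rowX_mul_disorder, rowX_flip, sum_rowX_mul_disorder]

lemma sum_comp_flip (i : Fin N) (f : Config N → ℝ) : ∑ σ, f (flip i σ) = ∑ σ, f σ :=
  Equiv.sum_comp (Function.Involutive.toPerm (flip i) (flip_flip i)) f

/-- The part of the Hamiltonian not involving the site `i`. -/
noncomputable def cavH (β h : ℝ) (G : Disorder N) (i : Fin N) (σ : Config N) : ℝ :=
  β / √N * ∑ p : Pairs N, (if onRow i p then 0 else G p * spin (σ p.1.1) * spin (σ p.1.2))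
    + h * ∑ j ∈ Finset.univ.erase i, spin (σ j)

lemma ham_eq_cavH (β h : ℝ) (G : Disorder N) (i : Fin N) (σ : Config N) :
    ham β h G σ = cavH β h G i σ + spin (σ i) * (β * locField G i σ + h) := by
  have h1 : ∑ p : Pairs N, G p * spin (σ p.1.1) * spin (σ p.1.2)
      = ∑ p : Pairs N, (if onRow i p then 0 else G p * spin (σ p.1.1) * spin (σ p.1.2))
        + ∑ p : Pairs N, (if onRow i p then G p * spin (σ p.1.1) * spin (σ p.1.2) else 0) := by
    rw [← Finset.sum_add_distrib]
    exact Finset.sum_congr rfl fun p _ => by split_ifs <;> simp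
  have h2 : ∑ p : Pairs N, (if onRow i p then G p * spin (σ p.1.1) * spin (σ p.1.2) else 0)
      = spin (σ i) * ∑ j ∈ Finset.univ.erase i, gval G i j * spin (σ j) := by
    rw [sum_onRow i fun p => G p * spin (σ p.1.1) * spin (σ p.1.2), Finset.mul_sum]
    refine Finset.sum_congr rfl fun j hj => ?_
    have hj : j ≠ i := by simpa using hj
    unfold gval
    rcases lt_or_gt_of_ne hj with h | h
    · simp only [h, h.not_gt, dite_true, dite_false]; ring
    · simp only [h, dite_true]; ring
  rw [ham, cavH, locField, h1, h2, ← Finset.add_sum_erase _ _ (Finset.mem_univ i)]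
  ring

lemma cavH_flip (β h : ℝ) (G : Disorder N) (i : Fin N) (σ : Config N) :
    cavH β h G i (flip i σ) = cavH β h G i σ := by
  unfold cavH
  congr 2
  · refine Finset.sum_congr rfl fun p _ => ?_
    split_ifs with hp
    · rfl
    · simp only [onRow, not_or] at hp
      rw [flip_apply_of_ne hp.1, flip_apply_of_ne hp.2]
  · exact Finset.sum_congr rfl fun j hj => by
      rw [flip_apply_of_ne (by simpa using hj)]

lemma cavH_merge (β h : ℝ) (G G' : Disorder N) (i : Fin N) :
    cavH β h (merge (onRow i) (G, G')) i = cavH β h G i := by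
  ext σ
  unfold cavH
  congr 2
  refine Finset.sum_congr rfl fun p _ => ?_
  split_ifs with hp
  · rfl
  · rw [merge, if_neg hp]

lemma exp_spin_mul (b : Bool) (y : ℝ) : exp (spin b * y) = cosh y + spin b * sinh y := by
  cases b
  · simp [spin, ← sub_eq_add_neg]
  · simp [spin]

/-- The family of local fields at the site `i`, weighted by the Gibbs measure of the system with
that site removed. -/
noncomputable def cav (hN : N ≠ 0) (β h : ℝ) (i : Fin N) (G : Disorder N) :
    FieldFamily (Pairs N) (Config N) where
  w σ := exp (cavH β h G i σ) / ∑ τ, exp (cavH β h G i τ)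
  x := rowX i
  v := 1 - 1 / N
  w_nonneg σ := by positivity
  sum_w := by
    rw [← Finset.sum_div]
    exact div_self (Finset.sum_pos (fun _ _ => exp_pos _) Finset.univ_nonempty).ne'
  norm_x := sum_rowX_sq hN i
  v_le := by
    have : (0 : ℝ) ≤ 1 / N := by positivity
    linarith

end

section
variable {N : ℕ} (hN : N ≠ 0) (β h : ℝ) (i : Fin N) (G : Disorder N)

lemma cav_fld (G' : Disorder N) (σ : Config N) :
    (cav hN β h i G).fld σ G' = locField G' i σ :=
  sum_rowX_mul_disorder i σ G'

lemma cav_w_flip (σ : Config N) :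
    (cav hN β h i G).w (flip i σ) = (cav hN β h i G).w σ := by
  simp only [cav, cavH_flip]

lemma cav_w_merge (G' : Disorder N) :
    cav hN β h i (merge (onRow i) (G, G')) = cav hN β h i G := by
  simp only [cav, cavH_merge]

lemma cav_fld_merge (G' G₀ : Disorder N) (σ : Config N) :
    (cav hN β h i G₀).fld σ (merge (onRow i) (G, G')) = (cav hN β h i G₀).fld σ G' := by
  refine Finset.sum_congr rfl fun p _ => ?_
  by_cases hp : onRow i p
  · rw [merge, if_pos hp]
  · simp only [cav, rowX_of_not_onRow hp, zero_mul]

lemma cav_avg_merge (f : ℝ → ℝ) (G' G₀ : Disorder N) :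
    (cav hN β h i G₀).avg f (merge (onRow i) (G, G')) = (cav hN β h i G₀).avg f G' := by
  simp only [FieldFamily.avg, cav_fld_merge]

lemma cav_gap_merge (s : ℝ) (u : ℝ → ℝ) (G' G₀ : Disorder N) :
    (cav hN β h i G₀).gap β h s u (merge (onRow i) (G, G')) = (cav hN β h i G₀).gap β h s u G' := by
  simp only [FieldFamily.gap, FieldFamily.field, cav_avg_merge]

/-- The effective tilting factor of the site `i`. -/
noncomputable def cavZ : ℝ := (cav hN β h i G).avg (fun x => cosh (β * x + h)) G

lemma one_le_cavZ : 1 ≤ cavZ hN β h i G := (cav hN β h i G).one_le_avg_cosh β h G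

lemma sum_spin_mul_eq_zero {φ : Config N → ℝ} (hφ : ∀ σ, φ (flip i σ) = φ σ) :
    ∑ σ, spin (σ i) * φ σ = 0 := by
  have := sum_comp_flip i fun σ => spin (σ i) * φ σ
  simp only [spin_flip, hφ, neg_mul, Finset.sum_neg_distrib] at this
  linarith

lemma sum_mul_exp_spin {φ a : Config N → ℝ} (hφ : ∀ σ, φ (flip i σ) = φ σ)
    (ha : ∀ σ, a (flip i σ) = a σ) :
    ∑ σ, φ σ * exp (spin (σ i) * a σ) = ∑ σ, φ σ * cosh (a σ) := by
  have := sum_spin_mul_eq_zero (φ := fun σ => φ σ * sinh (a σ)) i fun σ => by rw [hφ, ha]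
  simp_rw [exp_spin_mul, mul_add, Finset.sum_add_distrib]
  rw [add_eq_left, ← this]
  exact Finset.sum_congr rfl fun _ _ => by ring

lemma sum_mul_spin_mul_exp_spin {φ a : Config N → ℝ} (hφ : ∀ σ, φ (flip i σ) = φ σ)
    (ha : ∀ σ, a (flip i σ) = a σ) :
    ∑ σ, φ σ * (spin (σ i) * exp (spin (σ i) * a σ)) = ∑ σ, φ σ * sinh (a σ) := by
  have := sum_spin_mul_eq_zero (φ := fun σ => φ σ * cosh (a σ)) i fun σ => by rw [hφ, ha]
  have e : ∀ σ : Config N, φ σ * (spin (σ i) * exp (spin (σ i) * a σ))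
      = spin (σ i) * (φ σ * cosh (a σ)) + φ σ * sinh (a σ) := fun σ => by
    rw [exp_spin_mul]
    linear_combination φ σ * sinh (a σ) * spin_mul_self (σ i)
  simp_rw [e, Finset.sum_add_distrib, this, zero_add]

lemma gibbs_eq_cav (σ : Config N) :
    gibbs β h G σ = (cav hN β h i G).w σ * exp (spin (σ i) * (β * locField G i σ + h))
      / cavZ hN β h i G := by
  have h1 := sum_mul_exp_spin i (φ := fun σ => (cav hN β h i G).w σ)
    (a := fun σ => β * locField G i σ + h) (cav_w_flip hN β h i G)
    (fun σ => by rw [locField_flip])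
  have h2 : cavZ hN β h i G
      = ∑ σ, (cav hN β h i G).w σ * exp (spin (σ i) * (β * locField G i σ + h)) := by
    rw [h1, cavZ, FieldFamily.avg]
    simp_rw [cav_fld]
  have hW : 0 < ∑ τ, exp (cavH β h G i τ) :=
    Finset.sum_pos (fun _ _ => exp_pos _) Finset.univ_nonempty
  rw [h2, gibbs, Zpart]
  simp only [cav]
  simp_rw [ham_eq_cavH β h G i, exp_add, div_mul_eq_mul_div]
  rw [← Finset.sum_div, div_div_div_cancel_right₀ hW.ne']

lemma sum_gibbs_mul {f : Config N → ℝ} (hf : ∀ σ, f (flip i σ) = f σ) :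
    ∑ σ, f σ * gibbs β h G σ
      = (∑ σ, (cav hN β h i G).w σ * (f σ * cosh (β * locField G i σ + h))) / cavZ hN β h i G := by
  have h1 := sum_mul_exp_spin i (φ := fun σ => f σ * (cav hN β h i G).w σ)
    (a := fun σ => β * locField G i σ + h) (fun σ => by rw [cav_w_flip, hf])
    (fun σ => by rw [locField_flip])
  simp_rw [gibbs_eq_cav hN β h i G, ← mul_div_assoc, ← Finset.sum_div, ← mul_assoc]
  rw [h1]
  congr 1
  exact Finset.sum_congr rfl fun _ _ => by ring

lemma qavg_locField (u : ℝ → ℝ) :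
    qavg β h G (fun σ => u (locField G i σ))
      = (cav hN β h i G).avg (fun x => u x * cosh (β * x + h)) G
        / (cav hN β h i G).avg (fun x => cosh (β * x + h)) G := by
  rw [qavg, sum_gibbs_mul hN β h i G (f := fun σ => u (locField G i σ))
    (fun σ => by rw [locField_flip]), cavZ]
  congr 1
  simp_rw [FieldFamily.avg, cav_fld]

lemma mavg_eq_cav : mavg β h G i = (cav hN β h i G).avg (fun x => sinh (β * x + h)) G
    / (cav hN β h i G).avg (fun x => cosh (β * x + h)) G := by
  have h1 := sum_mul_spin_mul_exp_spin i (φ := fun σ => (cav hN β h i G).w σ)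
    (a := fun σ => β * locField G i σ + h) (cav_w_flip hN β h i G)
    (fun σ => by rw [locField_flip])
  rw [mavg, qavg]
  simp_rw [gibbs_eq_cav hN β h i G, ← mul_div_assoc, ← Finset.sum_div]
  rw [cavZ]
  congr 1
  rw [FieldFamily.avg]
  simp_rw [cav_fld]
  rw [← h1]
  exact Finset.sum_congr rfl fun _ _ => by ring

lemma rfield_eq_cav (q : ℝ) :
    rfield β h q G i = (cav hN β h i G).field β h (1 - q) G := by
  have h1 : 1 / √(N : ℝ) * ∑ j ∈ Finset.univ.erase i, gval G i j * mavg β h G j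
      = qavg β h G (fun σ => locField G i σ) := by
    simp only [mavg, qavg, locField, Finset.mul_sum, Finset.sum_mul]
    rw [Finset.sum_comm]
    exact Finset.sum_congr rfl fun _ _ => Finset.sum_congr rfl fun _ _ => by ring
  rw [rfield, h1, qavg_locField hN β h i G fun x => x, mavg_eq_cav hN, FieldFamily.field]
  ring

lemma gap_cav (q : ℝ) (u : ℝ → ℝ) :
    (cav hN β h i G).gap β h (1 - q) u G
      = qavg β h G (fun σ => u (locField G i σ)) - mixE β h u (rfield β h q G i) (1 - q) := by
  rw [FieldFamily.gap, qavg_locField hN, rfield_eq_cav hN]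

lemma cav_R (σ τ : Config N) :
    (cav hN β h i G).R σ τ = overlap σ τ - spin (σ i) * spin (τ i) / N :=
  sum_rowX_mul_rowX_eq_overlap i σ τ

lemma inv_sq_cavZ_mul_dev_le (q : ℝ) :
    (cavZ hN β h i G ^ 2)⁻¹ * (cav hN β h i G).dev q
      ≤ qavg2 β h G fun σ τ => |overlap σ τ - spin (σ i) * spin (τ i) / N - q| := by
  have hR : ∀ σ τ, |(cav hN β h i G).R (flip i σ) τ - q| = |(cav hN β h i G).R σ τ - q| := by
    intro σ τ; simp only [FieldFamily.R, cav, rowX_flip]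
  have hR' : ∀ σ τ, |(cav hN β h i G).R σ (flip i τ) - q| = |(cav hN β h i G).R σ τ - q| := by
    intro σ τ; simp only [FieldFamily.R, cav, rowX_flip]
  have e : (qavg2 β h G fun σ τ => |overlap σ τ - spin (σ i) * spin (τ i) / N - q|)
      = (∑ σ, (cav hN β h i G).w σ * ((∑ τ, (cav hN β h i G).w τ *
          (|(cav hN β h i G).R σ τ - q| * cosh (β * locField G i τ + h))) / cavZ hN β h i G
            * cosh (β * locField G i σ + h))) / cavZ hN β h i G := by
    rw [qavg2, ← sum_gibbs_mul hN β h i G]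
    · refine Finset.sum_congr rfl fun σ _ => ?_
      rw [← sum_gibbs_mul hN β h i G (hR' σ), Finset.sum_mul]
      refine Finset.sum_congr rfl fun τ _ => ?_
      rw [cav_R]; ring
    · intro σ; simp only [hR]
  have hZ := one_le_cavZ hN β h i G
  rw [e, FieldFamily.dev_eq, sq, mul_inv, mul_assoc, mul_comm, div_eq_mul_inv]
  refine mul_le_mul_of_nonneg_right ?_ (by positivity)
  rw [mul_comm, Finset.sum_mul]
  refine Finset.sum_le_sum fun σ _ => ?_
  rw [mul_assoc]
  refine mul_le_mul_of_nonneg_left ?_ ((cav hN β h i G).w_nonneg σ)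
  rw [← div_eq_mul_inv]
  have h2 : ∑ τ, (cav hN β h i G).w τ * |(cav hN β h i G).R σ τ - q|
      ≤ ∑ τ, (cav hN β h i G).w τ *
          (|(cav hN β h i G).R σ τ - q| * cosh (β * locField G i τ + h)) :=
    Finset.sum_le_sum fun τ _ => mul_le_mul_of_nonneg_left
      (le_mul_of_one_le_right (abs_nonneg _) (one_le_cosh _)) ((cav hN β h i G).w_nonneg τ)
  have h3 : 0 ≤ ∑ τ, (cav hN β h i G).w τ * |(cav hN β h i G).R σ τ - q| :=
    Finset.sum_nonneg fun τ _ => mul_nonneg ((cav hN β h i G).w_nonneg τ) (abs_nonneg _)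
  calc _ ≤ (∑ τ, (cav hN β h i G).w τ *
          (|(cav hN β h i G).R σ τ - q| * cosh (β * locField G i τ + h))) / cavZ hN β h i G := by
        gcongr
    _ ≤ _ := le_mul_of_one_le_right (div_nonneg (h3.trans h2) (by linarith)) (one_le_cosh _)

lemma inv_sq_cavZ_le : (cavZ hN β h i G ^ 2)⁻¹ ≤ 1 - mavg β h G i ^ 2 := by
  rw [mavg_eq_cav hN]
  exact (cav hN β h i G).inv_sq_avg_cosh_le β h G

end

section
variable {N : ℕ}

instance : IsProbabilityMeasure (μdis N) := inferInstanceAs (IsProbabilityMeasure (stdPi (Pairs N)))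

lemma measurable_ham (β h : ℝ) (σ : Config N) : Measurable fun G => ham β h G σ := by
  unfold ham
  have : Measurable fun G : Disorder N => ∑ p : Pairs N, G p * spin (σ p.1.1) * spin (σ p.1.2) :=
    Finset.measurable_fun_sum _ fun p _ => by fun_prop
  exact (this.const_mul _).add_const _

lemma measurable_gibbs (β h : ℝ) (σ : Config N) : Measurable fun G => gibbs β h G σ := by
  unfold gibbs Zpart
  exact (measurable_ham β h σ).exp.div
    (Finset.measurable_fun_sum _ fun τ _ => (measurable_ham β h τ).exp)

lemma gibbs_nonneg (β h : ℝ) (G : Disorder N) (σ : Config N) : 0 ≤ gibbs β h G σ := by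
  unfold gibbs Zpart; positivity

lemma sum_gibbs (β h : ℝ) (G : Disorder N) : ∑ σ, gibbs β h G σ = 1 := by
  unfold gibbs Zpart
  rw [← Finset.sum_div]
  exact div_self (Finset.sum_pos (fun _ _ => exp_pos _) Finset.univ_nonempty).ne'

lemma measurable_qavg2 (β h : ℝ) (f : Config N → Config N → ℝ) :
    Measurable fun G => qavg2 β h G f := by
  unfold qavg2
  exact Finset.measurable_fun_sum _ fun σ _ => Finset.measurable_fun_sum _ fun τ _ =>
    ((measurable_gibbs β h σ).const_mul _).mul (measurable_gibbs β h τ)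

lemma qavg2_mono (β h : ℝ) (G : Disorder N) {f g : Config N → Config N → ℝ}
    (hfg : ∀ σ τ, f σ τ ≤ g σ τ) : qavg2 β h G f ≤ qavg2 β h G g := by
  refine Finset.sum_le_sum fun σ _ => Finset.sum_le_sum fun τ _ => ?_
  exact mul_le_mul_of_nonneg_right (mul_le_mul_of_nonneg_right (hfg σ τ) (gibbs_nonneg _ _ _ _))
    (gibbs_nonneg _ _ _ _)

lemma qavg2_const (β h : ℝ) (G : Disorder N) (c : ℝ) : qavg2 β h G (fun _ _ => c) = c := by
  simp only [qavg2, ← Finset.mul_sum, sum_gibbs, mul_one]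

lemma qavg2_add (β h : ℝ) (G : Disorder N) (f g : Config N → Config N → ℝ) :
    qavg2 β h G (fun σ τ => f σ τ + g σ τ) = qavg2 β h G f + qavg2 β h G g := by
  simp only [qavg2, add_mul, Finset.sum_add_distrib]

lemma qavg2_const_mul (β h : ℝ) (G : Disorder N) (c : ℝ) (f : Config N → Config N → ℝ) :
    qavg2 β h G (fun σ τ => c * f σ τ) = c * qavg2 β h G f := by
  simp only [qavg2, Finset.mul_sum, mul_assoc]

lemma abs_qavg2_le (β h : ℝ) (G : Disorder N) {f : Config N → Config N → ℝ} {B : ℝ}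
    (hf : ∀ σ τ, |f σ τ| ≤ B) : |qavg2 β h G f| ≤ B := by
  have h1 := qavg2_mono β h G fun σ τ => (abs_le.1 (hf σ τ)).1
  have h2 := qavg2_mono β h G fun σ τ => (abs_le.1 (hf σ τ)).2
  rw [qavg2_const] at h1 h2
  exact abs_le.2 ⟨h1, h2⟩

lemma integrable_qavg2 (β h : ℝ) (f : Config N → Config N → ℝ) :
    Integrable (fun G => qavg2 β h G f) (μdis N) := by
  refine Integrable.of_bound (C := ∑ σ, ∑ τ, |f σ τ|) (measurable_qavg2 β h f).aestronglyMeasurable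
    (.of_forall fun G => abs_qavg2_le β h G fun σ τ => ?_)
  refine (Finset.single_le_sum (f := fun τ => |f σ τ|) (fun _ _ => abs_nonneg _)
    (Finset.mem_univ τ)).trans ?_
  exact Finset.single_le_sum (f := fun σ => ∑ τ, |f σ τ|)
    (fun _ _ => Finset.sum_nonneg fun _ _ => abs_nonneg _) (Finset.mem_univ σ)

lemma abs_le_add_pow_four {x l : ℝ} (hl : 0 < l) : |x| ≤ l + x ^ 4 / l ^ 3 := by
  have hx : x ^ 4 = |x| ^ 4 := by rw [Even.pow_abs (by decide)]
  rw [hx]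
  have h0 := abs_nonneg x
  generalize |x| = y at *
  rcases le_total y l with h | h
  · have : 0 ≤ y ^ 4 / l ^ 3 := by positivity
    linarith
  · have : y ≤ y ^ 4 / l ^ 3 := by
      rw [le_div_iff₀ (by positivity), pow_succ y 3, mul_comm]
      gcongr
    linarith

lemma integral_abs_overlap_sub_le (hN : N ≠ 0) {β h q K : ℝ} (hT : highTemp N β h q K) :
    ∫ G, qavg2 β h G (fun σ τ => |overlap σ τ - q|) ∂(μdis N) ≤ (1 + K) / √N := by
  have hN0 : (0 : ℝ) < N := by exact_mod_cast Nat.pos_of_ne_zero hN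
  have hs : 0 < √(N : ℝ) := Real.sqrt_pos.2 hN0
  have hss : √(N : ℝ) ^ 2 = N := Real.sq_sqrt hN0.le
  have hpt : ∀ G : Disorder N, qavg2 β h G (fun σ τ => |overlap σ τ - q|)
      ≤ 1 / √N + √N ^ 3 * qavg2 β h G (fun σ τ => (overlap σ τ - q) ^ 4) := by
    intro G
    have := qavg2_mono β h G (f := fun σ τ => |overlap σ τ - q|)
      (g := fun σ τ => 1 / √N + √N ^ 3 * (overlap σ τ - q) ^ 4) fun σ τ => by
        have := abs_le_add_pow_four (x := overlap σ τ - q) (one_div_pos.2 hs)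
        rwa [div_pow, one_pow, div_div_eq_mul_div, div_one, mul_comm (_ ^ 4)] at this
    rwa [qavg2_add, qavg2_const, qavg2_const_mul] at this
  have hi := (integrable_qavg2 β h fun σ τ : Config N => (overlap σ τ - q) ^ 4).const_mul (√N ^ 3)
  refine (integral_mono (integrable_qavg2 _ _ _) ((integrable_const _).add hi) hpt).trans ?_
  simp only [Pi.add_apply]
  rw [integral_add (integrable_const _) hi, integral_const_mul]
  simp only [integral_const, probReal_univ, one_smul]
  have h1 := mul_le_mul_of_nonneg_left hT (by positivity : 0 ≤ √(N : ℝ) ^ 3)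
  have h2 : √(N : ℝ) ^ 3 * (K / (N : ℝ) ^ 2) = K / √N := by
    nth_rewrite 2 [← hss]
    field_simp
  rw [add_div]
  linarith

lemma measurable_cavH (β h : ℝ) (i : Fin N) (σ : Config N) :
    Measurable fun G => cavH β h G i σ := by
  unfold cavH
  have : Measurable fun G : Disorder N => ∑ p : Pairs N,
      (if onRow i p then 0 else G p * spin (σ p.1.1) * spin (σ p.1.2)) :=
    Finset.measurable_fun_sum _ fun p _ => by split_ifs <;> fun_prop
  exact (this.const_mul _).add_const _

lemma measurable_cav_w (hN : N ≠ 0) (β h : ℝ) (i : Fin N) (σ : Config N) :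
    Measurable fun G => (cav hN β h i G).w σ :=
  (measurable_cavH β h i σ).exp.div
    (Finset.measurable_fun_sum _ fun τ _ => (measurable_cavH β h i τ).exp)

lemma measurable_locField (i : Fin N) (σ : Config N) :
    Measurable fun G => locField G i σ := by
  simp_rw [← sum_rowX_mul_disorder]
  exact Finset.measurable_fun_sum _ fun p _ => by fun_prop

lemma measurable_cav_avg (hN : N ≠ 0) (β h : ℝ) (i : Fin N) {f : ℝ → ℝ} (hf : Measurable f) :
    Measurable fun G => (cav hN β h i G).avg f G := by
  simp_rw [FieldFamily.avg, cav_fld]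
  exact Finset.measurable_fun_sum _ fun σ _ =>
    (measurable_cav_w hN β h i σ).mul (hf.comp (measurable_locField i σ))

lemma measurable_cavZ (hN : N ≠ 0) (β h : ℝ) (i : Fin N) : Measurable (cavZ hN β h i) :=
  measurable_cav_avg hN β h i (by fun_prop)

lemma measurable_cav_dev (hN : N ≠ 0) (β h q : ℝ) (i : Fin N) :
    Measurable fun G => (cav hN β h i G).dev q := by
  simp_rw [FieldFamily.dev, cav_R]
  exact Finset.measurable_fun_sum _ fun σ _ => Finset.measurable_fun_sum _ fun τ _ =>
    ((measurable_cav_w hN β h i σ).mul (measurable_cav_w hN β h i τ)).mul_const _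

lemma FieldFamily.dev_le_two {ι S : Type*} [Fintype ι] [Fintype S] (D : FieldFamily ι S) {q : ℝ}
    (hq : 0 ≤ q) (hq1 : q ≤ 1) : D.dev q ≤ 2 := by
  rw [D.dev_eq, ← D.sum_w_mul_const 2]
  refine Finset.sum_le_sum fun σ _ => mul_le_mul_of_nonneg_left ?_ (D.w_nonneg σ)
  rw [← D.sum_w_mul_const 2]
  refine Finset.sum_le_sum fun τ _ => mul_le_mul_of_nonneg_left ?_ (D.w_nonneg τ)
  have h1 := abs_le.1 (D.abs_R_le σ τ)
  have h2 := D.v_le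
  rw [abs_le]; constructor <;> linarith

lemma inv_sq_cavZ_nonneg (hN : N ≠ 0) (β h : ℝ) (i : Fin N) (G : Disorder N) :
    0 ≤ (cavZ hN β h i G ^ 2)⁻¹ := by positivity

lemma inv_sq_cavZ_le_one (hN : N ≠ 0) (β h : ℝ) (i : Fin N) (G : Disorder N) :
    (cavZ hN β h i G ^ 2)⁻¹ ≤ 1 :=
  inv_le_one_of_one_le₀ (one_le_pow₀ (one_le_cavZ hN β h i G))

lemma cavZ_merge (hN : N ≠ 0) (β h : ℝ) (i : Fin N) (G G' : Disorder N) :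
    cavZ hN β h i (merge (onRow i) (G, G')) = (cav hN β h i G).avg (fun x => cosh (β * x + h)) G' := by
  rw [cavZ, cav_w_merge, cav_avg_merge]

lemma integral_dev_cav_le (hN : N ≠ 0) (β h : ℝ) (i : Fin N) {q : ℝ} (hq : 0 ≤ q) (hq1 : q ≤ 1) :
    ∫ G, (cav hN β h i G).dev q ∂(μdis N) ≤ cavC β h *
      ∫ G, qavg2 β h G (fun σ τ => |overlap σ τ - spin (σ i) * spin (τ i) / N - q|) ∂(μdis N) := by
  have hA : 0 < cavC β h := by linarith [one_le_cavC β h]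
  have hd0 := fun G => (cav hN β h i G).dev_nonneg q
  have hd2 := fun G => (cav hN β h i G).dev_le_two hq hq1
  have hm : Measurable fun G => (cavZ hN β h i G ^ 2)⁻¹ * (cav hN β h i G).dev q :=
    ((measurable_cavZ hN β h i).pow_const 2).inv.mul (measurable_cav_dev hN β h q i)
  have hB : ∀ G, |(cavZ hN β h i G ^ 2)⁻¹ * (cav hN β h i G).dev q| ≤ 2 := by
    intro G
    rw [abs_of_nonneg (mul_nonneg (inv_sq_cavZ_nonneg _ _ _ _ _) (hd0 G))]
    exact (mul_le_of_le_one_left (hd0 G) (inv_sq_cavZ_le_one _ _ _ _ _)).trans (hd2 G)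
  obtain ⟨hi, he⟩ := integral_stdPi_eq_merge (onRow i) hm hB
  have hid : Integrable (fun G => (cavC β h)⁻¹ * (cav hN β h i G).dev q) (μdis N) :=
    (Integrable.of_bound (C := 2) (measurable_cav_dev hN β h q i).aestronglyMeasurable
      (.of_forall fun G => by rw [Real.norm_eq_abs, abs_of_nonneg (hd0 G)]; exact hd2 G)).const_mul _
  have h1 : (cavC β h)⁻¹ * ∫ G, (cav hN β h i G).dev q ∂(μdis N)
      ≤ ∫ G, (cavZ hN β h i G ^ 2)⁻¹ * (cav hN β h i G).dev q ∂(μdis N) := by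
    rw [← integral_const_mul]
    refine le_of_le_of_eq (integral_mono hid hi fun G => ?_) he.symm
    simp only [cavZ_merge, cav_w_merge, integral_mul_const]
    exact mul_le_mul_of_nonneg_right ((cav hN β h i G).inv_cavC_le_integral β h) (hd0 G)
  have h2 : ∫ G, (cavZ hN β h i G ^ 2)⁻¹ * (cav hN β h i G).dev q ∂(μdis N) ≤
      ∫ G, qavg2 β h G (fun σ τ => |overlap σ τ - spin (σ i) * spin (τ i) / N - q|) ∂(μdis N) :=
    integral_mono (Integrable.of_bound (C := 2) hm.aestronglyMeasurable (.of_forall hB))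
      (integrable_qavg2 _ _ _) fun G => inv_sq_cavZ_mul_dev_le hN β h i G q
  have h3 := mul_le_mul_of_nonneg_left (h1.trans h2) hA.le
  rwa [mul_inv_cancel_left₀ hA.ne'] at h3

lemma integral_dev_cav_le_of_highTemp (hN : N ≠ 0) {β h q K : ℝ} (i : Fin N) (hq : 0 ≤ q)
    (hq1 : q ≤ 1) (hT : highTemp N β h q K) :
    ∫ G, (cav hN β h i G).dev q ∂(μdis N) ≤ cavC β h * (2 + K) / √N := by
  have hN1 : (1 : ℝ) ≤ N := by exact_mod_cast Nat.one_le_iff_ne_zero.2 hN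
  have hs : 1 ≤ √(N : ℝ) := Real.one_le_sqrt.2 hN1
  have hss : √(N : ℝ) ^ 2 = N := Real.sq_sqrt (by linarith)
  have hA := one_le_cavC β h
  have hNs : 1 / (N : ℝ) ≤ 1 / √N := one_div_le_one_div_of_le (by linarith) (by nlinarith)
  have hpt : ∀ G : Disorder N,
      qavg2 β h G (fun σ τ => |overlap σ τ - spin (σ i) * spin (τ i) / N - q|)
        ≤ qavg2 β h G (fun σ τ => |overlap σ τ - q|) + 1 / √N := by
    intro G
    rw [← qavg2_const β h G (1 / √N), ← qavg2_add]
    refine qavg2_mono β h G fun σ τ => ?_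
    rw [show overlap σ τ - spin (σ i) * spin (τ i) / N - q
      = (overlap σ τ - q) - spin (σ i) * spin (τ i) / N by ring]
    refine (abs_sub _ _).trans ?_
    rw [abs_div, abs_mul, abs_spin, abs_spin, mul_one, abs_of_nonneg (by linarith : (0 : ℝ) ≤ N)]
    linarith
  refine (integral_dev_cav_le hN β h i hq hq1).trans ?_
  rw [mul_div_assoc]
  refine mul_le_mul_of_nonneg_left ?_ (by linarith)
  refine (integral_mono (integrable_qavg2 _ _ _)
    ((integrable_qavg2 _ _ _).add (integrable_const _)) hpt).trans ?_
  simp only [Pi.add_apply]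
  rw [integral_add (integrable_qavg2 _ _ _) (integrable_const _)]
  simp only [integral_const, probReal_univ, one_smul]
  have := integral_abs_overlap_sub_le hN hT
  have e : (2 + K) / √(N : ℝ) = (1 + K) / √N + 1 / √N := by ring
  linarith

lemma inv_cavC_le_integral_inv_sq_cavZ (hN : N ≠ 0) (β h : ℝ) (i : Fin N) :
    (cavC β h)⁻¹ ≤ ∫ G, (cavZ hN β h i G ^ 2)⁻¹ ∂(μdis N) := by
  obtain ⟨hi, he⟩ := integral_stdPi_eq_merge (onRow i) (F := fun G => (cavZ hN β h i G ^ 2)⁻¹)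
    ((measurable_cavZ hN β h i).pow_const 2).inv (B := 1) fun G => by
      rw [abs_of_nonneg (inv_sq_cavZ_nonneg _ _ _ _ _)]
      exact inv_sq_cavZ_le_one _ _ _ _ _
  refine le_of_le_of_eq ?_ he.symm
  have := integral_mono (integrable_const (cavC β h)⁻¹) hi fun G => by
    simp only [cavZ_merge]
    exact (cav hN β h i G).inv_cavC_le_integral β h
  simpa using this

lemma qavg2_overlap (β h : ℝ) (G : Disorder N) :
    qavg2 β h G overlap = 1 / N * ∑ j, mavg β h G j ^ 2 := by
  simp only [qavg2, overlap, mavg, qavg, sq, Finset.sum_mul_sum]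
  simp_rw [Finset.mul_sum, Finset.sum_mul]
  rw [Finset.sum_congr rfl fun σ _ => Finset.sum_comm, Finset.sum_comm]
  exact Finset.sum_congr rfl fun _ _ => Finset.sum_congr rfl fun _ _ =>
    Finset.sum_congr rfl fun _ _ => by ring

lemma measurable_mavg (β h : ℝ) (i : Fin N) : Measurable fun G => mavg β h G i := by
  unfold mavg qavg
  exact Finset.measurable_fun_sum _ fun σ _ => (measurable_gibbs β h σ).const_mul _

lemma integral_overlap_le (hN : N ≠ 0) (β h : ℝ) :
    ∫ G : Disorder N, qavg2 β h G overlap ∂(μdis N) ≤ 1 - (cavC β h)⁻¹ := by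
  have hN0 : (N : ℝ) ≠ 0 := by exact_mod_cast hN
  have hm1 : ∀ i (G : Disorder N), mavg β h G i ^ 2 ≤ 1 := fun i G => by
    linarith [inv_sq_cavZ_le hN β h i G, inv_sq_cavZ_nonneg hN β h i G]
  have hmi : ∀ i : Fin N, Integrable (fun G => mavg β h G i ^ 2) (μdis N) := fun i =>
    Integrable.of_bound (C := 1) ((measurable_mavg β h i).pow_const 2).aestronglyMeasurable
      (.of_forall fun G => by rw [Real.norm_eq_abs, abs_of_nonneg (sq_nonneg _)]; exact hm1 i G)
  have hz : ∀ i : Fin N, Integrable (fun G => (cavZ hN β h i G ^ 2)⁻¹) (μdis N) := fun i =>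
    Integrable.of_bound (C := 1) ((measurable_cavZ hN β h i).pow_const 2).inv.aestronglyMeasurable
      (.of_forall fun G => by
        rw [Real.norm_eq_abs, abs_of_nonneg (inv_sq_cavZ_nonneg _ _ _ _ _)]
        exact inv_sq_cavZ_le_one _ _ _ _ _)
  have hb : ∀ i : Fin N, ∫ G, mavg β h G i ^ 2 ∂(μdis N) ≤ 1 - (cavC β h)⁻¹ := by
    intro i
    have h1 := integral_mono (hz i) ((integrable_const 1).sub (hmi i)) fun G =>
      inv_sq_cavZ_le hN β h i G
    simp only [Pi.sub_apply] at h1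
    rw [integral_sub (integrable_const _) (hmi i)] at h1
    simp only [integral_const, probReal_univ, one_smul] at h1
    linarith [inv_cavC_le_integral_inv_sq_cavZ hN β h i]
  simp_rw [qavg2_overlap]
  rw [integral_const_mul, integral_finsetSum _ fun i _ => hmi i]
  calc _ ≤ 1 / (N : ℝ) * ∑ _i : Fin N, (1 - (cavC β h)⁻¹) := by gcongr; exact hb _
    _ = _ := by
      rw [Finset.sum_const, Finset.card_univ, Fintype.card_fin, nsmul_eq_mul]
      field_simp

lemma le_of_highTemp (hN : N ≠ 0) {β h q K : ℝ} (hT : highTemp N β h q K) :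
    q ≤ 1 - (cavC β h)⁻¹ + (1 + K) / √N := by
  have hpt : ∀ G : Disorder N, q ≤ qavg2 β h G overlap
      + qavg2 β h G (fun σ τ => |overlap σ τ - q|) := by
    intro G
    rw [← qavg2_add]
    nth_rewrite 1 [← qavg2_const β h G q]
    exact qavg2_mono β h G fun σ τ => by linarith [neg_abs_le (overlap σ τ - q)]
  have := integral_mono (integrable_const q)
    ((integrable_qavg2 β h _).add (integrable_qavg2 β h _)) hpt
  simp only [Pi.add_apply] at this
  rw [integral_add (integrable_qavg2 _ _ _) (integrable_qavg2 _ _ _)] at this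
  simp only [integral_const, probReal_univ, one_smul] at this
  linarith [integral_overlap_le hN β h, integral_abs_overlap_sub_le hN hT]

end

section
variable {N : ℕ}

lemma gaussDens_eq {s : ℝ} (hs : 0 < s) (m x : ℝ) :
    gaussDens m s x = gaussianPDFReal m s.toNNReal x := by
  rw [gaussDens, gaussianPDFReal, Real.coe_toNNReal _ hs.le, ← Real.sqrt_mul (by positivity : (0 : ℝ) ≤ 2 * π), one_div]

lemma integral_mul_gaussDens {u : ℝ → ℝ} (hu : Measurable u) {M : ℝ} (hM : ∀ x, |u x| ≤ M) {s : ℝ}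
    (hs : 0 < s) (m : ℝ) :
    Integrable (fun x => u x * gaussDens m s x) ∧
      ∫ x, u x * gaussDens m s x = ∫ x, u x ∂(gaussianReal m s.toNNReal) := by
  have hs' : s.toNNReal ≠ 0 := (Real.toNNReal_pos.2 hs).ne'
  simp_rw [gaussDens_eq hs]
  refine ⟨(integrable_gaussianPDFReal _ _).bdd_mul hu.aestronglyMeasurable (.of_forall hM), ?_⟩
  rw [integral_gaussianReal_eq_integral_smul hs']
  simp_rw [smul_eq_mul, mul_comm]

lemma integral_mul_mixture_eq_mixE {u : ℝ → ℝ} (hu : Measurable u) {M : ℝ} (hM : ∀ x, |u x| ≤ M)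
    (β h r : ℝ) {s : ℝ} (hs : 0 < s) :
    ∫ x, u x * (exp (β * r + h) / (exp (β * r + h) + exp (-(β * r) - h))
        * gaussDens (r + β * s) s x
      + (1 - exp (β * r + h) / (exp (β * r + h) + exp (-(β * r) - h)))
        * gaussDens (r - β * s) s x) = mixE β h u r s := by
  have hp : exp (β * r + h) / (exp (β * r + h) + exp (-(β * r) - h)) = logis (β * r + h) := by
    rw [logis, neg_add']
  obtain ⟨i1, e1⟩ := integral_mul_gaussDens hu hM hs (r + β * s)
  obtain ⟨i2, e2⟩ := integral_mul_gaussDens hu hM hs (r - β * s)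
  rw [hp, mixE, ← e1, ← e2, ← integral_const_mul, ← integral_const_mul,
    ← integral_add (i1.const_mul _) (i2.const_mul _)]
  congr 1; ext x; ring

lemma measurable_integral_gaussianReal {u : ℝ → ℝ} (hu : Measurable u) (v : NNReal) :
    Measurable fun m => ∫ x, u x ∂(gaussianReal m v) := by
  have e : ∀ m, ∫ x, u x ∂(gaussianReal m v) = ∫ x, u (m + x) ∂(gaussianReal 0 v) := by
    intro m
    have := gaussianReal_map_const_add (μ := 0) (v := v) m
    rw [zero_add] at this
    rw [← this, integral_map (by fun_prop) hu.aestronglyMeasurable]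
  simp_rw [e]
  have : StronglyMeasurable (Function.uncurry fun m x : ℝ => u (m + x)) :=
    (hu.comp (measurable_fst.add measurable_snd)).stronglyMeasurable
  exact this.integral_prod_right.measurable

lemma measurable_logis : Measurable logis := by unfold logis; fun_prop

lemma measurable_mixE {u : ℝ → ℝ} (hu : Measurable u) (β h s : ℝ) :
    Measurable fun r => mixE β h u r s := by
  unfold mixE
  have h1 : Measurable fun r => logis (β * r + h) := measurable_logis.comp (by fun_prop)
  exact (h1.mul ((measurable_integral_gaussianReal hu _).comp (measurable_id.add_const _))).add
    ((h1.const_sub 1).mul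
      ((measurable_integral_gaussianReal hu _).comp (measurable_id.sub_const _)))

lemma measurable_gap_cav (hN : N ≠ 0) (β h s : ℝ) (i : Fin N) {u : ℝ → ℝ} (hu : Measurable u) :
    Measurable fun G => (cav hN β h i G).gap β h s u G := by
  have hC : Measurable fun G => (cav hN β h i G).avg (fun x => cosh (β * x + h)) G :=
    measurable_cav_avg hN β h i (by fun_prop)
  have hF : Measurable fun G => (cav hN β h i G).field β h s G :=
    ((measurable_cav_avg hN β h i (by fun_prop)).sub
      ((measurable_cav_avg hN β h i (by fun_prop)).const_mul _)).div hC
  exact ((measurable_cav_avg hN β h i (by fun_prop)).div hC).sub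
    ((measurable_mixE hu β h s).comp hF)

lemma FieldFamily.sq_gap_le_const {ι S : Type*} [Fintype ι] [Fintype S] (D : FieldFamily ι S)
    {u : ℝ → ℝ} {M : ℝ} (hM : ∀ x, |u x| ≤ M) (β h s : ℝ) (g : ι → ℝ) :
    D.gap β h s u g ^ 2 ≤ 4 * M ^ 2 := by
  have h1 := abs_le.1 (D.abs_avg_div_le hM β h g)
  have h2 := abs_le.1 (abs_mixE_le hM β h (D.field β h s g) s)
  rw [FieldFamily.gap]
  nlinarith

lemma integral_sq_gap_cav_le (hN : N ≠ 0) {β h q K κ : ℝ} (i : Fin N) (hq : 0 ≤ q)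
    (hq1 : q ≤ 1) (hT : highTemp N β h q K) {u : ℝ → ℝ} (hu : Measurable u) {M : ℝ}
    (hM : ∀ x, |u x| ≤ M) (hκ : 0 < κ) (hκq : κ ≤ 1 - 1 / N - q) :
    ∫ G, (cav hN β h i G).gap β h (1 - q) u G ^ 2 ∂(μdis N)
      ≤ gapC β h κ * M ^ 2 * (cavC β h * (2 + K) / √N + 1 / N) := by
  have hc := gapC_pos β h hκ
  obtain ⟨hi, he⟩ := integral_stdPi_eq_merge (onRow i)
    (F := fun G => (cav hN β h i G).gap β h (1 - q) u G ^ 2) (B := 4 * M ^ 2)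
    ((measurable_gap_cav hN β h (1 - q) i hu).pow_const 2) fun G => by
      rw [abs_of_nonneg (sq_nonneg _)]
      exact FieldFamily.sq_gap_le_const _ hM _ _ _ _
  have hid : Integrable (fun G => (cav hN β h i G).dev q) (stdPi (Pairs N)) :=
    Integrable.of_bound (C := 2) (measurable_cav_dev hN β h q i).aestronglyMeasurable
      (.of_forall fun G => by
        rw [Real.norm_eq_abs, abs_of_nonneg ((cav hN β h i G).dev_nonneg q)]
        exact (cav hN β h i G).dev_le_two hq hq1)
  have hpt : ∀ G, ∫ G', (fun G => (cav hN β h i G).gap β h (1 - q) u G ^ 2)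
      (merge (onRow i) (G, G')) ∂(stdPi (Pairs N))
      ≤ gapC β h κ * M ^ 2 * ((cav hN β h i G).dev q + 1 / N) := by
    intro G
    simp only [cav_w_merge, cav_gap_merge]
    have := (cav hN β h i G).integral_sq_gap_le hu hM β h (s := 1 - q) hκ (by linarith)
      (by simpa only [cav, sub_sub_cancel] using hκq)
    rw [sub_sub_cancel] at this
    exact this.trans_eq (by simp [cav])
  refine he.trans_le ((integral_mono hi ((hid.add (integrable_const _)).const_mul _) hpt).trans ?_)
  simp only [Pi.add_apply]
  rw [integral_const_mul, integral_add hid (integrable_const _)]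
  simp only [integral_const, probReal_univ, one_smul]
  have : ∫ G, (cav hN β h i G).dev q ∂(stdPi (Pairs N)) ≤ cavC β h * (2 + K) / √N :=
    integral_dev_cav_le_of_highTemp hN i hq hq1 hT
  gcongr

end

/-- Theorem 1.1 (limit law for the local fields): quantitative mixture-Gaussian
approximation of the quenched law of the local field `ℓ_i`. -/
theorem local_field_limit_law (β h K : ℝ) (hβ : 0 < β) (hK : 0 < K) :
    ∃ C : ℝ, 0 < C ∧ ∀ (N : ℕ) (q : ℝ), 2 ≤ N → 0 ≤ q → q < 1 →
      highTemp N β h q K →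
      ∀ u : ℝ → ℝ, Measurable u → ∀ M : ℝ, (∀ x, |u x| ≤ M) →
      ∀ i : Fin N,
        ∫ G, (qavg β h G (fun σ => u (locField G i σ))
            - ∫ x, u x *
                ((Real.exp (β * rfield β h q G i + h) /
                    (Real.exp (β * rfield β h q G i + h)
                      + Real.exp (-(β * rfield β h q G i) - h)))
                    * gaussDens (rfield β h q G i + β * (1 - q)) (1 - q) x
                 + (1 - Real.exp (β * rfield β h q G i + h) /
                    (Real.exp (β * rfield β h q G i + h)
                      + Real.exp (-(β * rfield β h q G i) - h)))
                    * gaussDens (rfield β h q G i - β * (1 - q)) (1 - q) x)) ^ 2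
          ∂(μdis N)
        ≤ C * M ^ 2 / Real.sqrt N := by
  set A := cavC β h with hA'
  have hA : 1 ≤ A := one_le_cavC β h
  have hκ : 0 < 1 / (2 * A) := by positivity
  have hc := gapC_pos β h hκ
  set c := gapC β h (1 / (2 * A))
  refine ⟨c * (A * (2 + K) + 1) + 8 * A * (2 + K), by positivity, ?_⟩
  intro N q hN2 hq hq1 hT u hu M hM i
  have hN : N ≠ 0 := by omega
  have hN1 : (1 : ℝ) ≤ N := by exact_mod_cast Nat.one_le_iff_ne_zero.2 hN
  have hs : 1 ≤ √(N : ℝ) := Real.one_le_sqrt.2 hN1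
  have hss : √(N : ℝ) ^ 2 = N := Real.sq_sqrt (by linarith)
  have hNs : 1 / (N : ℝ) ≤ 1 / √N := one_div_le_one_div_of_le (by linarith) (by nlinarith)
  simp_rw [integral_mul_mixture_eq_mixE hu hM β h _ (sub_pos.2 hq1), ← gap_cav hN]
  have hq' := le_of_highTemp hN hT
  rw [← hA'] at hq'
  by_cases hlarge : (2 + K) / √N ≤ 1 / (2 * A)
  · have hκq : 1 / (2 * A) ≤ 1 - 1 / N - q := by
      have e1 : A⁻¹ = 1 / (2 * A) + 1 / (2 * A) := by field_simp; norm_num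
      have e2 : (2 + K) / √(N : ℝ) = (1 + K) / √N + 1 / √N := by ring
      linarith
    refine (integral_sq_gap_cav_le hN i hq hq1.le hT hu hM hκ hκq).trans ?_
    calc _ ≤ c * M ^ 2 * (A * (2 + K) / √N + 1 / √N) := by gcongr
      _ = c * (A * (2 + K) + 1) * M ^ 2 / √N := by ring
      _ ≤ _ := by
        gcongr
        have : 0 ≤ 8 * A * (2 + K) := by positivity
        linarith
  · have h1 : 1 ≤ 2 * A * (2 + K) / √N := by
      rw [not_le, div_lt_iff₀ (by positivity)] at hlarge
      calc (1 : ℝ) ≤ (2 + K) / √N * (2 * A) := hlarge.le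
        _ = _ := by ring
    have h2 : ∫ G, (cav hN β h i G).gap β h (1 - q) u G ^ 2 ∂(μdis N) ≤ 4 * M ^ 2 := by
      have := integral_mono_of_nonneg (μ := μdis N)
        (f := fun G => (cav hN β h i G).gap β h (1 - q) u G ^ 2)
        (.of_forall fun G => sq_nonneg _)
        (integrable_const (4 * M ^ 2)) (.of_forall fun G => FieldFamily.sq_gap_le_const _ hM _ _ _ _)
      simpa using this
    refine h2.trans ?_
    calc 4 * M ^ 2 ≤ 4 * M ^ 2 * (2 * A * (2 + K) / √N) := le_mul_of_one_le_right (by positivity) h1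
      _ = 8 * A * (2 + K) * M ^ 2 / √N := by ring
      _ ≤ _ := by
        gcongr
        have : 0 ≤ c * (A * (2 + K) + 1) := by positivity
        linarith

end SK
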